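/- Córdoba's sectorial square function estimate in the plane: for every exponent p with 2 ≤ p ≤ 4 and every ε > 0 there is a constant C such that for every integer N ≥ 2 and every Schwartz function f on ℝ², ‖ (Σ_{m=0}^{N−1} |Q_{Δ_m} f|²)^{1/2} ‖_{L^p(ℝ²)} ≤ C N^{ε} ‖f‖_{L^p(ℝ²)}, where Δ_m = {ξ ∈ ℝ² \ {0} : 2πm/N ≤ arg ξ < 2π(m+1)/N} are the N equiangular sectors. -/

import Mathlib

/- Córdoba's sectorial square function estimate in the plane: for 2 ≤ p ≤ 4 and ε > 0 there
is C with ‖(Σ_{m<N} |Q_{Δ_m} f|²)^{1/2}‖_{L^p(ℝ²)} ≤ C N^ε ‖f‖_{L^p(ℝ²)} for all N ≥ 2 and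
all Schwartz f, where Δ_m are the N equiangular sectors. -/

open MeasureTheory
open scoped FourierTransform

noncomputable section

/-- The angle of a nonzero vector in ℝ², taken in `[0, 2π)` (with junk value `0` at `0`). -/
def argTwoPi (ξ : EuclideanSpace ℝ (Fin 2)) : ℝ :=
  let a := Complex.arg (((ξ 0 : ℝ) : ℂ) + (ξ 1 : ℝ) * Complex.I)
  if a < 0 then a + 2 * Real.pi else a

/-- The `m`-th of `N` equiangular sectors: `{ξ ≠ 0 : 2πm/N ≤ arg ξ < 2π(m+1)/N}`. -/
def equiangularSector (N m : ℕ) : Set (EuclideanSpace ℝ (Fin 2)) :=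
  {ξ | ξ ≠ 0 ∧ 2 * Real.pi * m / N ≤ argTwoPi ξ ∧ argTwoPi ξ < 2 * Real.pi * (m + 1) / N}

/-- The frequency projection `Q_E f` on ℝ²: the inverse Fourier transform of `χ_E f̂`. -/
def freqProj2 (E : Set (EuclideanSpace ℝ (Fin 2)))
    (f : EuclideanSpace ℝ (Fin 2) → ℂ) : EuclideanSpace ℝ (Fin 2) → ℂ :=
  𝓕⁻ (E.indicator (𝓕 f))

section PlaneSquareFunctions

open Complex ComplexConjugate Set
open scoped Convolution ENNReal NNReal

/-- The Euclidean plane. -/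
abbrev Plane := EuclideanSpace ℝ (Fin 2)

/-- Integrable and pointwise bounded functions on the plane: the class of Fourier-side symbols. -/
structure Nice (α : Plane → ℂ) : Prop where
  integrable : Integrable α
  bdd : ∃ C : ℝ, ∀ ξ, ‖α ξ‖ ≤ C

theorem continuous_neg_innerₗ :
    Continuous fun p : Plane × Plane => (-(innerₗ Plane)) p.1 p.2 := by
  have : Continuous fun p : Plane × Plane => - inner ℝ p.1 p.2 :=
    (continuous_inner (𝕜 := ℝ) (E := Plane)).neg
  exact this

namespace Nice
variable {α β : Plane → ℂ}

theorem memLp_two (h : Nice α) : MemLp α 2 := by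
  obtain ⟨C, hC⟩ := h.bdd
  rw [memLp_two_iff_integrable_sq_norm h.integrable.1]
  simp_rw [sq]
  exact h.integrable.norm.bdd_mul (c := C) h.integrable.norm.1 (by simpa using Filter.Eventually.of_forall hC)

theorem add (h : Nice α) (h' : Nice β) : Nice (α + β) := by
  obtain ⟨C, hC⟩ := h.bdd
  obtain ⟨D, hD⟩ := h'.bdd
  exact ⟨h.integrable.add h'.integrable, C + D, fun ξ => (norm_add_le _ _).trans
    (add_le_add (hC ξ) (hD ξ))⟩

theorem zero : Nice (0 : Plane → ℂ) := ⟨integrable_zero _ _ _, 0, by simp⟩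

theorem mul_bdd {m : Plane → ℂ} (h : Nice α) (hm : Measurable m) {B : ℝ} (hB : ∀ ξ, ‖m ξ‖ ≤ B) :
    Nice (fun ξ => m ξ * α ξ) := by
  obtain ⟨C, hC⟩ := h.bdd
  refine ⟨h.integrable.bdd_mul (c := B) hm.aestronglyMeasurable (Filter.Eventually.of_forall hB), B * C,
    fun ξ => ?_⟩
  rw [norm_mul]
  exact mul_le_mul (hB ξ) (hC ξ) (norm_nonneg _) ((norm_nonneg _).trans (hB ξ))

theorem const_mul (h : Nice α) (c : ℂ) : Nice (fun ξ => c * α ξ) :=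
  h.mul_bdd (m := fun _ => c) measurable_const (B := ‖c‖) (fun _ => le_rfl)

theorem neg (h : Nice α) : Nice (-α) := by
  convert! h.const_mul (-1) using 1
  ext; simp

theorem sub (h : Nice α) (h' : Nice β) : Nice (α - β) := by
  rw [sub_eq_add_neg]; exact h.add h'.neg

theorem sum {ι : Type*} (s : Finset ι) {a : ι → Plane → ℂ} (h : ∀ i ∈ s, Nice (a i)) :
    Nice (∑ i ∈ s, a i) := by
  classical
  induction s using Finset.induction_on with
  | empty => simpa using zero
  | insert i s hi ih =>
    rw [Finset.sum_insert hi]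
    exact (h i (by simp)).add (ih fun j hj => h j (by simp [hj]))

theorem indicator (h : Nice α) {E : Set Plane} (hE : MeasurableSet E) : Nice (E.indicator α) := by
  obtain ⟨C, hC⟩ := h.bdd
  exact ⟨h.integrable.indicator hE, C, fun ξ => (norm_indicator_le_norm_self _ _).trans (hC ξ)⟩

theorem star (h : Nice α) : Nice (fun ξ => conj (α (-ξ))) := by
  obtain ⟨C, hC⟩ := h.bdd
  refine ⟨?_, C, fun ξ => by simpa using hC (-ξ)⟩
  exact (Complex.conjCLE.toContinuousLinearMap.integrable_comp h.integrable.comp_neg)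

theorem conv (h : Nice α) (h' : Nice β) : Nice (α ⋆[ContinuousLinearMap.mul ℂ ℂ, volume] β) := by
  obtain ⟨D, hD⟩ := h'.bdd
  refine ⟨h.integrable.integrable_convolution _ h'.integrable, (∫ ξ, ‖α ξ‖) * D, fun ξ => ?_⟩
  rw [convolution_def, ← integral_mul_const]
  refine norm_integral_le_of_norm_le (h.integrable.norm.mul_const D) (Filter.Eventually.of_forall fun t => ?_)
  simp only [ContinuousLinearMap.mul_apply', norm_mul]
  exact mul_le_mul_of_nonneg_left (hD _) (norm_nonneg _)

theorem continuous_fourierInv (h : Nice α) : Continuous (𝓕⁻ α) :=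
  VectorFourier.fourierIntegral_continuous Real.continuous_fourierChar
    continuous_neg_innerₗ h.integrable

theorem norm_fourierInv_le (α : Plane → ℂ) (x : Plane) : ‖𝓕⁻ α x‖ ≤ ∫ ξ, ‖α ξ‖ :=
  VectorFourier.norm_fourierIntegral_le_integral_norm _ _ _ _ _

theorem fourierInv_add (h : Nice α) (h' : Nice β) : 𝓕⁻ (α + β) = 𝓕⁻ α + 𝓕⁻ β :=
  (VectorFourier.fourierIntegral_add Real.continuous_fourierChar
    continuous_neg_innerₗ h.integrable h'.integrable)

theorem fourierInv_const_mul (c : ℂ) (α : Plane → ℂ) (x : Plane) :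
    𝓕⁻ (fun ξ => c * α ξ) x = c * 𝓕⁻ α x := by
  have := VectorFourier.fourierIntegral_const_smul Real.fourierChar volume
    (-(innerₗ Plane)) α c
  exact congrFun this x

theorem fourierInv_zero : 𝓕⁻ (0 : Plane → ℂ) = 0 := by
  ext x; simp [Real.fourierInv_eq]

theorem fourierInv_neg (α : Plane → ℂ) : 𝓕⁻ (-α) = - 𝓕⁻ α := by
  ext x
  have := fourierInv_const_mul (-1) α x
  simp only [neg_mul, one_mul] at this
  exact this

theorem fourierInv_sub (h : Nice α) (h' : Nice β) : 𝓕⁻ (α - β) = 𝓕⁻ α - 𝓕⁻ β := by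
  rw [sub_eq_add_neg, fourierInv_add h h'.neg, fourierInv_neg, sub_eq_add_neg]

theorem fourierInv_sum {ι : Type*} (s : Finset ι) {a : ι → Plane → ℂ} (h : ∀ i ∈ s, Nice (a i)) :
    𝓕⁻ (∑ i ∈ s, a i) = ∑ i ∈ s, 𝓕⁻ (a i) := by
  classical
  induction s using Finset.induction_on with
  | empty => simpa using fourierInv_zero
  | insert i s hi ih =>
    rw [Finset.sum_insert hi, Finset.sum_insert hi, fourierInv_add (h i (by simp))
      (sum s fun j hj => h j (by simp [hj])), ih fun j hj => h j (by simp [hj])]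

theorem conj_fourierInv (α : Plane → ℂ) (x : Plane) :
    conj (𝓕⁻ α x) = 𝓕⁻ (fun ξ => conj (α (-ξ))) x := by
  rw [Real.fourierInv_eq, Real.fourierInv_eq, ← integral_conj,
    ← integral_neg_eq_self (fun ξ => conj _)]
  congr 1; ext ξ
  simp [Circle.smul_def, ← Circle.coe_inv_eq_conj, AddChar.map_neg_eq_inv]

theorem fourierInv_mul (h : Nice α) (h' : Nice β) (x : Plane) :
    𝓕⁻ α x * 𝓕⁻ β x = 𝓕⁻ (α ⋆[ContinuousLinearMap.mul ℂ ℂ, volume] β) x := by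
  simp_rw [Real.fourierInv_eq_fourier_neg]
  rw [Real.fourier_mul_convolution_eq h.integrable h'.integrable]

theorem integral_fourierInv_mul (h : Nice α) {g : Plane → ℂ} (hg : Integrable g) :
    ∫ x, 𝓕⁻ α x * g x = ∫ ξ, α ξ * 𝓕⁻ g ξ := by
  have := VectorFourier.integral_fourierIntegral_smul_eq_flip (L := -(innerₗ Plane)) (μ := volume)
    (ν := volume) (f := α) (g := g) Real.continuous_fourierChar
    continuous_neg_innerₗ h.integrable hg
  have hflip : (-(innerₗ Plane)).flip = -(innerₗ Plane) := by
    ext x y; simp [real_inner_comm]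
  rw [hflip] at this
  exact this

theorem toLp_fourierInv_ae (h : Nice α) :
    ((𝓕⁻ (h.memLp_two.toLp α) : Lp ℂ 2 (volume : Measure Plane)) : Plane → ℂ) =ᵐ[volume] 𝓕⁻ α := by
  refine ae_eq_of_integral_contDiff_smul_eq ?_ h.continuous_fourierInv.locallyIntegrable ?_
  · exact (Lp.memLp _).locallyIntegrable (by norm_num)
  · intro g hg hgc
    have hgc' : HasCompactSupport (fun x => (g x : ℂ)) :=
      hgc.comp_left (g := ((↑) : ℝ → ℂ)) Complex.ofReal_zero
    let φ : SchwartzMap Plane ℂ := hgc'.toSchwartzMap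
      (by exact_mod_cast Complex.ofRealCLM.contDiff.comp hg)
    have hφ : ∀ x, φ x = (g x : ℂ) := fun x => rfl
    have h1 := congrArg (fun T => T φ) (Lp.fourierInv_toTemperedDistribution_eq (h.memLp_two.toLp α))
    simp only [TemperedDistribution.fourierInv_apply, Lp.toTemperedDistribution_apply] at h1
    have h2 : ∫ x, (𝓕⁻ φ) x • (h.memLp_two.toLp α : Plane → ℂ) x = ∫ x, α x * 𝓕⁻ (φ : Plane → ℂ) x := by
      refine integral_congr_ae ?_
      filter_upwards [h.memLp_two.coeFn_toLp] with x hx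
      rw [hx, SchwartzMap.fourierInv_coe, smul_eq_mul, mul_comm]
    rw [h2, ← h.integral_fourierInv_mul φ.integrable] at h1
    simp only [hφ, Complex.real_smul, smul_eq_mul] at h1 ⊢
    rw [← h1]
    congr 1; ext x; ring

theorem memLp_two_fourierInv (h : Nice α) : MemLp (𝓕⁻ α) 2 :=
  (memLp_congr_ae h.toLp_fourierInv_ae).1 (Lp.memLp _)

theorem plancherel (h : Nice α) (h' : Nice β) :
    ∫ x, 𝓕⁻ α x * conj (𝓕⁻ β x) = ∫ ξ, α ξ * conj (β ξ) := by
  have key := Lp.inner_fourier_eq (𝓕⁻ (h'.memLp_two.toLp β) : Lp ℂ 2 (volume : Measure Plane))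
    (𝓕⁻ (h.memLp_two.toLp α) : Lp ℂ 2 (volume : Measure Plane))
  rw [FourierTransform.fourier_fourierInv_eq, FourierTransform.fourier_fourierInv_eq] at key
  rw [L2.inner_def, L2.inner_def] at key
  have h1 : ∫ x, 𝓕⁻ α x * conj (𝓕⁻ β x) = ∫ a, inner ℂ
      ((𝓕⁻ (h'.memLp_two.toLp β) : Lp ℂ 2 (volume : Measure Plane)) a)
      ((𝓕⁻ (h.memLp_two.toLp α) : Lp ℂ 2 (volume : Measure Plane)) a) := by
    refine integral_congr_ae ?_
    filter_upwards [h.toLp_fourierInv_ae, h'.toLp_fourierInv_ae] with x hx hx'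
    rw [hx, hx', RCLike.inner_apply]
  rw [h1, ← key]
  refine integral_congr_ae ?_
  filter_upwards [h.memLp_two.coeFn_toLp, h'.memLp_two.coeFn_toLp] with x hx hx'
  rw [hx, hx', RCLike.inner_apply]

theorem plancherel_sq (h : Nice α) : ∫ x, ‖𝓕⁻ α x‖ ^ 2 = ∫ ξ, ‖α ξ‖ ^ 2 := by
  have := h.plancherel h
  simp_rw [Complex.mul_conj'] at this
  exact_mod_cast this

end Nice

/-- Continuous, bounded and square integrable real functions. -/
structure Good (u : Plane → ℝ) : Prop where
  cont : Continuous u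
  bdd : ∃ C : ℝ, ∀ x, |u x| ≤ C
  memLp : MemLp u 2

namespace Good
variable {u v : Plane → ℝ}

theorem add (hu : Good u) (hv : Good v) : Good (fun x => u x + v x) := by
  obtain ⟨C, hC⟩ := hu.bdd
  obtain ⟨D, hD⟩ := hv.bdd
  exact ⟨hu.cont.add hv.cont, ⟨C + D, fun x => (abs_add_le _ _).trans (add_le_add (hC x) (hD x))⟩,
    hu.memLp.add hv.memLp⟩

theorem zero : Good (fun _ => 0) := ⟨continuous_const, ⟨0, by simp⟩, MemLp.zero'⟩

theorem mul (hu : Good u) (hv : Good v) : Good (fun x => u x * v x) := by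
  obtain ⟨C, hC⟩ := hu.bdd
  obtain ⟨D, hD⟩ := hv.bdd
  refine ⟨hu.cont.mul hv.cont, ⟨C * D, fun x => ?_⟩, ?_⟩
  · rw [abs_mul]
    exact mul_le_mul (hC x) (hD x) (abs_nonneg _) ((abs_nonneg _).trans (hC x))
  · refine (hv.memLp.const_mul C).mono (hu.cont.mul hv.cont).aestronglyMeasurable
      (Filter.Eventually.of_forall fun x => ?_)
    simp only [norm_mul, Real.norm_eq_abs]
    exact mul_le_mul_of_nonneg_right ((hC x).trans (le_abs_self _)) (abs_nonneg _)

theorem sq (hu : Good u) : Good (fun x => u x ^ 2) := by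
  simpa [_root_.sq] using hu.mul hu

theorem sum {ι : Type*} (s : Finset ι) {a : ι → Plane → ℝ} (h : ∀ i ∈ s, Good (a i)) :
    Good (fun x => ∑ i ∈ s, a i x) := by
  classical
  induction s using Finset.induction_on with
  | empty => simpa using zero
  | insert i s hi ih =>
    simp_rw [Finset.sum_insert hi]
    exact (h i (by simp)).add (ih fun j hj => h j (by simp [hj]))

theorem integrable_mul (hu : Good u) (hv : Good v) : Integrable (fun x => u x * v x) :=
  hu.memLp.integrable_mul hv.memLp

theorem integrable_sq (hu : Good u) : Integrable (fun x => u x ^ 2) := by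
  simpa [_root_.sq] using hu.integrable_mul hu

end Good

namespace Nice
variable {α β : Plane → ℂ}

theorem good_norm (h : Nice α) : Good (fun x => ‖𝓕⁻ α x‖) :=
  ⟨h.continuous_fourierInv.norm, ⟨_, fun x => by simpa using norm_fourierInv_le α x⟩,
    h.memLp_two_fourierInv.norm⟩

theorem good_sq (h : Nice α) : Good (fun x => ‖𝓕⁻ α x‖ ^ 2) := h.good_norm.sq

theorem good_sum_sq {ι : Type*} (s : Finset ι) {a : ι → Plane → ℂ} (h : ∀ i ∈ s, Nice (a i)) :
    Good (fun x => ∑ i ∈ s, ‖𝓕⁻ (a i) x‖ ^ 2) := Good.sum s fun i hi => (h i hi).good_sq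

theorem integrable_norm_sq (h : Nice α) : Integrable (fun ξ => ‖α ξ‖ ^ 2) :=
  (memLp_two_iff_integrable_sq_norm h.integrable.1).1 h.memLp_two

theorem normSq_eq (h : Nice α) : ∃ γ, Nice γ ∧ ∀ x, ((‖𝓕⁻ α x‖ ^ 2 : ℝ) : ℂ) = 𝓕⁻ γ x := by
  refine ⟨_, h.conv h.star, fun x => ?_⟩
  rw [← fourierInv_mul h h.star, ← conj_fourierInv, Complex.mul_conj']
  simp

theorem sum_normSq_eq {ι : Type*} (s : Finset ι) {a : ι → Plane → ℂ} (h : ∀ i ∈ s, Nice (a i)) :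
    ∃ γ, Nice γ ∧ ∀ x, ((∑ i ∈ s, ‖𝓕⁻ (a i) x‖ ^ 2 : ℝ) : ℂ) = 𝓕⁻ γ x := by
  classical
  induction s using Finset.induction_on with
  | empty => exact ⟨0, zero, by simp [fourierInv_zero]⟩
  | insert i s hi ih =>
    obtain ⟨γ, hγ, h1⟩ := ih fun j hj => h j (by simp [hj])
    obtain ⟨δ, hδ, h2⟩ := (h i (by simp)).normSq_eq
    refine ⟨δ + γ, hδ.add hγ, fun x => ?_⟩
    rw [Finset.sum_insert hi, fourierInv_add hδ hγ, Complex.ofReal_add, h1, h2]; rfl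

theorem ae_eq_of_fourierInv_eq (h : Nice α) (h' : Nice β) (he : ∀ x, 𝓕⁻ α x = 𝓕⁻ β x) :
    α =ᵐ[volume] β := by
  have h1 := (h.sub h').plancherel_sq
  rw [fourierInv_sub h h'] at h1
  simp only [Pi.sub_apply, he, sub_self, norm_zero, ne_eq, OfNat.ofNat_ne_zero, not_false_eq_true,
    zero_pow, integral_zero] at h1
  have h2 := (integral_eq_zero_iff_of_nonneg (fun ξ => by positivity)
    (h.sub h').integrable_norm_sq).1 h1.symm
  filter_upwards [h2] with ξ hξ
  simpa [sub_eq_zero] using hξ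

end Nice

theorem measurableSet_halfPlane (a : Plane) (b : ℝ) : MeasurableSet {ξ : Plane | b ≤ inner ℝ ξ a} :=
  measurableSet_le measurable_const (by fun_prop)

theorem volume_line_eq_zero {a : Plane} (ha : a ≠ 0) :
    volume {ξ : Plane | inner ℝ ξ a = 0} = 0 := by
  have := Measure.addHaar_submodule (volume : Measure Plane) (LinearMap.ker (innerₗ Plane a)) (by
    intro h
    have : a ∈ LinearMap.ker (innerₗ Plane a) := h ▸ Submodule.mem_top
    simp [ha] at this)
  convert! this using 2
  ext ξ
  simp [real_inner_comm]

/-- A Cotlar type identity, in the form of an inequality. -/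
theorem integral_normSq_halfPlane_mul_le {α γ : Plane → ℂ} (hα : Nice α) (hγ : Nice γ)
    (hreal : ∀ x, conj (𝓕⁻ γ x) = 𝓕⁻ γ x) {a : Plane} (ha : a ≠ 0) (b : ℝ) :
    ∫ x, ‖𝓕⁻ ({ξ : Plane | b ≤ inner ℝ ξ a}.indicator α) x‖ ^ 2 * (𝓕⁻ γ x).re ≤
      2 * ∫ x, ‖𝓕⁻ α x‖ * ‖𝓕⁻ ({ξ : Plane | b ≤ inner ℝ ξ a}.indicator α) x‖ *
        ‖𝓕⁻ ({ξ : Plane | 0 ≤ inner ℝ ξ a}.indicator γ) x‖ := by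
  set H := {ξ : Plane | b ≤ inner ℝ ξ a} with hH
  set H0 := {ξ : Plane | 0 ≤ inner ℝ ξ a} with hH0
  have hHm : MeasurableSet H := measurableSet_halfPlane a b
  have hH0m : MeasurableSet H0 := measurableSet_halfPlane a 0
  have hβ : Nice (H.indicator α) := hα.indicator hHm
  have hδ : Nice (Hᶜ.indicator α) := hα.indicator hHm.compl
  have hp : Nice (H0.indicator γ) := hγ.indicator hH0m
  set G := 𝓕⁻ (H.indicator α) with hG
  set P := 𝓕⁻ (H0.indicator γ) with hP
  have hF : ∀ x, 𝓕⁻ α x = G x + 𝓕⁻ (Hᶜ.indicator α) x := by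
    intro x
    have : α = H.indicator α + Hᶜ.indicator α := (indicator_self_add_compl H α).symm
    conv_lhs => rw [this, Nice.fourierInv_add hβ hδ]
    rfl
  -- orthogonality
  have horth : ∫ x, 𝓕⁻ (Hᶜ.indicator α) x * conj (G x) * conj (P x) = 0 := by
    have h1 : ∀ x, 𝓕⁻ (Hᶜ.indicator α) x * conj (G x) =
        𝓕⁻ (Hᶜ.indicator α ⋆[ContinuousLinearMap.mul ℂ ℂ, volume]
          fun ξ => conj (H.indicator α (-ξ))) x := by
      intro x
      rw [hG, Nice.conj_fourierInv, Nice.fourierInv_mul hδ hβ.star]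
    simp_rw [h1]
    rw [(hδ.conv hβ.star).plancherel hp]
    rw [← integral_zero Plane ℂ (μ := volume)]
    congr 1
    ext ξ
    by_cases hξ : ξ ∈ H0
    swap
    · simp [indicator_of_notMem hξ]
    rw [convolution_def]
    have : (fun t => ContinuousLinearMap.mul ℂ ℂ (Hᶜ.indicator α t)
        (conj (H.indicator α (-(ξ - t))))) = 0 := by
      ext t
      by_cases ht : t ∈ Hᶜ
      swap
      · simp [indicator_of_notMem ht]
      by_cases ht' : -(ξ - t) ∈ H
      · simp only [hH, hH0, mem_ofPred_eq, mem_compl_iff, not_le, neg_sub, inner_sub_left] at ht ht' hξ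
        linarith
      · rw [indicator_of_notMem ht']; simp
    rw [this]; simp
  have hstar : γ =ᵐ[volume] fun ξ => conj (γ (-ξ)) :=
    hγ.ae_eq_of_fourierInv_eq hγ.star fun x => by rw [← Nice.conj_fourierInv, hreal]
  have hsum : ∀ x, 𝓕⁻ γ x = P x + conj (P x) := by
    intro x
    rw [hP, Nice.conj_fourierInv]
    change _ = (𝓕⁻ (H0.indicator γ) + 𝓕⁻ _) x
    rw [← Nice.fourierInv_add hp hp.star]
    refine Real.fourierInv_congr_ae ?_ x
    have hline : ∀ᵐ ξ : Plane, inner ℝ ξ a ≠ 0 := by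
      simpa [ae_iff] using volume_line_eq_zero ha
    filter_upwards [hstar, hline] with ξ h1 h2
    rcases lt_or_gt_of_ne h2 with h | h
    · have m1 : ξ ∉ H0 := by simpa [hH0] using h
      have m2 : -ξ ∈ H0 := by simpa [hH0] using h.le
      simp [indicator_of_notMem m1, indicator_of_mem m2, ← h1]
    · have m1 : ξ ∈ H0 := h.le
      have m2 : -ξ ∉ H0 := by simpa [hH0] using h
      simp [indicator_of_notMem m2, indicator_of_mem m1]
  have hre : ∀ x, ‖G x‖ ^ 2 * (𝓕⁻ γ x).re = 2 * (G x * conj (G x) * conj (P x)).re := by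
    intro x
    rw [hsum, Complex.mul_conj', ← Complex.ofReal_pow, Complex.re_ofReal_mul]
    simp; ring
  have hGPi : ∀ {δ : Plane → ℂ}, Nice δ → Integrable (fun x => 𝓕⁻ δ x * conj (G x) * conj (P x)) := by
    intro δ hδ
    refine ((hδ.good_norm.mul hβ.good_norm).integrable_mul hp.good_norm).mono' ?_ ?_
    · exact (((hδ.continuous_fourierInv).mul (Complex.continuous_conj.comp hβ.continuous_fourierInv)).mul
        (Complex.continuous_conj.comp hp.continuous_fourierInv)).aestronglyMeasurable
    · exact Filter.Eventually.of_forall fun x => by simp [hG, hP]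
  have heq : ∫ x, G x * conj (G x) * conj (P x) = ∫ x, 𝓕⁻ α x * conj (G x) * conj (P x) := by
    rw [← sub_eq_zero, ← neg_eq_zero, neg_sub, ← integral_sub (hGPi hα) (hGPi hβ), ← horth]
    congr 1; ext x; rw [hF]; ring
  simp_rw [hre]
  rw [integral_const_mul]
  refine mul_le_mul_of_nonneg_left ?_ (by norm_num)
  have : ∫ x, (G x * conj (G x) * conj (P x)).re = (∫ x, G x * conj (G x) * conj (P x)).re :=
    integral_re (hGPi hβ)
  rw [this, heq]
  refine (Complex.re_le_norm _).trans ((norm_integral_le_integral_norm _).trans (le_of_eq ?_))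
  congr 1; ext x; simp

/-- A Rademacher–Menshov inequality for half planes rotating monotonically. -/
theorem exists_maximal_halfPlane (n : ℕ) : ∀ (A : ℕ → Plane),
    (∀ ξ, Monotone (fun m => (inner ℝ ξ (A m) : ℝ)) ∨ Antitone (fun m => (inner ℝ ξ (A m) : ℝ))) →
    ∀ γ : Plane → ℂ, Nice γ → ∃ M : Plane → ℝ, Integrable M ∧ (∀ x, 0 ≤ M x) ∧
      (∀ m < 2 ^ n, ∀ x, ‖𝓕⁻ ({ξ : Plane | 0 ≤ inner ℝ ξ (A m)}.indicator γ) x‖ ^ 2 ≤ M x) ∧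
      ∫ x, M x ≤ (n + 1) ^ 2 * ∫ ξ, ‖γ ξ‖ ^ 2 := by
  induction n with
  | zero =>
    intro A _ γ hγ
    have h0 := hγ.indicator (measurableSet_halfPlane (A 0) 0)
    refine ⟨fun x => ‖𝓕⁻ ({ξ : Plane | 0 ≤ inner ℝ ξ (A 0)}.indicator γ) x‖ ^ 2,
      h0.good_norm.integrable_sq, fun x => by positivity, ?_, ?_⟩
    · intro m hm x
      obtain rfl : m = 0 := by simpa using hm
      rfl
    · rw [h0.plancherel_sq]
      simp only [Nat.cast_zero, zero_add, one_pow, one_mul]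
      refine integral_mono h0.integrable_norm_sq hγ.integrable_norm_sq fun ξ => ?_
      gcongr
      exact norm_indicator_le_norm_self _ _
  | succ n ih =>
    intro A hA γ hγ
    obtain ⟨M, hMi, hM0, hM, hMle⟩ := ih (fun m => A (2 * m)) (fun ξ => by
      rcases hA ξ with h | h
      · exact Or.inl (h.comp (fun a b hab => by simpa using hab))
      · exact Or.inr (h.comp_monotone (fun a b hab => by simpa using hab))) γ hγ
    set H : ℕ → Set Plane := fun m => {ξ : Plane | 0 ≤ inner ℝ ξ (A m)} with hH
    have hHm : ∀ m, MeasurableSet (H m) := fun m => measurableSet_halfPlane _ _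
    have hN : ∀ m, Nice ((H m).indicator γ) := fun m => hγ.indicator (hHm m)
    set d : ℕ → Plane → ℂ := fun j => (H (2 * j + 1)).indicator γ - (H (2 * j)).indicator γ with hd
    have hdN : ∀ j, Nice (d j) := fun j => (hN _).sub (hN _)
    have hI : 0 ≤ ∫ ξ, ‖γ ξ‖ ^ 2 := integral_nonneg fun ξ => by positivity
    -- pointwise bound for the sum of squared differences
    have hsum : ∀ k ξ, ∑ j ∈ Finset.range k, ‖d j ξ‖ ^ 2 ≤ ‖γ ξ‖ ^ 2 := by
      intro k ξ
      classical
      let c : ℕ → ℝ := fun m => if ξ ∈ H m then 1 else 0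
      have hc01 : ∀ m, 0 ≤ c m ∧ c m ≤ 1 := fun m => by
        simp only [c]; split_ifs <;> norm_num
      have hdc : ∀ j, ‖d j ξ‖ ^ 2 = (c (2 * j + 1) - c (2 * j)) ^ 2 * ‖γ ξ‖ ^ 2 := by
        intro j
        simp only [hd, Pi.sub_apply, indicator_apply, c]
        split_ifs <;> simp
      simp_rw [hdc]
      rw [← Finset.sum_mul]
      refine mul_le_of_le_one_left (by positivity) ?_
      have hcm : Monotone c ∨ Antitone c := by
        rcases hA ξ with h | h
        · left
          intro a b hab
          have hab' : inner ℝ ξ (A a) ≤ inner ℝ ξ (A b) := h hab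
          simp only [c]
          split_ifs with h1 h2 h2
          · exact le_rfl
          · exact absurd (le_trans h1 hab') h2
          · norm_num
          · exact le_rfl
        · right
          intro a b hab
          have hab' : inner ℝ ξ (A b) ≤ inner ℝ ξ (A a) := h hab
          simp only [c]
          split_ifs with h1 h2 h2
          · exact le_rfl
          · exact absurd (le_trans h1 hab') h2
          · norm_num
          · exact le_rfl
      rcases hcm with h | h
      · have : ∀ k, ∑ j ∈ Finset.range k, (c (2 * j + 1) - c (2 * j)) ^ 2 ≤ c (2 * k) - c 0 := by
          intro k
          induction k with
          | zero => simp
          | succ k ihk =>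
            rw [Finset.sum_range_succ]
            have h1 : c (2 * k) ≤ c (2 * k + 1) := h (by omega)
            have h2 : c (2 * k + 1) ≤ c (2 * (k + 1)) := h (by omega)
            nlinarith [hc01 (2 * k), hc01 (2 * k + 1)]
        linarith [this k, hc01 (2 * k), hc01 0]
      · have : ∀ k, ∑ j ∈ Finset.range k, (c (2 * j + 1) - c (2 * j)) ^ 2 ≤ c 0 - c (2 * k) := by
          intro k
          induction k with
          | zero => simp
          | succ k ihk =>
            rw [Finset.sum_range_succ]
            have h1 : c (2 * k + 1) ≤ c (2 * k) := h (by omega)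
            have h2 : c (2 * (k + 1)) ≤ c (2 * k + 1) := h (by omega)
            nlinarith [hc01 (2 * k), hc01 (2 * k + 1)]
        linarith [this k, hc01 (2 * k), hc01 0]
    have hn : (0 : ℝ) < n + 1 := by positivity
    refine ⟨fun x => ((n + 2) / (n + 1) : ℝ) * M x +
      (n + 2) * ∑ j ∈ Finset.range (2 ^ n), ‖𝓕⁻ (d j) x‖ ^ 2, ?_, ?_, ?_, ?_⟩
    · refine (hMi.const_mul _).add (Integrable.const_mul ?_ _)
      exact integrable_finsetSum _ fun j _ => (hdN j).good_norm.integrable_sq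
    · intro x
      have := hM0 x
      positivity
    · intro m hm x
      have hjm : m / 2 < 2 ^ n := by rw [pow_succ] at hm; omega
      have h0 := hM (m / 2) hjm x
      have hS : ‖𝓕⁻ (d (m / 2)) x‖ ^ 2 ≤ ∑ j ∈ Finset.range (2 ^ n), ‖𝓕⁻ (d j) x‖ ^ 2 :=
        Finset.single_le_sum (f := fun j => ‖𝓕⁻ (d j) x‖ ^ 2) (fun j _ => by positivity)
          (Finset.mem_range.2 hjm)
      have hSn : ∀ S : ℝ, 0 ≤ S → ‖𝓕⁻ ((H (2 * (m / 2))).indicator γ) x‖ ^ 2 ≤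
          ((n + 2) / (n + 1) : ℝ) * M x + (n + 2) * S := by
        intro S hS
        refine h0.trans ?_
        have : (1 : ℝ) ≤ (n + 2) / (n + 1) := by rw [le_div_iff₀ hn]; linarith
        have h3 := mul_le_mul_of_nonneg_right this (hM0 x)
        have : (0 : ℝ) ≤ (n + 2) * S := by positivity
        linarith
      rcases Nat.even_or_odd' m with ⟨j, hj | hj⟩
      · have : 2 * (m / 2) = m := by omega
        have h5 := hSn _ ((by positivity : (0 : ℝ) ≤ ‖𝓕⁻ (d (m / 2)) x‖ ^ 2).trans hS)
        rwa [this] at h5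
      · have h6 : 2 * (m / 2) + 1 = m := by omega
        have hadd : (H m).indicator γ = (H (2 * (m / 2))).indicator γ + d (m / 2) := by
          simp only [hd, h6]; abel
        change ‖𝓕⁻ ((H m).indicator γ) x‖ ^ 2 ≤ _
        rw [hadd, Nice.fourierInv_add (hN _) (hdN _), Pi.add_apply]
        set u := ‖𝓕⁻ ((H (2 * (m / 2))).indicator γ) x‖ with hu
        set v := ‖𝓕⁻ (d (m / 2)) x‖ with hv
        have h7 : ‖𝓕⁻ ((H (2 * (m / 2))).indicator γ) x + 𝓕⁻ (d (m / 2)) x‖ ≤ u + v :=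
          norm_add_le _ _
        have h8 : (u + v) ^ 2 ≤ ((n + 2) / (n + 1) : ℝ) * u ^ 2 + (n + 2) * v ^ 2 := by
          have : ((n + 2) / (n + 1) : ℝ) * u ^ 2 + (n + 2) * v ^ 2 - (u + v) ^ 2 =
            (u - (n + 1) * v) ^ 2 / (n + 1) := by field_simp; ring
          have h9 : 0 ≤ (u - (n + 1) * v) ^ 2 / (n + 1) := by positivity
          linarith
        calc _ ≤ (u + v) ^ 2 := by gcongr
          _ ≤ _ := h8
          _ ≤ _ := add_le_add (mul_le_mul_of_nonneg_left h0 (by positivity))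
            (mul_le_mul_of_nonneg_left hS (by positivity))
    · rw [integral_add (hMi.const_mul _) (Integrable.const_mul
        (integrable_finsetSum _ fun j _ => (hdN j).good_norm.integrable_sq) _), integral_const_mul,
        integral_const_mul, integral_finsetSum _ fun j _ => (hdN j).good_norm.integrable_sq]
      have h1 : ∑ j ∈ Finset.range (2 ^ n), ∫ x, ‖𝓕⁻ (d j) x‖ ^ 2 ≤ ∫ ξ, ‖γ ξ‖ ^ 2 := by
        simp_rw [(hdN _).plancherel_sq]
        rw [← integral_finsetSum _ fun j _ => (hdN j).integrable_norm_sq]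
        exact integral_mono (integrable_finsetSum _ fun j _ => (hdN j).integrable_norm_sq)
          hγ.integrable_norm_sq (hsum _)
      have h2 : ((n + 2) / (n + 1) : ℝ) * ∫ x, M x ≤ (n + 2) * (n + 1) * ∫ ξ, ‖γ ξ‖ ^ 2 := by
        calc _ ≤ ((n + 2) / (n + 1) : ℝ) * ((n + 1) ^ 2 * ∫ ξ, ‖γ ξ‖ ^ 2) := by gcongr
          _ = _ := by field_simp
      have h3 : ((n : ℝ) + 2) * ∑ j ∈ Finset.range (2 ^ n), ∫ x, ‖𝓕⁻ (d j) x‖ ^ 2 ≤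
        (n + 2) * ∫ ξ, ‖γ ξ‖ ^ 2 := by gcongr
      push_cast
      nlinarith

/-- Meyer's vector-valued half-plane inequality in `L⁴`, for a monotonically rotating family. -/
theorem meyer_halfPlane {ι : Type*} (s : Finset ι) {α : ι → Plane → ℂ} (hα : ∀ i, Nice (α i))
    (n : ℕ) {A : ℕ → Plane} (hA0 : ∀ m, A m ≠ 0)
    (hA : ∀ ξ, Monotone (fun m => (inner ℝ ξ (A m) : ℝ)) ∨ Antitone (fun m => (inner ℝ ξ (A m) : ℝ)))
    (m : ι → ℕ) (hm : ∀ i ∈ s, m i < 2 ^ n) (b : ι → ℝ) :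
    ∫ x, (∑ i ∈ s, ‖𝓕⁻ ({ξ : Plane | b i ≤ inner ℝ ξ (A (m i))}.indicator (α i)) x‖ ^ 2) ^ 2 ≤
      32 * ((n + 1) ^ 2) ^ 2 * ∫ x, (∑ i ∈ s, ‖𝓕⁻ (α i) x‖ ^ 2) ^ 2 := by
  set H : ι → Set Plane := fun i => {ξ : Plane | b i ≤ inner ℝ ξ (A (m i))} with hH
  have hβ : ∀ i, Nice ((H i).indicator (α i)) := fun i => (hα i).indicator (measurableSet_halfPlane _ _)
  set F : ι → Plane → ℝ := fun i x => ‖𝓕⁻ (α i) x‖ with hF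
  set G : ι → Plane → ℝ := fun i x => ‖𝓕⁻ ((H i).indicator (α i)) x‖ with hG
  have hFg : ∀ i, Good (F i) := fun i => (hα i).good_norm
  have hGg : ∀ i, Good (G i) := fun i => (hβ i).good_norm
  set a : Plane → ℝ := fun x => ∑ i ∈ s, F i x ^ 2 with ha
  set B : Plane → ℝ := fun x => ∑ i ∈ s, G i x ^ 2 with hB
  have hag : Good a := Good.sum s fun i _ => (hFg i).sq
  have hBg : Good B := Good.sum s fun i _ => (hGg i).sq
  obtain ⟨γ, hγ, hγB⟩ := Nice.sum_normSq_eq s (a := fun i => (H i).indicator (α i)) fun i _ => hβ i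
  have hγB' : ∀ x, 𝓕⁻ γ x = (B x : ℂ) := fun x => (hγB x).symm
  obtain ⟨M, hMi, hM0, hM, hMle⟩ := exists_maximal_halfPlane n A hA γ hγ
  have hγsq : ∫ ξ, ‖γ ξ‖ ^ 2 = ∫ x, B x ^ 2 := by
    rw [← hγ.plancherel_sq]; simp [hγB']
  rw [hγsq] at hMle
  set P : ι → Plane → ℝ := fun i x => ‖𝓕⁻ ({ξ : Plane | 0 ≤ inner ℝ ξ (A (m i))}.indicator γ) x‖ with hP
  have hPg : ∀ i, Good (P i) := fun i => (hγ.indicator (measurableSet_halfPlane _ _)).good_norm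
  have h1 : ∀ i, ∫ x, G i x ^ 2 * B x ≤ 2 * ∫ x, F i x * G i x * P i x := by
    intro i
    have := integral_normSq_halfPlane_mul_le (hα i) hγ (fun x => by simp [hγB']) (hA0 (m i)) (b i)
    simpa [hγB'] using this
  have h2 : ∫ x, B x ^ 2 ≤ ∫ x, 2 * ∑ i ∈ s, F i x * G i x * P i x := by
    have e1 : ∫ x, B x ^ 2 = ∑ i ∈ s, ∫ x, G i x ^ 2 * B x := by
      rw [← integral_finsetSum _ fun i _ => (hGg i).sq.integrable_mul hBg]
      congr 1; ext x
      rw [sq, ← Finset.sum_mul]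
    rw [e1, integral_const_mul, integral_finsetSum _ fun i _ =>
      ((hFg i).mul (hGg i)).integrable_mul (hPg i), Finset.mul_sum]
    exact Finset.sum_le_sum fun i _ => h1 i
  set L : ℝ := (n + 1) ^ 2 with hL
  have hLpos : 0 < L := by positivity
  have h3 : ∀ x, 2 * ∑ i ∈ s, F i x * G i x * P i x ≤
      (1 / (4 * L)) * M x + (1 / 4 * B x ^ 2 + 16 * L ^ 2 * a x ^ 2) := by
    intro x
    set S := ∑ i ∈ s, F i x * G i x with hS
    set p := Real.sqrt (M x) with hp
    have hpM : p ^ 2 = M x := Real.sq_sqrt (hM0 x)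
    have hS0 : 0 ≤ S := Finset.sum_nonneg fun i _ => mul_nonneg (norm_nonneg _) (norm_nonneg _)
    have c1 : ∑ i ∈ s, F i x * G i x * P i x ≤ S * p := by
      rw [hS, Finset.sum_mul]
      refine Finset.sum_le_sum fun i hi => ?_
      exact mul_le_mul_of_nonneg_left (Real.le_sqrt_of_sq_le (hM _ (hm i hi) x))
        (mul_nonneg (norm_nonneg _) (norm_nonneg _))
    have c2 : S ^ 2 ≤ a x * B x := Finset.sum_mul_sq_le_sq_mul_sq s _ _
    have c3 : 2 * (S * p) ≤ (1 / (4 * L)) * p ^ 2 + 4 * L * S ^ 2 := by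
      have e : (1 / (4 * L)) * p ^ 2 + 4 * L * S ^ 2 - 2 * (S * p) = (p - 4 * L * S) ^ 2 / (4 * L) := by
        field_simp; ring
      have : 0 ≤ (p - 4 * L * S) ^ 2 / (4 * L) := by positivity
      linarith
    have c4 : 4 * L * S ^ 2 ≤ 4 * L * (a x * B x) := by gcongr
    have c5 : 0 ≤ (B x / 2 - 4 * L * a x) ^ 2 := sq_nonneg _
    have c6 : (B x / 2 - 4 * L * a x) ^ 2 = 1 / 4 * B x ^ 2 - 4 * L * (a x * B x)
      + 16 * L ^ 2 * a x ^ 2 := by ring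
    rw [← hpM]
    linarith
  have h4 : ∫ x, 2 * ∑ i ∈ s, F i x * G i x * P i x ≤
      (1 / (4 * L)) * (∫ x, M x) + (1 / 4 * (∫ x, B x ^ 2) + 16 * L ^ 2 * ∫ x, a x ^ 2) := by
    have i1 := hMi.const_mul (1 / (4 * L))
    have i2 := hBg.integrable_sq.const_mul (1 / 4)
    have i3 := hag.integrable_sq.const_mul (16 * L ^ 2)
    have i4 := integrable_finsetSum s fun i _ => ((hFg i).mul (hGg i)).integrable_mul (hPg i)
    have i5 : Integrable fun x => 1 / 4 * B x ^ 2 + 16 * L ^ 2 * a x ^ 2 := i2.add i3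
    rw [← integral_const_mul, ← integral_const_mul, ← integral_const_mul, ← integral_add i2 i3,
      ← integral_add i1 i5]
    exact integral_mono (i4.const_mul 2) (i1.add i5) h3
  have h5 : (1 / (4 * L)) * ∫ x, M x ≤ 1 / 4 * ∫ x, B x ^ 2 := by
    calc _ ≤ (1 / (4 * L)) * (L * ∫ x, B x ^ 2) := by gcongr
      _ = _ := by field_simp
  change ∫ x, B x ^ 2 ≤ 32 * L ^ 2 * ∫ x, a x ^ 2
  linarith

/-- The version of `meyer_halfPlane` for the complementary half planes. -/
theorem meyer_halfPlane_compl {ι : Type*} (s : Finset ι) {α : ι → Plane → ℂ} (hα : ∀ i, Nice (α i))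
    (n : ℕ) {A : ℕ → Plane} (hA0 : ∀ m, A m ≠ 0)
    (hA : ∀ ξ, Monotone (fun m => (inner ℝ ξ (A m) : ℝ)) ∨ Antitone (fun m => (inner ℝ ξ (A m) : ℝ)))
    (m : ι → ℕ) (hm : ∀ i ∈ s, m i < 2 ^ n) (b : ι → ℝ) :
    ∫ x, (∑ i ∈ s, ‖𝓕⁻ ({ξ : Plane | b i ≤ inner ℝ ξ (A (m i))}ᶜ.indicator (α i)) x‖ ^ 2) ^ 2 ≤
      264 * ((n + 1) ^ 2) ^ 2 * ∫ x, (∑ i ∈ s, ‖𝓕⁻ (α i) x‖ ^ 2) ^ 2 := by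
  have key := meyer_halfPlane s hα n hA0 hA m hm b
  set H : ι → Set Plane := fun i => {ξ : Plane | b i ≤ inner ℝ ξ (A (m i))} with hH
  have hHm : ∀ i, MeasurableSet (H i) := fun i => measurableSet_halfPlane _ _
  have hβ : ∀ i, Nice ((H i).indicator (α i)) := fun i => (hα i).indicator (hHm i)
  have hβ' : ∀ i, Nice ((H i)ᶜ.indicator (α i)) := fun i => (hα i).indicator (hHm i).compl
  set a : Plane → ℝ := fun x => ∑ i ∈ s, ‖𝓕⁻ (α i) x‖ ^ 2 with ha
  set B : Plane → ℝ := fun x => ∑ i ∈ s, ‖𝓕⁻ ((H i).indicator (α i)) x‖ ^ 2 with hB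
  set B' : Plane → ℝ := fun x => ∑ i ∈ s, ‖𝓕⁻ ((H i)ᶜ.indicator (α i)) x‖ ^ 2 with hB'
  have hag : Good a := Nice.good_sum_sq s fun i _ => hα i
  have hBg : Good B := Nice.good_sum_sq s fun i _ => hβ i
  have hBg' : Good B' := Nice.good_sum_sq s fun i _ => hβ' i
  have h1 : ∀ x, B' x ≤ 2 * a x + 2 * B x := by
    intro x
    simp only [ha, hB, hB', Finset.mul_sum, ← Finset.sum_add_distrib]
    refine Finset.sum_le_sum fun i _ => ?_
    have e : (H i)ᶜ.indicator (α i) = α i - (H i).indicator (α i) := indicator_compl _ _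
    rw [e, Nice.fourierInv_sub (hα i) (hβ i), Pi.sub_apply]
    have h := norm_sub_le (𝓕⁻ (α i) x) (𝓕⁻ ((H i).indicator (α i)) x)
    have h0 := norm_nonneg (𝓕⁻ (α i) x - 𝓕⁻ ((H i).indicator (α i)) x)
    nlinarith [sq_nonneg (‖𝓕⁻ (α i) x‖ - ‖𝓕⁻ ((H i).indicator (α i)) x‖)]
  have hB'0 : ∀ x, 0 ≤ B' x := fun x => Finset.sum_nonneg fun i _ => by positivity
  have h2 : ∫ x, B' x ^ 2 ≤ ∫ x, (8 * a x ^ 2 + 8 * B x ^ 2) := by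
    refine integral_mono hBg'.integrable_sq ((hag.integrable_sq.const_mul 8).add
      (hBg.integrable_sq.const_mul 8)) fun x => ?_
    have := h1 x
    have := hB'0 x
    change B' x ^ 2 ≤ 8 * a x ^ 2 + 8 * B x ^ 2
    nlinarith [sq_nonneg (a x - B x)]
  rw [integral_add (hag.integrable_sq.const_mul 8) (hBg.integrable_sq.const_mul 8),
    integral_const_mul, integral_const_mul] at h2
  change ∫ x, B x ^ 2 ≤ _ * ∫ x, a x ^ 2 at key
  change ∫ x, B' x ^ 2 ≤ _ * ∫ x, a x ^ 2
  have h3 : 0 ≤ ∫ x, a x ^ 2 := integral_nonneg fun x => by positivity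
  have h4 : (1 : ℝ) ≤ ((n + 1) ^ 2) ^ 2 := by
    have : (1 : ℝ) ≤ n + 1 := by simp
    exact one_le_pow₀ (one_le_pow₀ this)
  nlinarith

/-- The Cauchy (Poisson) kernel on the line, up to normalization. -/
def cauchyKer (s : ℝ) : ℝ := (1 + s ^ 2)⁻¹

theorem cauchyKer_pos (s : ℝ) : 0 < cauchyKer s := by unfold cauchyKer; positivity

theorem cauchyKer_neg (s : ℝ) : cauchyKer (-s) = cauchyKer s := by simp [cauchyKer]

theorem continuous_cauchyKer : Continuous cauchyKer := by
  unfold cauchyKer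
  exact Continuous.inv₀ (by fun_prop) fun s => by positivity

theorem integrable_cauchyKer : Integrable cauchyKer := integrable_inv_one_add_sq

theorem integral_cauchyKer : ∫ s, cauchyKer s = Real.pi := integral_univ_inv_one_add_sq

@[fun_prop]
theorem measurable_cauchyKer : Measurable cauchyKer := continuous_cauchyKer.measurable

theorem lintegral_cauchyKer : ∫⁻ s, ENNReal.ofReal (cauchyKer s) = ENNReal.ofReal Real.pi := by
  rw [← integral_cauchyKer, ofReal_integral_eq_lintegral_ofReal integrable_cauchyKer
    (Filter.Eventually.of_forall fun s => (cauchyKer_pos s).le)]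

/-- Averaging against the Cauchy kernel in the direction `v`. -/
def avg (v : Plane) (u : Plane → ℝ≥0∞) (x : Plane) : ℝ≥0∞ :=
  ∫⁻ s, ENNReal.ofReal (cauchyKer s) * u (x - s • v)

namespace avg
variable {u w : Plane → ℝ≥0∞} (v v' : Plane)

@[fun_prop]
theorem measurable (hu : Measurable u) : Measurable (avg v u) := by
  have : Measurable (fun z : Plane × ℝ => ENNReal.ofReal (cauchyKer z.2) * u (z.1 - z.2 • v)) := by
    fun_prop
  exact this.lintegral_prod_right'

theorem mono {u w : Plane → ℝ≥0∞} (h : ∀ x, u x ≤ w x) (x : Plane) : avg v u x ≤ avg v w x :=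
  lintegral_mono fun s => by gcongr; exact h _

theorem add (hu : Measurable u) (w : Plane → ℝ≥0∞) (x : Plane) :
    avg v (fun x => u x + w x) x = avg v u x + avg v w x := by
  simp only [avg, mul_add]
  rw [lintegral_add_left (by fun_prop)]

theorem const_mul (c : ℝ≥0∞) (hu : Measurable u) (x : Plane) :
    avg v (fun x => c * u x) x = c * avg v u x := by
  simp only [avg]
  rw [← lintegral_const_mul c (by fun_prop)]
  congr 1; ext s; ring

theorem zero (x : Plane) : avg v (fun _ => 0) x = 0 := by simp [avg]

theorem sum {ι : Type*} (s : Finset ι) {u : ι → Plane → ℝ≥0∞} (hu : ∀ i, Measurable (u i))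
    (x : Plane) : avg v (fun x => ∑ i ∈ s, u i x) x = ∑ i ∈ s, avg v (u i) x := by
  classical
  induction s using Finset.induction_on with
  | empty => simp [zero]
  | insert i s hi ih =>
    simp_rw [Finset.sum_insert hi]
    rw [add v (hu i), ih]

theorem lintegral_mul_comm (hu : Measurable u) (hw : Measurable w) :
    ∫⁻ x, avg v u x * w x = ∫⁻ x, u x * avg v w x := by
  have e1 : ∫⁻ x, avg v u x * w x =
      ∫⁻ s, ∫⁻ x, ENNReal.ofReal (cauchyKer s) * u (x - s • v) * w x := by
    rw [lintegral_lintegral_swap (by fun_prop)]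
    congr 1; ext x
    rw [avg, ← lintegral_mul_const _ (by fun_prop)]
  have e2 : ∫⁻ x, u x * avg v w x =
      ∫⁻ s, ∫⁻ x, u x * (ENNReal.ofReal (cauchyKer s) * w (x - s • v)) := by
    rw [lintegral_lintegral_swap (by fun_prop)]
    congr 1; ext x
    rw [avg, ← lintegral_const_mul _ (by fun_prop)]
  rw [e1, e2, ← lintegral_neg_eq_self]
  congr 1; ext s
  rw [← lintegral_sub_right_eq_self (μ := volume) _ (s • v)]
  congr 1; ext x
  rw [cauchyKer_neg, neg_smul, sub_neg_eq_add, sub_add_cancel]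
  ring

theorem comm (hu : Measurable u) (x : Plane) : avg v (avg v' u) x = avg v' (avg v u) x := by
  have hm : ∀ a w : Plane, Measurable fun s : ℝ => ENNReal.ofReal (cauchyKer s) * u (a - s • w) :=
    fun a w => by fun_prop
  simp only [avg]
  simp_rw [← lintegral_const_mul _ (hm _ _)]
  rw [lintegral_lintegral_swap (by fun_prop)]
  congr 1; ext s; congr 1; ext t
  rw [sub_right_comm]; ring

theorem lintegral (hu : Measurable u) : ∫⁻ x, avg v u x = ENNReal.ofReal Real.pi * ∫⁻ x, u x := by
  simp only [avg]
  rw [lintegral_lintegral_swap (by fun_prop)]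
  have hm : ∀ a : Plane, Measurable fun x : Plane => u (x - a) := fun a => by fun_prop
  simp_rw [lintegral_const_mul _ (hm _), lintegral_sub_right_eq_self]
  rw [lintegral_mul_const _ (by fun_prop), lintegral_cauchyKer]

end avg

theorem lintegral_mul_sq_le {X : Type*} [MeasurableSpace X] {μ : Measure X} {f g : X → ℝ≥0∞}
    (hf : AEMeasurable f μ) (hg : AEMeasurable g μ) :
    (∫⁻ x, f x * g x ∂μ) ^ 2 ≤ (∫⁻ x, f x ^ 2 ∂μ) * ∫⁻ x, g x ^ 2 ∂μ := by
  have h := ENNReal.lintegral_mul_le_Lp_mul_Lq μ (Real.HolderConjugate.two_two) hf hg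
  simp only [Pi.mul_apply, ENNReal.rpow_two] at h
  calc _ ≤ ((∫⁻ x, f x ^ 2 ∂μ) ^ (1 / 2 : ℝ) * (∫⁻ x, g x ^ 2 ∂μ) ^ (1 / 2 : ℝ)) ^ 2 := by gcongr
    _ = _ := by
      rw [mul_pow, ← ENNReal.rpow_natCast, ← ENNReal.rpow_natCast, ← ENNReal.rpow_mul,
        ← ENNReal.rpow_mul]
      norm_num

namespace avg
variable {u w : Plane → ℝ≥0∞} (v v' : Plane)

theorem sq_le (hu : Measurable u) (x : Plane) :
    avg v u x ^ 2 ≤ ENNReal.ofReal Real.pi * avg v (fun x => u x ^ 2) x := by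
  have h := lintegral_mul_sq_le (μ := (volume : Measure ℝ).withDensity fun s => ENNReal.ofReal (cauchyKer s))
    (f := fun _ => 1) (g := fun s => u (x - s • v)) (by fun_prop) (by fun_prop)
  rw [lintegral_withDensity_eq_lintegral_mul _ (by fun_prop) (by fun_prop),
    lintegral_withDensity_eq_lintegral_mul _ (by fun_prop) (by fun_prop),
    lintegral_withDensity_eq_lintegral_mul _ (by fun_prop) (by fun_prop)] at h
  simpa [avg, lintegral_cauchyKer] using h

theorem lintegral_sq_le (hu : Measurable u) :
    ∫⁻ x, avg v u x ^ 2 ≤ ENNReal.ofReal Real.pi ^ 2 * ∫⁻ x, u x ^ 2 := by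
  calc _ ≤ ∫⁻ x, ENNReal.ofReal Real.pi * avg v (fun x => u x ^ 2) x := lintegral_mono (sq_le v hu)
    _ = _ := by
      rw [lintegral_const_mul _ (by fun_prop), lintegral v (by fun_prop)]; ring

theorem cauchyKer_mul_le {c : ℝ} (hc0 : 0 ≤ c) (hc1 : c ≤ 1) (s y : ℝ) :
    cauchyKer (s - c * y) * cauchyKer y ≤ 2 * cauchyKer s * (cauchyKer y + c * cauchyKer (s - c * y)) := by
  unfold cauchyKer
  have h1 : 0 < 1 + (s - c * y) ^ 2 := by positivity
  have h2 : 0 < 1 + y ^ 2 := by positivity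
  have h3 : 0 < 1 + s ^ 2 := by positivity
  have key : 1 + s ^ 2 ≤ 2 * ((1 + (s - c * y) ^ 2) + c * (1 + y ^ 2)) := by
    have hc2 : c ^ 2 ≤ c := by nlinarith
    nlinarith [sq_nonneg (s - 2 * (c * y)), mul_nonneg (sub_nonneg.2 hc2) (sq_nonneg y)]
  have : 2 * (1 + s ^ 2)⁻¹ * ((1 + y ^ 2)⁻¹ + c * (1 + (s - c * y) ^ 2)⁻¹) -
    (1 + (s - c * y) ^ 2)⁻¹ * (1 + y ^ 2)⁻¹ =
    (2 * ((1 + (s - c * y) ^ 2) + c * (1 + y ^ 2)) - (1 + s ^ 2)) * ((1 + s ^ 2)⁻¹ *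
      (1 + (s - c * y) ^ 2)⁻¹ * (1 + y ^ 2)⁻¹) := by
    field_simp
  have h4 : 0 ≤ (1 + s ^ 2)⁻¹ * (1 + (s - c * y) ^ 2)⁻¹ * (1 + y ^ 2)⁻¹ := by positivity
  have := mul_nonneg (sub_nonneg.2 key) h4
  linarith

theorem lintegral_cauchyKer_mul_le {c : ℝ} (hc0 : 0 < c) (hc1 : c ≤ 1) (s : ℝ) :
    ∫⁻ y, ENNReal.ofReal (cauchyKer (s - c * y)) * ENNReal.ofReal (cauchyKer y) ≤
      ENNReal.ofReal (4 * Real.pi) * ENNReal.ofReal (cauchyKer s) := by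
  have hi : Integrable fun y => cauchyKer (s - c * y) :=
    (integrable_cauchyKer.comp_sub_left s).comp_mul_left' hc0.ne'
  have hint : ∫ y, cauchyKer (s - c * y) = c⁻¹ * Real.pi := by
    have := Measure.integral_comp_mul_left (fun y => cauchyKer (s - y)) c
    rw [this, integral_sub_left_eq_self, integral_cauchyKer, abs_of_pos (by positivity), smul_eq_mul]
  have hi2 : Integrable fun y => 2 * cauchyKer s * (cauchyKer y + c * cauchyKer (s - c * y)) :=
    (integrable_cauchyKer.add (hi.const_mul c)).const_mul _
  calc _ = ∫⁻ y, ENNReal.ofReal (cauchyKer (s - c * y) * cauchyKer y) := by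
        congr 1; ext y; rw [ENNReal.ofReal_mul (cauchyKer_pos _).le]
    _ ≤ ∫⁻ y, ENNReal.ofReal (2 * cauchyKer s * (cauchyKer y + c * cauchyKer (s - c * y))) :=
        lintegral_mono fun y => ENNReal.ofReal_le_ofReal (cauchyKer_mul_le hc0.le hc1 s y)
    _ = ENNReal.ofReal (∫ y, 2 * cauchyKer s * (cauchyKer y + c * cauchyKer (s - c * y))) := by
        rw [ofReal_integral_eq_lintegral_ofReal hi2 (Filter.Eventually.of_forall fun y => ?_)]
        have := cauchyKer_pos s
        have := cauchyKer_pos y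
        have := cauchyKer_pos (s - c * y)
        change 0 ≤ _
        positivity
    _ = _ := by
        rw [integral_const_mul, integral_add integrable_cauchyKer (hi.const_mul c), integral_const_mul,
          hint, integral_cauchyKer, ← ENNReal.ofReal_mul (by positivity)]
        congr 1; field_simp; ring

theorem avg_smul_le {l r : ℝ} (hl : 0 < l) (hlr : l ≤ r) (hu : Measurable u) (x : Plane) :
    avg (r • v) (avg (l • v) u) x ≤ ENNReal.ofReal (4 * Real.pi) * avg (r • v) u x := by
  have hr : 0 < r := hl.trans_le hlr
  set c := l / r with hc
  have hc0 : 0 < c := by positivity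
  have hc1 : c ≤ 1 := (div_le_one hr).2 hlr
  have hcr : c * r = l := by rw [hc]; field_simp
  have e1 : avg (r • v) (avg (l • v) u) x = ∫⁻ y, ∫⁻ s, ENNReal.ofReal (cauchyKer s) *
      (ENNReal.ofReal (cauchyKer y) * u (x - s • r • v - y • l • v)) := by
    have hm : ∀ a w : Plane, Measurable fun s : ℝ => ENNReal.ofReal (cauchyKer s) * u (a - s • w) :=
      fun a w => by fun_prop
    simp only [avg]
    simp_rw [← lintegral_const_mul _ (hm _ _)]
    rw [lintegral_lintegral_swap (by fun_prop)]
  have e2 : ∀ y : ℝ, ∫⁻ s, ENNReal.ofReal (cauchyKer s) *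
      (ENNReal.ofReal (cauchyKer y) * u (x - s • r • v - y • l • v)) =
      ∫⁻ s, (ENNReal.ofReal (cauchyKer (s - c * y)) * ENNReal.ofReal (cauchyKer y)) * u (x - s • r • v) := by
    intro y
    rw [← lintegral_sub_right_eq_self _ (c * y)]
    congr 1; ext s
    rw [show x - (s - c * y) • r • v - y • l • v = x - s • r • v by
      rw [← hcr]; module]
    ring
  rw [e1]
  simp_rw [e2]
  rw [lintegral_lintegral_swap (by fun_prop), avg, ← lintegral_const_mul _ (by fun_prop)]
  refine lintegral_mono fun s => ?_
  rw [lintegral_mul_const _ (by fun_prop), ← mul_assoc]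
  gcongr
  exact lintegral_cauchyKer_mul_le hc0 hc1 s

end avg

/-- Positive symmetric additive operators on nonnegative functions, bounded on `L²`. -/
structure PosOp (T : (Plane → ℝ≥0∞) → Plane → ℝ≥0∞) : Prop where
  meas : ∀ {u}, Measurable u → Measurable (T u)
  zero : ∀ x, T (fun _ => 0) x = 0
  add : ∀ {u w}, Measurable u → Measurable w → ∀ x, T (fun x => u x + w x) x = T u x + T w x
  symm : ∀ {u w}, Measurable u → Measurable w → ∫⁻ x, T u x * w x = ∫⁻ x, u x * T w x
  bdd : ∃ K : ℝ≥0, ∀ {u}, Measurable u → ∫⁻ x, T u x ^ 2 ≤ K * ∫⁻ x, u x ^ 2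

namespace PosOp
variable {T : (Plane → ℝ≥0∞) → Plane → ℝ≥0∞}

theorem sum (hT : PosOp T) {ι : Type*} (s : Finset ι) {u : ι → Plane → ℝ≥0∞} (hu : ∀ i, Measurable (u i))
    (x : Plane) : T (fun x => ∑ i ∈ s, u i x) x = ∑ i ∈ s, T (u i) x := by
  classical
  induction s using Finset.induction_on with
  | empty => simp [hT.zero]
  | insert i s hi ih =>
    simp_rw [Finset.sum_insert hi]
    rw [hT.add (hu i) (Finset.measurable_fun_sum s fun i _ => hu i), ih]

theorem of_avg (v : Plane) : PosOp (avg v) where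
  meas hu := avg.measurable v hu
  zero := avg.zero v
  add hu _ x := avg.add v hu _ x
  symm hu hw := avg.lintegral_mul_comm v hu hw
  bdd := ⟨(Real.toNNReal Real.pi) ^ 2, fun hu => avg.lintegral_sq_le v hu⟩

theorem of_avg_avg (v v' : Plane) : PosOp (fun u => avg v (avg v' u)) where
  meas hu := avg.measurable v (avg.measurable v' hu)
  zero x := by
    have : avg v' (fun _ => 0) = fun _ => 0 := funext (avg.zero v')
    rw [this, avg.zero]
  add {u w} hu hw x := by
    have : avg v' (fun x => u x + w x) = fun x => avg v' u x + avg v' w x :=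
      funext fun x => avg.add v' hu w x
    rw [this, avg.add v (avg.measurable v' hu)]
  symm {u w} hu hw := by
    rw [avg.lintegral_mul_comm v (by fun_prop) hw, avg.lintegral_mul_comm v' hu (by fun_prop)]
    congr 1; ext x
    rw [avg.comm v' v hw]
  bdd := ⟨(Real.toNNReal Real.pi) ^ 2 * (Real.toNNReal Real.pi) ^ 2, fun {u} hu => by
    refine (avg.lintegral_sq_le v (avg.measurable v' hu)).trans ?_
    push_cast
    rw [mul_assoc]
    exact mul_le_mul_right (avg.lintegral_sq_le v' hu) _⟩

end PosOp

theorem measurable_finset_sup {ι : Type*} (s : Finset ι) {a : ι → Plane → ℝ≥0∞}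
    (ha : ∀ i, Measurable (a i)) : Measurable (fun x => s.sup fun k => a k x) := by
  classical
  induction s using Finset.induction_on with
  | empty => simp
  | insert i s hi ih =>
    simp_rw [Finset.sup_insert]
    exact (ha i).sup ih

/-- Linearization of a finite maximum. -/
theorem exists_weights_sup {ι : Type*} (s : Finset ι) {a : ι → Plane → ℝ≥0∞}
    (ha : ∀ i, Measurable (a i)) :
    ∃ w : ι → Plane → ℝ≥0∞, (∀ i, Measurable (w i)) ∧
      (∀ x, ∑ i ∈ s, w i x = s.sup fun k => a k x) ∧
      ∀ x, ∑ i ∈ s, w i x * a i x = (s.sup fun k => a k x) ^ 2 := by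
  classical
  induction s using Finset.induction_on with
  | empty => exact ⟨fun _ _ => 0, fun _ => measurable_const, by simp, by simp⟩
  | insert i s hi ih =>
    obtain ⟨w, hw, h1, h2⟩ := ih
    have hS := measurable_finset_sup s ha
    set E : Set Plane := {x | (s.sup fun k => a k x) ≤ a i x} with hE
    have hEm : MeasurableSet E := measurableSet_le hS (ha i)
    refine ⟨fun j => if j = i then E.indicator (a i) else Eᶜ.indicator (w j), fun j => ?_,
      fun x => ?_, fun x => ?_⟩
    · by_cases hj : j = i
      · simpa [hj] using (ha i).indicator hEm
      · simpa [hj] using (hw j).indicator hEm.compl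
    · rw [Finset.sum_insert hi, Finset.sup_insert]
      have : ∀ j ∈ s, (if j = i then E.indicator (a i) else Eᶜ.indicator (w j)) x =
          Eᶜ.indicator (w j) x := fun j hj => by
        rw [if_neg (by rintro rfl; exact hi hj)]
      rw [Finset.sum_congr rfl this]
      by_cases hx : x ∈ E
      · simp only [↓reduceIte, indicator_of_mem hx, mem_compl_iff, hx, not_true_eq_false,
          not_false_eq_true, indicator_of_notMem, Finset.sum_const_zero, add_zero]
        exact (sup_eq_left.2 hx).symm
      · simp only [↓reduceIte, indicator_of_notMem hx, mem_compl_iff, hx,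
          not_false_eq_true, indicator_of_mem, zero_add]
        rw [h1, sup_eq_right.2 (le_of_not_ge hx)]
    · rw [Finset.sum_insert hi, Finset.sup_insert]
      have : ∀ j ∈ s, (if j = i then E.indicator (a i) else Eᶜ.indicator (w j)) x * a j x =
          Eᶜ.indicator (w j) x * a j x := fun j hj => by
        rw [if_neg (by rintro rfl; exact hi hj)]
      rw [Finset.sum_congr rfl this]
      by_cases hx : x ∈ E
      · simp only [↓reduceIte, indicator_of_mem hx, mem_compl_iff, hx, not_true_eq_false,
          not_false_eq_true, indicator_of_notMem, Finset.sum_const_zero, add_zero, zero_mul]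
        rw [sup_eq_left.2 hx, sq]
      · simp only [↓reduceIte, indicator_of_notMem hx, mem_compl_iff, hx,
          not_false_eq_true, indicator_of_mem, zero_add, zero_mul]
        rw [h2, sup_eq_right.2 (le_of_not_ge hx)]

section MaximalTTstar

variable {ι : Type*} (s : Finset ι) {T : ι → (Plane → ℝ≥0∞) → Plane → ℝ≥0∞}

theorem maximal_ttstar_step (hT : ∀ i, PosOp (T i)) {C : ℝ≥0}
    (hC : ∀ k ∈ s, ∀ l ∈ s, ∀ u, Measurable u → ∀ x, T k (T l u) x ≤ C * (T k u x + T l u x))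
    {N : ℝ≥0} (hN : ∀ u, Measurable u → ∫⁻ x, u x ^ 2 ≠ ∞ →
      ∫⁻ x, (s.sup fun k => T k u x) ^ 2 ≤ N * ∫⁻ x, u x ^ 2)
    {u : Plane → ℝ≥0∞} (hu : Measurable u) (huf : ∫⁻ x, u x ^ 2 ≠ ∞) :
    ∫⁻ x, (s.sup fun k => T k u x) ^ 2 ≤ NNReal.sqrt (4 * C ^ 2 * N) * ∫⁻ x, u x ^ 2 := by
  set M : Plane → ℝ≥0∞ := fun x => s.sup fun k => T k u x with hM
  have hMm : Measurable M := measurable_finset_sup s fun i => (hT i).meas hu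
  obtain ⟨w, hw, hw1, hw2⟩ := exists_weights_sup s (a := fun k => T k u) fun i => (hT i).meas hu
  set U := ∫⁻ x, u x ^ 2 with hU
  set X := ∫⁻ x, M x ^ 2 with hX
  have hXf : X ≠ ∞ := ne_top_of_le_ne_top (ENNReal.mul_ne_top ENNReal.coe_ne_top huf) (hN u hu huf)
  set h : Plane → ℝ≥0∞ := fun x => ∑ k ∈ s, T k (w k) x with hh
  have hhm : Measurable h := Finset.measurable_fun_sum s fun k _ => (hT k).meas (hw k)
  have e1 : X = ∫⁻ x, u x * h x := by
    calc X = ∫⁻ x, ∑ k ∈ s, w k x * T k u x := by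
          rw [hX]; congr 1; ext x; exact (hw2 x).symm
      _ = ∑ k ∈ s, ∫⁻ x, w k x * T k u x :=
          lintegral_finsetSum s fun k _ => (hw k).mul ((hT k).meas hu)
      _ = ∑ k ∈ s, ∫⁻ x, u x * T k (w k) x := by
          refine Finset.sum_congr rfl fun k _ => ?_
          rw [← (hT k).symm hu (hw k)]
          exact lintegral_congr fun x => mul_comm _ _
      _ = _ := by
          rw [← lintegral_finsetSum s (f := fun k x => u x * T k (w k) x)
            fun k _ => hu.mul ((hT k).meas (hw k))]
          simp_rw [hh, Finset.mul_sum]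
  set MM : Plane → ℝ≥0∞ := fun x => s.sup fun k => T k M x with hMM
  have hMMm : Measurable MM := measurable_finset_sup s fun i => (hT i).meas hMm
  have hsplit : ∀ k ∈ s, ∑ l ∈ s, ∫⁻ x, w l x * T k (w k) x = ∫⁻ x, w k x * T k M x := by
    intro k _
    calc _ = ∫⁻ x, ∑ l ∈ s, w l x * T k (w k) x :=
          (lintegral_finsetSum s (f := fun l x => w l x * T k (w k) x)
            fun l _ => (hw l).mul ((hT k).meas (hw k))).symm
      _ = ∫⁻ x, M x * T k (w k) x := by
          simp_rw [← Finset.sum_mul, hw1]; rfl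
      _ = ∫⁻ x, T k M x * w k x := ((hT k).symm hMm (hw k)).symm
      _ = _ := lintegral_congr fun x => mul_comm _ _
  have hsplit2 : ∀ l ∈ s, ∑ k ∈ s, ∫⁻ x, w l x * T l (w k) x = ∫⁻ x, w l x * T l M x := by
    intro l _
    calc _ = ∫⁻ x, ∑ k ∈ s, w l x * T l (w k) x :=
          (lintegral_finsetSum s (f := fun k x => w l x * T l (w k) x)
            fun k _ => (hw l).mul ((hT l).meas (hw k))).symm
      _ = ∫⁻ x, w l x * T l M x := by
          simp_rw [← Finset.mul_sum, ← (hT l).sum s hw, hw1]; rfl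
  have hfin : ∑ k ∈ s, ∫⁻ x, w k x * T k M x ≤ ∫⁻ x, M x * MM x := by
    rw [← lintegral_finsetSum s (f := fun k x => w k x * T k M x)
      fun k _ => (hw k).mul ((hT k).meas hMm)]
    refine lintegral_mono fun x => ?_
    calc _ ≤ ∑ k ∈ s, w k x * MM x := by
          refine Finset.sum_le_sum fun k hk => ?_
          gcongr
          exact Finset.le_sup (f := fun k => T k M x) hk
      _ = M x * MM x := by rw [← Finset.sum_mul, hw1]
  have e2 : ∫⁻ x, h x ^ 2 ≤ 2 * C * ∫⁻ x, M x * MM x := by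
    calc ∫⁻ x, h x ^ 2 = ∫⁻ x, ∑ k ∈ s, ∑ l ∈ s, T l (w l) x * T k (w k) x := by
          congr 1; ext x; rw [sq, hh]; simp only [Finset.sum_mul_sum]; rw [Finset.sum_comm]
      _ = ∑ k ∈ s, ∑ l ∈ s, ∫⁻ x, T l (w l) x * T k (w k) x := by
          have hm : ∀ k l, Measurable fun x => T l (w l) x * T k (w k) x := fun k l =>
            ((hT l).meas (hw l)).mul ((hT k).meas (hw k))
          rw [lintegral_finsetSum s fun k _ => Finset.measurable_fun_sum s fun l _ => hm k l]
          exact Finset.sum_congr rfl fun k _ => lintegral_finsetSum s fun l _ => hm k l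
      _ = ∑ k ∈ s, ∑ l ∈ s, ∫⁻ x, w l x * T l (T k (w k)) x :=
          Finset.sum_congr rfl fun k _ => Finset.sum_congr rfl fun l _ =>
            (hT l).symm (hw l) ((hT k).meas (hw k))
      _ ≤ ∑ k ∈ s, ∑ l ∈ s, ∫⁻ x, w l x * (C * (T l (w k) x + T k (w k) x)) := by
          refine Finset.sum_le_sum fun k hk => Finset.sum_le_sum fun l hl =>
            lintegral_mono fun x => ?_
          gcongr
          exact hC l hl k hk _ (hw k) x
      _ = ∑ k ∈ s, ∑ l ∈ s, (C * ∫⁻ x, w l x * T l (w k) x) +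
          ∑ k ∈ s, ∑ l ∈ s, (C * ∫⁻ x, w l x * T k (w k) x) := by
          simp_rw [← Finset.sum_add_distrib]
          refine Finset.sum_congr rfl fun k hk => Finset.sum_congr rfl fun l hl => ?_
          have m1 : Measurable fun x => w l x * T l (w k) x := (hw l).mul ((hT l).meas (hw k))
          have m2 : Measurable fun x => w l x * T k (w k) x := (hw l).mul ((hT k).meas (hw k))
          rw [← mul_add, ← lintegral_add_left m1, ← lintegral_const_mul' _ _ ENNReal.coe_ne_top]
          refine lintegral_congr fun x => ?_
          ring
      _ = 2 * C * ∑ k ∈ s, ∫⁻ x, w k x * T k M x := by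
          rw [Finset.sum_comm]
          simp_rw [← Finset.mul_sum]
          rw [Finset.sum_congr rfl hsplit, Finset.sum_congr rfl hsplit2]; ring
      _ ≤ _ := by gcongr
  have h3 : X ^ 2 ≤ U * (2 * C * ∫⁻ x, M x * MM x) := by
    rw [e1]; exact (lintegral_mul_sq_le hu.aemeasurable hhm.aemeasurable).trans (by gcongr)
  have h4 : (∫⁻ x, M x * MM x) ^ 2 ≤ X * (N * X) :=
    (lintegral_mul_sq_le hMm.aemeasurable hMMm.aemeasurable).trans
      (by gcongr; exact hN M hMm hXf)
  have h5 : X ^ 2 * X ^ 2 ≤ U ^ 2 * (4 * C ^ 2 * N) * X ^ 2 := by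
    calc X ^ 2 * X ^ 2 = (X ^ 2) ^ 2 := by ring
      _ ≤ (U * (2 * C * ∫⁻ x, M x * MM x)) ^ 2 := by gcongr
      _ = U ^ 2 * 4 * C ^ 2 * (∫⁻ x, M x * MM x) ^ 2 := by ring
      _ ≤ U ^ 2 * 4 * C ^ 2 * (X * (N * X)) := by gcongr
      _ = _ := by ring
  by_cases hX0 : X = 0
  · rw [hX0]; exact zero_le
  have h6 : X ^ 2 ≤ U ^ 2 * (4 * C ^ 2 * N) :=
    (ENNReal.mul_le_mul_iff_left (pow_ne_zero 2 hX0) (ENNReal.pow_ne_top hXf)).1 h5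
  have h7 : X ^ 2 ≤ ((NNReal.sqrt (4 * C ^ 2 * N) : ℝ≥0∞) * U) ^ 2 := by
    refine h6.trans_eq ?_
    rw [mul_pow, ← ENNReal.coe_pow (NNReal.sqrt _), NNReal.sq_sqrt]; push_cast; ring
  exact (ENNReal.pow_le_pow_left_iff two_ne_zero).1 h7

/-- Almost-idempotent families of positive operators have a maximal function bounded on `L²`,
uniformly in the number of operators. -/
theorem lintegral_sup_sq_le (hT : ∀ i, PosOp (T i)) {C : ℝ≥0}
    (hC : ∀ k ∈ s, ∀ l ∈ s, ∀ u, Measurable u → ∀ x, T k (T l u) x ≤ C * (T k u x + T l u x))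
    {u : Plane → ℝ≥0∞} (hu : Measurable u) :
    ∫⁻ x, (s.sup fun k => T k u x) ^ 2 ≤ (4 * C ^ 2 + 1) * ∫⁻ x, u x ^ 2 := by
  by_cases huf : ∫⁻ x, u x ^ 2 = ∞
  · rw [huf, ENNReal.mul_top (by simp)]; exact le_top
  set S : Set ℝ≥0 := {N | ∀ u, Measurable u → ∫⁻ x, u x ^ 2 ≠ ∞ →
      ∫⁻ x, (s.sup fun k => T k u x) ^ 2 ≤ N * ∫⁻ x, u x ^ 2} with hS
  have hne : S.Nonempty := by
    choose K hK using fun i => (hT i).bdd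
    refine ⟨∑ k ∈ s, K k, fun u hu _ => ?_⟩
    calc _ ≤ ∫⁻ x, ∑ k ∈ s, T k u x ^ 2 := by
          refine lintegral_mono fun x => ?_
          by_cases he : s.Nonempty
          · obtain ⟨k, hk, hk'⟩ := Finset.exists_mem_eq_sup s he fun k => T k u x
            rw [hk']
            exact Finset.single_le_sum (f := fun k => T k u x ^ 2) (fun _ _ => zero_le) hk
          · simp [Finset.not_nonempty_iff_eq_empty.1 he]
      _ = ∑ k ∈ s, ∫⁻ x, T k u x ^ 2 :=
          lintegral_finsetSum s fun k _ => ((hT k).meas hu).pow_const 2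
      _ ≤ ∑ k ∈ s, K k * ∫⁻ x, u x ^ 2 := Finset.sum_le_sum fun k _ => hK k hu
      _ = _ := by rw [← Finset.sum_mul]; push_cast; rfl
  set N₀ := sInf S with hN₀
  have hstep : ∀ N ∈ S, N₀ ≤ NNReal.sqrt (4 * C ^ 2 * N) := fun N hN =>
    csInf_le (OrderBot.bddBelow S) fun u hu huf => maximal_ttstar_step s hT hC hN hu huf
  have hlt : N₀ < 4 * C ^ 2 + 1 := by
    by_contra hcon
    push Not at hcon
    have hpos : 0 < N₀ := lt_of_lt_of_le (by positivity) hcon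
    have hlt : 4 * C ^ 2 < N₀ := lt_of_lt_of_le (lt_add_one _) hcon
    obtain ⟨N, hN, hN'⟩ : ∃ N ∈ S, 4 * C ^ 2 * N < N₀ ^ 2 := by
      by_cases hC0 : C = 0
      · obtain ⟨N, hN⟩ := hne
        exact ⟨N, hN, by simp [hC0]; positivity⟩
      have h4 : 0 < 4 * C ^ 2 := by positivity
      obtain ⟨N, hN, hN'⟩ := exists_lt_of_csInf_lt hne
        (show sInf S < N₀ ^ 2 / (4 * C ^ 2) by
          rw [lt_div_iff₀ h4, sq N₀, ← hN₀]; exact mul_lt_mul_of_pos_left hlt hpos)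
      exact ⟨N, hN, by rw [lt_div_iff₀ h4] at hN'; rwa [mul_comm]⟩
    have := hstep N hN
    have h8 : N₀ ^ 2 ≤ 4 * C ^ 2 * N := by
      calc N₀ ^ 2 ≤ NNReal.sqrt (4 * C ^ 2 * N) ^ 2 := by gcongr
        _ = _ := NNReal.sq_sqrt _
    exact absurd h8 (not_le.2 hN')
  obtain ⟨N, hN, hN'⟩ := exists_lt_of_csInf_lt hne hlt
  refine (hN u hu huf).trans ?_
  gcongr
  exact_mod_cast hN'.le

end MaximalTTstar

/-- The dyadic maximal function in a fixed direction. -/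
theorem lintegral_sup_avg_sq_le {ι : Type*} (s : Finset ι) (r : ι → ℝ) (hr : ∀ i, 0 < r i) (v : Plane)
    {u : Plane → ℝ≥0∞} (hu : Measurable u) :
    ∫⁻ x, (s.sup fun k => avg (r k • v) u x) ^ 2 ≤
      ENNReal.ofReal (64 * Real.pi ^ 2 + 1) * ∫⁻ x, u x ^ 2 := by
  have := lintegral_sup_sq_le s (T := fun k => avg (r k • v)) (fun k => PosOp.of_avg _)
    (C := Real.toNNReal (4 * Real.pi)) (fun k _ l _ u hu x => ?_) hu
  · refine this.trans_eq ?_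
    congr 1
    rw [ENNReal.ofReal_add (by positivity) (by simp), show 64 * Real.pi ^ 2 = 4 * (4 * Real.pi) ^ 2 by ring,
      ENNReal.ofReal_mul (by simp), ENNReal.ofReal_pow (by positivity)]
    simp [ENNReal.ofReal]
  · rcases le_total (r l) (r k) with h | h
    · exact (avg.avg_smul_le v (hr l) h hu x).trans (by gcongr <;> first | exact le_rfl | exact le_self_add)
    · rw [avg.comm _ _ hu]
      exact (avg.avg_smul_le v (hr k) h hu x).trans (by gcongr <;> first | exact le_rfl | exact le_add_self)

theorem lintegral_sup_avg_avg_sq_le {ι : Type*} (s : Finset ι) (r : ι → ℝ) (hr : ∀ i, 0 < r i)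
    (v v' : Plane) {u : Plane → ℝ≥0∞} (hu : Measurable u) :
    ∫⁻ x, (s.sup fun k => avg (r k • v) (avg (r k • v') u) x) ^ 2 ≤
      ENNReal.ofReal (4 * (4 * Real.pi) ^ 4 + 1) * ∫⁻ x, u x ^ 2 := by
  have key : ∀ k l, r l ≤ r k → ∀ u, Measurable u → ∀ x,
      avg (r k • v) (avg (r k • v') (avg (r l • v) (avg (r l • v') u))) x ≤
      ENNReal.ofReal ((4 * Real.pi) ^ 2) * avg (r k • v) (avg (r k • v') u) x := by
    intro k l h u hu x
    have e : avg (r k • v') (avg (r l • v) (avg (r l • v') u)) =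
        avg (r l • v) (avg (r k • v') (avg (r l • v') u)) :=
      funext fun x => avg.comm _ _ (by fun_prop) x
    rw [e]
    refine (avg.avg_smul_le v (hr l) h (by fun_prop) x).trans ?_
    have h2 := avg.mono (r k • v) (fun y => avg.avg_smul_le v' (hr l) h hu y) x
    rw [avg.const_mul _ _ (by fun_prop)] at h2
    refine (mul_le_mul_right h2 _).trans_eq ?_
    rw [← mul_assoc, ← ENNReal.ofReal_mul (by positivity), sq]
  have := lintegral_sup_sq_le s (T := fun k u => avg (r k • v) (avg (r k • v') u))
    (fun k => PosOp.of_avg_avg _ _)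
    (C := Real.toNNReal ((4 * Real.pi) ^ 2)) (fun k _ l _ u hu x => ?_) hu
  · refine this.trans_eq ?_
    congr 1
    rw [ENNReal.ofReal_add (by positivity) (by simp),
      show 4 * (4 * Real.pi) ^ 4 = 4 * ((4 * Real.pi) ^ 2) ^ 2 by ring,
      ENNReal.ofReal_mul (by simp), ENNReal.ofReal_pow (by positivity)]
    simp [ENNReal.ofReal]
  · rcases le_total (r l) (r k) with h | h
    · exact (key k l h u hu x).trans (by gcongr <;> first | exact le_rfl | exact le_self_add)
    · have e : avg (r k • v) (avg (r k • v') (avg (r l • v) (avg (r l • v') u))) x =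
          avg (r l • v) (avg (r l • v') (avg (r k • v) (avg (r k • v') u))) x := by
        have h1 : ∀ a b : Plane, ∀ w, Measurable w → avg a (avg b w) = avg b (avg a w) :=
          fun a b w hw => funext fun x => avg.comm a b hw x
        rw [h1 (r k • v') (r l • v) _ (by fun_prop), h1 (r k • v) (r l • v) _ (by fun_prop),
          h1 (r k • v') (r l • v') _ (by fun_prop), h1 (r k • v) (r l • v') _ (by fun_prop)]
      show avg (r k • v) (avg (r k • v') (avg (r l • v) (avg (r l • v') u))) x ≤ _
      rw [e]
      exact (key l k h u hu x).trans (by gcongr <;> first | exact le_rfl | exact le_add_self)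

/-- Convolution with the measure `κ(s) ds` carried by the line through `v`. -/
def dirConv (κ : ℝ → ℂ) (v : Plane) (f : Plane → ℂ) (x : Plane) : ℂ :=
  ∫ s, κ s * f (x - s • v)

theorem dirConv_fourierInv {κ : ℝ → ℂ} (hκ : Integrable κ) (v : Plane) {α : Plane → ℂ}
    (hα : Integrable α) (x : Plane) :
    dirConv κ v (𝓕⁻ α) x = 𝓕⁻ (fun ξ => 𝓕 κ (inner ℝ ξ v) * α ξ) x := by
  have hexp : ∀ (s : ℝ) (ξ : Plane),
      cexp (↑(2 * Real.pi * inner ℝ ξ (x - s • v)) * I) =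
      cexp (↑(-2 * Real.pi * s * inner ℝ ξ v) * I) * cexp (↑(2 * Real.pi * inner ℝ ξ x) * I) := by
    intro s ξ
    rw [← Complex.exp_add, inner_sub_right, inner_smul_right]
    congr 1; push_cast; ring
  have hi : Integrable (Function.uncurry fun (s : ℝ) (ξ : Plane) =>
      cexp (↑(2 * Real.pi * inner ℝ ξ (x - s • v)) * I) * (κ s * α ξ)) (volume.prod volume) := by
    refine (hκ.mul_prod hα).bdd_mul (c := 1) ?_ (Filter.Eventually.of_forall fun z => ?_)
    · exact (by fun_prop : Continuous fun z : ℝ × Plane =>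
        cexp (↑(2 * Real.pi * inner ℝ z.2 (x - z.1 • v)) * I)).aestronglyMeasurable
    · rw [Complex.norm_exp_ofReal_mul_I]
  simp_rw [dirConv, Real.fourierInv_eq', ← integral_const_mul]
  calc _ = ∫ s, ∫ ξ, cexp (↑(2 * Real.pi * inner ℝ ξ (x - s • v)) * I) * (κ s * α ξ) := by
        refine integral_congr_ae (Filter.Eventually.of_forall fun s => ?_)
        refine integral_congr_ae (Filter.Eventually.of_forall fun ξ => ?_)
        simp only [smul_eq_mul]; ring
    _ = ∫ ξ, ∫ s, cexp (↑(2 * Real.pi * inner ℝ ξ (x - s • v)) * I) * (κ s * α ξ) :=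
        integral_integral_swap hi
    _ = _ := by
        refine integral_congr_ae (Filter.Eventually.of_forall fun ξ => ?_)
        simp only [Real.fourier_real_eq_integral_exp_smul, smul_eq_mul]
        rw [← integral_mul_const, ← integral_const_mul]
        refine integral_congr_ae (Filter.Eventually.of_forall fun s => ?_)
        simp only [hexp]; ring

theorem continuous_fourier_real {κ : ℝ → ℂ} (hκ : Integrable κ) : Continuous (𝓕 κ) :=
  VectorFourier.fourierIntegral_continuous Real.continuous_fourierChar
    (by exact (continuous_inner (𝕜 := ℝ) (E := ℝ))) hκ

theorem norm_fourier_real_le (κ : ℝ → ℂ) (x : ℝ) : ‖𝓕 κ x‖ ≤ ∫ s, ‖κ s‖ :=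
  VectorFourier.norm_fourierIntegral_le_integral_norm _ _ _ _ _

theorem Nice.dirConv_symbol {κ : ℝ → ℂ} (hκ : Integrable κ) (v : Plane) {α : Plane → ℂ}
    (hα : Nice α) : Nice (fun ξ => 𝓕 κ (inner ℝ ξ v) * α ξ) :=
  hα.mul_bdd ((continuous_fourier_real hκ).measurable.comp (by fun_prop))
    (fun _ => norm_fourier_real_le κ _)

theorem integrable_exp_neg_mul_abs {b : ℝ} (hb : 0 < b) : Integrable fun t : ℝ => Real.exp (-(b * |t|)) := by
  rw [← integrableOn_univ, ← Iic_union_Ioi (a := (0:ℝ)), integrableOn_union]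
  constructor
  · refine (integrableOn_exp_mul_Iic hb 0).congr_fun (fun t ht => ?_) measurableSet_Iic
    simp [abs_of_nonpos (show t ≤ 0 from ht)]
  · refine (exp_neg_integrableOn_Ioi 0 hb).congr_fun (fun t ht => ?_) measurableSet_Ioi
    simp [abs_of_pos (show 0 < t from ht)]

theorem fourierInv_exp_neg_abs (x : ℝ) :
    𝓕⁻ (fun t : ℝ => ((Real.pi * Real.exp (-(2 * Real.pi * |t|)) : ℝ) : ℂ)) x = (cauchyKer x : ℂ) := by
  have hpi := Real.pi_pos
  have hint : Integrable fun t : ℝ => cexp (↑(2 * Real.pi * inner ℝ t x) * I) •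
      ((Real.pi * Real.exp (-(2 * Real.pi * |t|)) : ℝ) : ℂ) := by
    refine (((integrable_exp_neg_mul_abs (b := 2 * Real.pi) (by positivity)).const_mul Real.pi).ofReal).bdd_mul
      (c := 1) ?_ (Filter.Eventually.of_forall fun z => ?_)
    · exact (by fun_prop : Continuous fun t : ℝ =>
        cexp (↑(2 * Real.pi * inner ℝ t x) * I)).aestronglyMeasurable
    · rw [Complex.norm_exp_ofReal_mul_I]
  rw [Real.fourierInv_eq', ← intervalIntegral.integral_Iic_add_Ioi (b := 0) hint.integrableOn hint.integrableOn]
  set a : ℂ := 2 * Real.pi * (1 + x * I) with ha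
  set b : ℂ := 2 * Real.pi * (-1 + x * I) with hb
  have hare : 0 < a.re := by simp [ha, hpi]
  have hbre : b.re < 0 := by simp [hb, hpi]
  have e1 : ∫ t in Iic (0:ℝ), cexp (↑(2 * Real.pi * inner ℝ t x) * I) •
      ((Real.pi * Real.exp (-(2 * Real.pi * |t|)) : ℝ) : ℂ) = Real.pi * (1 / a) := by
    have := integral_exp_mul_complex_Iic hare 0
    simp only [ofReal_zero, mul_zero, Complex.exp_zero] at this
    rw [← this, ← integral_const_mul]
    refine setIntegral_congr_fun measurableSet_Iic fun t ht => ?_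
    simp only [abs_of_nonpos (show t ≤ 0 from ht), smul_eq_mul, RCLike.inner_apply, conj_trivial]
    push_cast
    rw [mul_left_comm, ← Complex.exp_add, ha]
    congr 2; ring
  have e2 : ∫ t in Ioi (0:ℝ), cexp (↑(2 * Real.pi * inner ℝ t x) * I) •
      ((Real.pi * Real.exp (-(2 * Real.pi * |t|)) : ℝ) : ℂ) = Real.pi * (-1 / b) := by
    have := integral_exp_mul_complex_Ioi hbre 0
    simp only [ofReal_zero, mul_zero, Complex.exp_zero] at this
    rw [← this, ← integral_const_mul]
    refine setIntegral_congr_fun measurableSet_Ioi fun t ht => ?_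
    simp only [abs_of_pos (show 0 < t from ht), smul_eq_mul, RCLike.inner_apply, conj_trivial]
    push_cast
    rw [mul_left_comm, ← Complex.exp_add, hb]
    congr 2; ring
  rw [e1, e2]
  have h1 : (1 + x * I : ℂ) ≠ 0 := fun h => by simpa using congrArg Complex.re h
  have h2 : (-1 + x * I : ℂ) ≠ 0 := fun h => by simpa using congrArg Complex.re h
  have h3 : (1 + (x:ℂ) ^ 2 : ℂ) ≠ 0 := by
    have : (0:ℝ) < 1 + x ^ 2 := by positivity
    exact_mod_cast this.ne'
  have hpc : (Real.pi : ℂ) ≠ 0 := by exact_mod_cast hpi.ne'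
  rw [ha, hb, cauchyKer]
  push_cast
  field_simp
  linear_combination (-2 * (x:ℂ) ^ 2) * I_sq

theorem fourier_cauchyKer (x : ℝ) :
    𝓕 (fun s => (cauchyKer s : ℂ)) x = ((Real.pi * Real.exp (-(2 * Real.pi * |x|)) : ℝ) : ℂ) := by
  set h : ℝ → ℂ := fun t : ℝ => ((Real.pi * Real.exp (-(2 * Real.pi * |t|)) : ℝ) : ℂ) with hh
  have hc : Continuous h := by fun_prop
  have hi : Integrable h :=
    ((integrable_exp_neg_mul_abs (b := 2 * Real.pi) (by positivity)).const_mul Real.pi).ofReal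
  have hinv : 𝓕⁻ h = fun s => (cauchyKer s : ℂ) := funext fourierInv_exp_neg_abs
  have hF : 𝓕 h = fun s => (cauchyKer s : ℂ) := by
    ext s
    have := congrFun hinv (-s)
    rw [Real.fourierInv_eq_fourier_neg, neg_neg, cauchyKer_neg] at this
    exact this
  rw [← hinv, hc.fourier_fourierInv_eq hi (by rw [hF]; exact integrable_cauchyKer.ofReal)]

/-- Sums of a decreasing profile over an arithmetic progression are controlled by the sum centred
at the origin. -/
theorem sum_antitone_progression_le {φ : ℝ → ℝ} (hφ : AntitoneOn φ (Ici 0)) {σ : ℝ} {B : ℝ} (hB : ∀ n : ℕ, ∑ j ∈ Finset.range n, φ (j * |σ|) ≤ B)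
    (x : ℝ) (Q : ℕ) : ∑ q ∈ Finset.range Q, φ |x - q * σ| ≤ 2 * B := by
  wlog hσ : 0 ≤ σ generalizing σ x
  · have := this (σ := -σ) (by simpa using hB) (-x) (by linarith)
    refine le_trans (le_of_eq ?_) this
    refine Finset.sum_congr rfl fun q _ => ?_
    rw [← abs_neg]; congr 2; ring
  rw [abs_of_nonneg hσ] at hB
  have hB0 : 0 ≤ B := by simpa using hB 0
  have left : ∀ n : ℕ, (∀ q < n, (q:ℝ) * σ ≤ x) → ∑ q ∈ Finset.range n, φ |x - q * σ| ≤ B := by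
    intro n hn
    refine le_trans ?_ (hB n)
    rw [← Finset.sum_range_reflect]
    refine Finset.sum_le_sum fun q hq => ?_
    have hq' := Finset.mem_range.1 hq
    have h1 := hn (n - 1) (by omega)
    have h2 := hn (n - 1 - q) (by omega)
    refine hφ (by simp; positivity) (by simp) ?_
    rw [abs_of_nonneg (by linarith)]
    rw [show ((n - 1 - q : ℕ) : ℝ) = ((n - 1 : ℕ) : ℝ) - q by rw [Nat.cast_sub (by omega)]]
    nlinarith
  have right : ∀ (y : ℝ) (n : ℕ), y ≤ 0 → ∑ q ∈ Finset.range n, φ |y - q * σ| ≤ B := by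
    intro y n hy
    refine le_trans ?_ (hB n)
    refine Finset.sum_le_sum fun q hq => ?_
    have : 0 ≤ (q:ℝ) * σ := by positivity
    refine hφ (by simpa using this) (by simp) ?_
    rw [abs_of_nonpos (by linarith)]; linarith
  obtain ⟨Q₀, h0, h1⟩ : ∃ Q₀ ≤ Q, (∀ q < Q₀, (q:ℝ) * σ ≤ x) ∧ (Q₀ < Q → x ≤ Q₀ * σ) := by
    induction Q with
    | zero => exact ⟨0, le_rfl, by simp, by simp⟩
    | succ Q ih =>
      obtain ⟨Q₀, h0, h1, h2⟩ := ih
      by_cases hx : Q₀ < Q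
      · exact ⟨Q₀, by omega, h1, fun _ => h2 hx⟩
      · have : Q₀ = Q := by omega
        subst this
        by_cases hx : (Q₀:ℝ) * σ ≤ x
        · refine ⟨Q₀ + 1, le_rfl, fun q hq => ?_, by simp⟩
          rcases Nat.lt_succ_iff_lt_or_eq.1 hq with h | rfl
          · exact h1 q h
          · exact hx
        · exact ⟨Q₀, by omega, h1, fun _ => (not_le.1 hx).le⟩
  have e : Q = Q₀ + (Q - Q₀) := by omega
  rw [e, Finset.sum_range_add]
  have hl := left Q₀ h1.1
  have hr : ∑ j ∈ Finset.range (Q - Q₀), φ |x - ((Q₀ + j : ℕ):ℝ) * σ| ≤ B := by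
    rcases h0.lt_or_eq with h | h
    · refine le_trans (le_of_eq ?_) (right (x - Q₀ * σ) (Q - Q₀) (by linarith [h1.2 h]))
      refine Finset.sum_congr rfl fun q _ => ?_
      congr 2; push_cast; ring
    · simp [h, hB0]
  linarith

/-- The symbol of `avg` up to the factor `π`. -/
def poissonSymbol (t : ℝ) : ℝ := Real.exp (-(2 * Real.pi * |t|))

theorem poissonSymbol_pos (t : ℝ) : 0 < poissonSymbol t := Real.exp_pos _
theorem poissonSymbol_le_one (t : ℝ) : poissonSymbol t ≤ 1 := by
  rw [poissonSymbol, Real.exp_le_one_iff, neg_nonpos]; positivity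

theorem continuous_poissonSymbol : Continuous poissonSymbol := by unfold poissonSymbol; fun_prop

theorem poissonSymbol_antitoneOn : AntitoneOn poissonSymbol (Ici 0) := by
  intro a ha b hb hab
  unfold poissonSymbol
  rw [abs_of_nonneg (show 0 ≤ a from ha), abs_of_nonneg (show 0 ≤ b from hb)]
  gcongr

theorem sum_poissonSymbol_sq_le {σ : ℝ} (hσ : σ ≠ 0) (y : ℝ) (Q : ℕ) :
    ∑ q ∈ Finset.range Q, poissonSymbol (y - q * σ) ^ 2 ≤ 2 * (1 - poissonSymbol σ ^ 2)⁻¹ := by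
  have hlt : poissonSymbol σ ^ 2 < 1 := by
    have : poissonSymbol σ < 1 := by
      rw [poissonSymbol, Real.exp_lt_one_iff, neg_lt_zero]; have := Real.pi_pos; positivity
    have h0 := poissonSymbol_pos σ
    nlinarith
  have key := sum_antitone_progression_le (φ := fun t => poissonSymbol t ^ 2) (σ := σ)
    (fun a ha b hb hab => pow_le_pow_left₀ (poissonSymbol_pos _).le (poissonSymbol_antitoneOn ha hb hab) 2)
    (B := (1 - poissonSymbol σ ^ 2)⁻¹) (fun n => ?_) y Q
  · simpa [poissonSymbol] using key
  · have e : ∀ j : ℕ, poissonSymbol (j * |σ|) ^ 2 = (poissonSymbol σ ^ 2) ^ j := by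
      intro j
      simp only [poissonSymbol, ← Real.exp_nat_mul]
      congr 1
      rw [abs_mul, abs_abs, Nat.abs_cast]; push_cast; ring
    simp_rw [e]
    rw [← one_div, le_div_iff₀ (by linarith), mul_comm, mul_neg_geom_sum]
    have : 0 ≤ (poissonSymbol σ ^ 2) ^ n := by positivity
    linarith

theorem abs_poissonSymbol_sub_le (σ : ℝ) {y y' : ℝ} (h : |y - y'| ≤ |σ|) :
    (poissonSymbol σ * poissonSymbol y - poissonSymbol (2 * σ) * poissonSymbol y') ^ 2 ≤
      poissonSymbol σ ^ 2 * (1 - poissonSymbol σ ^ 2) ^ 2 * poissonSymbol y ^ 2 := by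
  have e2 : poissonSymbol (2 * σ) = poissonSymbol σ ^ 2 := by
    simp only [poissonSymbol, ← Real.exp_nat_mul]; congr 1
    rw [abs_mul, abs_two]; push_cast; ring
  have h1 : poissonSymbol y' * poissonSymbol σ ≤ poissonSymbol y := by
    simp only [poissonSymbol, ← Real.exp_add]
    refine Real.exp_le_exp.2 ?_
    have := abs_sub_abs_le_abs_sub y y'
    have := Real.pi_pos
    nlinarith
  have h2 : poissonSymbol y * poissonSymbol σ ≤ poissonSymbol y' := by
    simp only [poissonSymbol, ← Real.exp_add]
    refine Real.exp_le_exp.2 ?_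
    have := abs_sub_abs_le_abs_sub y' y
    rw [abs_sub_comm] at this
    have := Real.pi_pos
    nlinarith
  rw [e2, ← mul_pow, ← mul_pow]
  have p0 := poissonSymbol_pos σ
  have p1 := poissonSymbol_pos y
  have q0 : 0 ≤ poissonSymbol σ * poissonSymbol y - poissonSymbol σ ^ 2 * poissonSymbol y' := by
    nlinarith
  refine pow_le_pow_left₀ q0 ?_ 2
  nlinarith [mul_le_mul_of_nonneg_left h2 (sq_nonneg (poissonSymbol σ))]

/-- The symbol of a Nikodym average. -/
def nikodymSymbol (i : ℕ) (r a b : ℝ) (q : ℕ) : ℝ :=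
  poissonSymbol (r / 2 ^ i * a) * poissonSymbol (r * (b - q / 2 ^ i * a))

theorem sum_nikodymSymbol_sub_sq_le (i : ℕ) (ρ a b : ℝ) (K : ℕ) :
    ∑ k ∈ Finset.range K, ∑ q ∈ Finset.range (2 ^ (i + 1)),
      (nikodymSymbol (i + 1) (2 ^ k * ρ) a b q - nikodymSymbol i (2 ^ k * ρ) a b (q / 2)) ^ 2 ≤ 2 := by
  set w : ℕ → ℝ := fun k => poissonSymbol (2 ^ k * ρ / 2 ^ (i + 1) * a) ^ 2 with hw
  have hw2 : ∀ k, w (k + 1) = w k ^ 2 := by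
    intro k
    simp only [hw, poissonSymbol, ← Real.exp_nat_mul]; congr 1
    rw [show (2:ℝ) ^ (k + 1) * ρ / 2 ^ (i + 1) * a = 2 * (2 ^ k * ρ / 2 ^ (i + 1) * a) by ring, abs_mul,
      abs_two]
    push_cast; ring
  have step : ∀ k, ∑ q ∈ Finset.range (2 ^ (i + 1)),
      (nikodymSymbol (i + 1) (2 ^ k * ρ) a b q - nikodymSymbol i (2 ^ k * ρ) a b (q / 2)) ^ 2 ≤
      2 * (w k - w (k + 1)) := by
    intro k
    set r := 2 ^ k * ρ with hr
    set σ := r / 2 ^ (i + 1) * a with hσ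
    have h1 : ∀ q : ℕ, (nikodymSymbol (i + 1) r a b q - nikodymSymbol i r a b (q / 2)) ^ 2 ≤
        poissonSymbol σ ^ 2 * (1 - poissonSymbol σ ^ 2) ^ 2 * poissonSymbol (r * b - q * σ) ^ 2 := by
      intro q
      have e1 : nikodymSymbol (i + 1) r a b q = poissonSymbol σ * poissonSymbol (r * b - q * σ) := by
        rw [nikodymSymbol, hσ]; congr 2; ring
      have e2 : nikodymSymbol i r a b (q / 2) =
          poissonSymbol (2 * σ) * poissonSymbol (r * b - (2 * (q / 2 : ℕ) : ℝ) * σ) := by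
        rw [nikodymSymbol, hσ]; congr 2 <;> ring
      rw [e1, e2]
      refine abs_poissonSymbol_sub_le σ ?_
      have hq : (q:ℝ) = 2 * (q / 2 : ℕ) + (q % 2 : ℕ) := by exact_mod_cast (Nat.div_add_mod q 2).symm
      have : r * b - q * σ - (r * b - (2 * (q / 2 : ℕ) : ℝ) * σ) = -((q % 2 : ℕ) : ℝ) * σ := by
        linear_combination (-σ) * hq
      rw [this, abs_mul, abs_neg, Nat.abs_cast]
      have h01 : ((q % 2 : ℕ) : ℝ) ≤ 1 := by exact_mod_cast (by omega : q % 2 ≤ 1)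
      nlinarith [abs_nonneg σ]
    refine (Finset.sum_le_sum fun q _ => h1 q).trans ?_
    rw [← Finset.mul_sum, hw2]
    have hwk : w k = poissonSymbol σ ^ 2 := rfl
    rw [hwk]
    by_cases h0 : σ = 0
    · have : poissonSymbol σ = 1 := by simp [h0, poissonSymbol]
      simp [this]
    · have h2 := sum_poissonSymbol_sq_le h0 (r * b) (2 ^ (i + 1))
      have hlt : poissonSymbol σ ^ 2 < 1 := by
        have : poissonSymbol σ < 1 := by
          rw [poissonSymbol, Real.exp_lt_one_iff, neg_lt_zero]; have := Real.pi_pos; positivity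
        have h0 := poissonSymbol_pos σ
        nlinarith
      have h3 : 1 - poissonSymbol σ ^ 2 ≠ 0 := by linarith
      refine (mul_le_mul_of_nonneg_left h2 (by positivity)).trans_eq ?_
      field_simp
  refine (Finset.sum_le_sum fun k _ => step k).trans ?_
  rw [← Finset.mul_sum, Finset.sum_range_sub']
  have h0 : w 0 ≤ 1 := pow_le_one₀ (poissonSymbol_pos _).le (poissonSymbol_le_one _)
  have h1 : 0 ≤ w K := sq_nonneg _
  linarith

theorem avg_fourierInv {γ : Plane → ℂ} (hγ : Nice γ) {g : Plane → ℝ} (hg0 : ∀ x, 0 ≤ g x)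
    (hg : ∀ x, (g x : ℂ) = 𝓕⁻ γ x) (v : Plane) :
    ∃ h : Plane → ℝ, (∀ x, 0 ≤ h x) ∧
      (∀ x, (h x : ℂ) = 𝓕⁻ (fun ξ => ((Real.pi * poissonSymbol (inner ℝ ξ v) : ℝ) : ℂ) * γ ξ) x) ∧
      ∀ x, avg v (fun x => ENNReal.ofReal (g x)) x = ENNReal.ofReal (h x) := by
  have hgc : Continuous g := by
    have : g = fun x => (𝓕⁻ γ x).re := funext fun x => by rw [← hg]; simp
    rw [this]; exact Complex.continuous_re.comp hγ.continuous_fourierInv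
  refine ⟨fun x => ∫ s, cauchyKer s * g (x - s • v), fun x => integral_nonneg fun s =>
    mul_nonneg (cauchyKer_pos s).le (hg0 _), fun x => ?_, fun x => ?_⟩
  · have := dirConv_fourierInv (κ := fun s => (cauchyKer s : ℂ)) integrable_cauchyKer.ofReal v
      hγ.integrable x
    simp_rw [fourier_cauchyKer] at this
    simp only [poissonSymbol]
    rw [← this, dirConv]
    simp_rw [← hg]
    rw [← integral_complex_ofReal]; push_cast; rfl
  · have hb : ∀ y, ‖g y‖ ≤ ∫ ξ, ‖γ ξ‖ := fun y => by
      rw [← Complex.norm_real, hg]; exact Nice.norm_fourierInv_le γ y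
    rw [ofReal_integral_eq_lintegral_ofReal]
    · simp_rw [avg, ENNReal.ofReal_mul (cauchyKer_pos _).le]
    · refine integrable_cauchyKer.mul_bdd (c := ∫ ξ, ‖γ ξ‖) ?_ (Filter.Eventually.of_forall fun s => hb _)
      exact (by fun_prop : Continuous fun s : ℝ => g (x - s • v)).aestronglyMeasurable
    · exact Filter.Eventually.of_forall fun s => mul_nonneg (cauchyKer_pos s).le (hg0 _)

/-- Averages over Nikodym-type parallelograms of eccentricity `2 ^ i`. -/
def nikodymAvg (e e' : Plane) (i : ℕ) (r : ℝ) (q : ℕ) (u : Plane → ℝ≥0∞) : Plane → ℝ≥0∞ :=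
  avg ((r / 2 ^ i) • e) (avg (r • (e' - ((q:ℝ) / 2 ^ i) • e)) u)

/-- The maximal function over all averages of eccentricity `2 ^ i` at the scales `2 ^ k * ρ`. -/
def nikodymMax (e e' : Plane) (ρ : ℝ) (K i : ℕ) (u : Plane → ℝ≥0∞) (x : Plane) : ℝ≥0∞ :=
  (Finset.range K ×ˢ Finset.range (2 ^ i)).sup fun z => nikodymAvg e e' i (2 ^ z.1 * ρ) z.2 u x

section Nikodym
variable (e e' : Plane) (ρ : ℝ) (K : ℕ)

theorem measurable_nikodymMax (i : ℕ) {u : Plane → ℝ≥0∞} (hu : Measurable u) :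
    Measurable (nikodymMax e e' ρ K i u) :=
  measurable_finset_sup _ fun _ => avg.measurable _ (avg.measurable _ hu)

theorem nikodymAvg_fourierInv {γ : Plane → ℂ} (hγ : Nice γ) {g : Plane → ℝ} (hg0 : ∀ x, 0 ≤ g x)
    (hg : ∀ x, (g x : ℂ) = 𝓕⁻ γ x) (i : ℕ) (r : ℝ) (q : ℕ) :
    ∃ h : Plane → ℝ, (∀ x, 0 ≤ h x) ∧
      (∀ x, (h x : ℂ) = 𝓕⁻ (fun ξ => ((Real.pi ^ 2 *
        nikodymSymbol i r (inner ℝ ξ e) (inner ℝ ξ e') q : ℝ) : ℂ) * γ ξ) x) ∧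
      ∀ x, nikodymAvg e e' i r q (fun x => ENNReal.ofReal (g x)) x = ENNReal.ofReal (h x) := by
  have hn : ∀ v : Plane, Nice (fun ξ => ((Real.pi * poissonSymbol (inner ℝ ξ v) : ℝ) : ℂ) * γ ξ) := by
    intro v
    have := hγ.dirConv_symbol (κ := fun s => (cauchyKer s : ℂ)) integrable_cauchyKer.ofReal v
    simp_rw [fourier_cauchyKer] at this
    exact this
  obtain ⟨h, h0, h1, h2⟩ := avg_fourierInv hγ hg0 hg (r • (e' - ((q:ℝ) / 2 ^ i) • e))
  obtain ⟨h', h0', h1', h2'⟩ := avg_fourierInv (hn _) h0 h1 ((r / 2 ^ i) • e)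
  refine ⟨h', h0', fun x => ?_, fun x => ?_⟩
  · rw [h1']
    refine congrFun (congrArg _ (funext fun ξ => ?_)) x
    rw [nikodymSymbol, inner_smul_right, inner_smul_right, inner_sub_right, inner_smul_right]
    push_cast; ring
  · rw [nikodymAvg, funext h2, h2']

theorem continuous_nikodymSymbol (i : ℕ) (r : ℝ) (q : ℕ) :
    Continuous fun ξ : Plane => nikodymSymbol i r (inner ℝ ξ e) (inner ℝ ξ e') q := by
  have := continuous_poissonSymbol
  unfold nikodymSymbol
  fun_prop

theorem nikodymSymbol_mem (i : ℕ) (r a b : ℝ) (q : ℕ) : nikodymSymbol i r a b q ∈ Ioc (0:ℝ) 1 :=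
  ⟨mul_pos (poissonSymbol_pos _) (poissonSymbol_pos _),
    mul_le_one₀ (poissonSymbol_le_one _) (poissonSymbol_pos _).le (poissonSymbol_le_one _)⟩

theorem Nice.integrable_normSq {γ : Plane → ℂ} (hγ : Nice γ) : Integrable fun ξ => ‖γ ξ‖ ^ 2 :=
  hγ.memLp_two.integrable_norm_pow (p := 2) (by norm_num)

theorem nikodymMax_succ {γ : Plane → ℂ} (hγ : Nice γ) {g : Plane → ℝ} (hg0 : ∀ x, 0 ≤ g x)
    (hg : ∀ x, (g x : ℂ) = 𝓕⁻ γ x) (i : ℕ) :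
    ∃ S : Plane → ℝ≥0∞, Measurable S ∧
      (∀ x, nikodymMax e e' ρ K (i + 1) (fun x => ENNReal.ofReal (g x)) x ≤
        nikodymMax e e' ρ K i (fun x => ENNReal.ofReal (g x)) x + S x) ∧
      ∫⁻ x, S x ^ 2 ≤ ENNReal.ofReal (2 * Real.pi ^ 4) * ∫⁻ x, ENNReal.ofReal (g x) ^ 2 := by
  set s := Finset.range K ×ˢ Finset.range (2 ^ (i + 1)) with hs
  set m : ℕ × ℕ → Plane → ℝ := fun z ξ => Real.pi ^ 2 *
    (nikodymSymbol (i + 1) (2 ^ z.1 * ρ) (inner ℝ ξ e) (inner ℝ ξ e') z.2 -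
      nikodymSymbol i (2 ^ z.1 * ρ) (inner ℝ ξ e) (inner ℝ ξ e') (z.2 / 2)) with hm
  set D : ℕ × ℕ → Plane → ℂ := fun z => 𝓕⁻ (fun ξ => (m z ξ : ℂ) * γ ξ) with hD
  have hpi := Real.pi_pos
  have hmn : ∀ (i : ℕ) (r : ℝ) (q : ℕ), Nice (fun ξ => ((Real.pi ^ 2 *
        nikodymSymbol i r (inner ℝ ξ e) (inner ℝ ξ e') q : ℝ) : ℂ) * γ ξ) := by
    intro i r q
    refine hγ.mul_bdd (B := Real.pi ^ 2) ?_ fun ξ => ?_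
    · have := continuous_nikodymSymbol e e' i r q
      exact (by fun_prop : Continuous fun ξ : Plane => ((Real.pi ^ 2 *
        nikodymSymbol i r (inner ℝ ξ e) (inner ℝ ξ e') q : ℝ) : ℂ)).measurable
    · have := nikodymSymbol_mem i r (inner ℝ ξ e) (inner ℝ ξ e') q
      rw [Complex.norm_real, Real.norm_of_nonneg (mul_nonneg (by positivity) this.1.le)]
      exact mul_le_of_le_one_right (by positivity) this.2
  have hDn : ∀ z, Nice (fun ξ => (m z ξ : ℂ) * γ ξ) := by
    intro z
    convert! (hmn (i + 1) (2 ^ z.1 * ρ) z.2).sub (hmn i (2 ^ z.1 * ρ) (z.2 / 2)) using 1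
    ext ξ; simp only [hm, Pi.sub_apply]; push_cast; ring
  have hDc : ∀ z, Continuous (D z) := fun z => (hDn z).continuous_fourierInv
  refine ⟨fun x => ENNReal.ofReal (Real.sqrt (∑ z ∈ s, ‖D z x‖ ^ 2)), ?_, fun x => ?_, ?_⟩
  · exact (by fun_prop : Continuous fun x => Real.sqrt (∑ z ∈ s, ‖D z x‖ ^ 2)).measurable.ennreal_ofReal
  · refine Finset.sup_le fun z hz => ?_
    obtain ⟨h, h0, h1, h2⟩ := nikodymAvg_fourierInv e e' hγ hg0 hg (i + 1) (2 ^ z.1 * ρ) z.2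
    obtain ⟨h', h0', h1', h2'⟩ := nikodymAvg_fourierInv e e' hγ hg0 hg i (2 ^ z.1 * ρ) (z.2 / 2)
    have hz' : (z.1, z.2 / 2) ∈ Finset.range K ×ˢ Finset.range (2 ^ i) := by
      simp only [Finset.mem_product, Finset.mem_range] at hz ⊢
      refine ⟨hz.1, ?_⟩
      have := hz.2; rw [pow_succ] at this; omega
    have hle := Finset.le_sup (f := fun z : ℕ × ℕ => nikodymAvg e e' i (2 ^ z.1 * ρ) z.2
      (fun x => ENNReal.ofReal (g x)) x) hz'
    refine le_trans ?_ (add_le_add hle le_rfl)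
    simp only
    rw [h2, h2', ← ENNReal.ofReal_add (h0' _) (Real.sqrt_nonneg _)]
    refine ENNReal.ofReal_le_ofReal ?_
    have e1 : D z x = ((h x - h' x : ℝ) : ℂ) := by
      have := congrFun (Nice.fourierInv_sub (hmn (i + 1) (2 ^ z.1 * ρ) z.2) (hmn i (2 ^ z.1 * ρ) (z.2 / 2))) x
      rw [Pi.sub_apply, ← h1, ← h1'] at this
      rw [Complex.ofReal_sub, ← this, hD]
      refine congrFun (congrArg _ (funext fun ξ => ?_)) x
      simp only [hm, Pi.sub_apply]; push_cast; ring
    have e2 : h x - h' x ≤ Real.sqrt (∑ z ∈ s, ‖D z x‖ ^ 2) := by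
      refine Real.le_sqrt_of_sq_le ?_
      refine le_trans (le_of_eq ?_) (Finset.single_le_sum (f := fun z => ‖D z x‖ ^ 2)
        (fun _ _ => sq_nonneg _) hz)
      simp only [e1]; rw [Complex.norm_real, Real.norm_eq_abs, sq_abs]
    linarith
  · have c1 : ∀ x, ENNReal.ofReal (Real.sqrt (∑ z ∈ s, ‖D z x‖ ^ 2)) ^ 2 =
        ENNReal.ofReal (∑ z ∈ s, ‖D z x‖ ^ 2) := fun x => by
      rw [← ENNReal.ofReal_pow (Real.sqrt_nonneg _), Real.sq_sqrt (by positivity)]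
    have c2 : ∀ x, ENNReal.ofReal (g x) ^ 2 = ENNReal.ofReal (‖𝓕⁻ γ x‖ ^ 2) := fun x => by
      rw [← hg, Complex.norm_real, Real.norm_of_nonneg (hg0 x), ENNReal.ofReal_pow (hg0 x)]
    simp_rw [c1, c2]
    have i1 : ∀ z, Integrable fun x => ‖D z x‖ ^ 2 := fun z =>
      (hDn z).memLp_two_fourierInv.integrable_norm_pow (p := 2) (by norm_num)
    rw [← ofReal_integral_eq_lintegral_ofReal (integrable_finsetSum _ fun z _ => i1 z)
        (Filter.Eventually.of_forall fun x => by positivity),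
      ← ofReal_integral_eq_lintegral_ofReal (hγ.memLp_two_fourierInv.integrable_norm_pow (p := 2) (by norm_num))
        (Filter.Eventually.of_forall fun x => by positivity), ← ENNReal.ofReal_mul (by positivity)]
    refine ENNReal.ofReal_le_ofReal ?_
    rw [integral_finsetSum _ fun z _ => i1 z, hγ.plancherel_sq, ← integral_const_mul]
    have e1 : ∀ z, ∫ x, ‖D z x‖ ^ 2 = ∫ ξ, ‖(m z ξ : ℂ) * γ ξ‖ ^ 2 := fun z => (hDn z).plancherel_sq
    simp_rw [e1]
    rw [← integral_finsetSum _ fun z _ => (hDn z).integrable_normSq]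
    refine integral_mono (integrable_finsetSum _ fun z _ => (hDn z).integrable_normSq)
      (hγ.integrable_normSq.const_mul _) fun ξ => ?_
    simp only [norm_mul, mul_pow, Complex.norm_real, Real.norm_eq_abs, sq_abs]
    rw [← Finset.sum_mul]
    refine mul_le_mul_of_nonneg_right ?_ (sq_nonneg _)
    simp only [hm, mul_pow]
    rw [← Finset.mul_sum, hs, Finset.sum_product]
    have := sum_nikodymSymbol_sub_sq_le i ρ (inner ℝ ξ e) (inner ℝ ξ e') K
    calc _ ≤ (Real.pi ^ 2) ^ 2 * 2 := by gcongr
      _ = _ := by ring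

/-- The Nikodym maximal inequality with logarithmic loss. -/
theorem exists_nikodymMax_le : ∃ C : ℝ≥0, ∀ (e e' : Plane) (ρ : ℝ) (K : ℕ) (_ : 0 < ρ)
    {γ : Plane → ℂ} (_ : Nice γ) {g : Plane → ℝ} (_ : ∀ x, 0 ≤ g x) (_ : ∀ x, (g x : ℂ) = 𝓕⁻ γ x)
    (i : ℕ), ∫⁻ x, nikodymMax e e' ρ K i (fun x => ENNReal.ofReal (g x)) x ^ 2 ≤
      C * (i + 1) ^ 2 * ∫⁻ x, ENNReal.ofReal (g x) ^ 2 := by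
  set C₀ : ℝ≥0 := Real.toNNReal (4 * (4 * Real.pi) ^ 4 + 1) with hC₀
  refine ⟨C₀, fun e e' ρ K hρ γ hγ g hg0 hg i => ?_⟩
  have hgm : Measurable g := by
    have : g = fun x => (𝓕⁻ γ x).re := funext fun x => by rw [← hg]; simp
    rw [this]; exact (Complex.continuous_re.comp hγ.continuous_fourierInv).measurable
  set u : Plane → ℝ≥0∞ := fun x => ENNReal.ofReal (g x) with hu
  have hum : Measurable u := hgm.ennreal_ofReal
  set U := ∫⁻ x, u x ^ 2 with hU
  have hcC : ENNReal.ofReal (2 * Real.pi ^ 4) ≤ C₀ := by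
    have : 2 * Real.pi ^ 4 ≤ 4 * (4 * Real.pi) ^ 4 + 1 := by
      have : 0 ≤ Real.pi ^ 4 := by positivity
      nlinarith
    exact ENNReal.ofReal_le_ofReal this
  have main : (∫⁻ x, nikodymMax e e' ρ K i u x ^ 2) ^ (1 / 2 : ℝ) ≤
      (i + 1) * (C₀ * U) ^ (1 / 2 : ℝ) := by
    induction i with
    | zero =>
      simp only [Nat.cast_zero, zero_add, one_mul]
      gcongr
      have := lintegral_sup_avg_avg_sq_le (Finset.range K) (fun k => 2 ^ k * ρ) (fun k => by positivity)
        e e' hum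
      refine le_trans (lintegral_mono fun x => ?_) this
      gcongr
      refine Finset.sup_le fun z hz => ?_
      simp only [Finset.mem_product, Finset.mem_range, pow_zero, Nat.lt_one_iff] at hz
      refine le_trans (le_of_eq ?_) (Finset.le_sup (Finset.mem_range.2 hz.1))
      simp [nikodymAvg, hz.2]
    | succ i ih =>
      obtain ⟨S, hS, h1, h2⟩ := nikodymMax_succ e e' ρ K hγ hg0 hg i
      have hmm := measurable_nikodymMax e e' ρ K i hum
      calc _ ≤ (∫⁻ x, (nikodymMax e e' ρ K i u x + S x) ^ (2:ℝ)) ^ (1 / 2 : ℝ) := by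
            gcongr with x
            rw [ENNReal.rpow_two]; gcongr; exact h1 x
        _ ≤ (∫⁻ x, nikodymMax e e' ρ K i u x ^ (2:ℝ)) ^ (1 / 2 : ℝ) +
            (∫⁻ x, S x ^ (2:ℝ)) ^ (1 / 2 : ℝ) :=
            ENNReal.lintegral_Lp_add_le hmm.aemeasurable hS.aemeasurable (by norm_num)
        _ ≤ (i + 1) * (C₀ * U) ^ (1 / 2 : ℝ) + (C₀ * U) ^ (1 / 2 : ℝ) := by
            simp_rw [ENNReal.rpow_two]
            gcongr
            exact h2.trans (by gcongr)
        _ = _ := by push_cast; ring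
  calc _ = ((∫⁻ x, nikodymMax e e' ρ K i u x ^ 2) ^ (1 / 2 : ℝ)) ^ 2 := by
        rw [← ENNReal.rpow_two, ← ENNReal.rpow_mul]; norm_num
    _ ≤ ((i + 1) * (C₀ * U) ^ (1 / 2 : ℝ)) ^ 2 := by gcongr
    _ = _ := by
        rw [mul_pow, ← ENNReal.rpow_two ((C₀ * U) ^ (1 / 2 : ℝ)), ← ENNReal.rpow_mul]; norm_num; ring

end Nikodym

section DirConv
variable {κ : ℝ → ℂ} {F : Plane → ℂ}

theorem measurable_dirConv (hκm : Measurable κ) (v : Plane) (hFm : Measurable F) :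
    Measurable (dirConv κ v F) := by
  have : Measurable (fun z : Plane × ℝ => κ z.2 * F (z.1 - z.2 • v)) := by fun_prop
  exact this.stronglyMeasurable.integral_prod_right'.measurable

theorem integrable_dirConv_prod (hκ : Integrable κ) (hκm : Measurable κ) (v : Plane) (hF : Integrable F)
    (hFm : Measurable F) :
    Integrable (fun z : Plane × ℝ => κ z.2 * F (z.1 - z.2 • v)) (volume.prod volume) := by
  have : Measurable (fun z : Plane × ℝ => κ z.2 * F (z.1 - z.2 • v)) := by fun_prop
  rw [integrable_prod_iff' this.aestronglyMeasurable]
  refine ⟨Filter.Eventually.of_forall fun s => by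
    exact (hF.comp_sub_right (s • v)).const_mul (κ s), ?_⟩
  simp only [norm_mul]
  have e : ∀ s : ℝ, ∫ x, ‖κ s‖ * ‖F (x - s • v)‖ = ‖κ s‖ * ∫ x, ‖F x‖ := fun s => by
    rw [integral_const_mul, integral_sub_right_eq_self (fun x => ‖F x‖)]
  simp_rw [e]
  exact hκ.norm.mul_const _

theorem Nice.dirConv (hF : Nice F) (hFm : Measurable F) (hκ : Integrable κ) (hκm : Measurable κ)
    (v : Plane) : Nice (dirConv κ v F) := by
  obtain ⟨C, hC⟩ := hF.bdd
  refine ⟨(integrable_dirConv_prod hκ hκm v hF.integrable hFm).integral_prod_left, (∫ s, ‖κ s‖) * C,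
    fun x => ?_⟩
  rw [_root_.dirConv, ← integral_mul_const]
  refine norm_integral_le_of_norm_le (hκ.norm.mul_const C) (Filter.Eventually.of_forall fun s => ?_)
  rw [norm_mul]
  exact mul_le_mul_of_nonneg_left (hC _) (norm_nonneg _)

theorem fourierInv_dirConv (hF : Integrable F) (hFm : Measurable F) (hκ : Integrable κ)
    (hκm : Measurable κ) (v ξ : Plane) :
    𝓕⁻ (dirConv κ v F) ξ = 𝓕 κ (-inner ℝ ξ v) * 𝓕⁻ F ξ := by
  have hi : Integrable (Function.uncurry fun (x : Plane) (s : ℝ) =>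
      cexp (↑(2 * Real.pi * inner ℝ x ξ) * I) * (κ s * F (x - s • v))) (volume.prod volume) := by
    refine (integrable_dirConv_prod hκ hκm v hF hFm).bdd_mul (c := 1) ?_
      (Filter.Eventually.of_forall fun z => ?_)
    · exact (by fun_prop : Continuous fun z : Plane × ℝ =>
        cexp (↑(2 * Real.pi * inner ℝ z.1 ξ) * I)).aestronglyMeasurable
    · rw [Complex.norm_exp_ofReal_mul_I]
  have shift : ∀ s : ℝ, ∫ x, cexp (↑(2 * Real.pi * inner ℝ x ξ) * I) * F (x - s • v) =
      cexp (↑(2 * Real.pi * s * inner ℝ ξ v) * I) * ∫ x, cexp (↑(2 * Real.pi * inner ℝ x ξ) * I) * F x := by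
    intro s
    rw [← integral_sub_right_eq_self (fun x => cexp (↑(2 * Real.pi * inner ℝ x ξ) * I) * F x) (s • v),
      ← integral_const_mul]
    refine integral_congr_ae (Filter.Eventually.of_forall fun x => ?_)
    simp only
    rw [← mul_assoc, ← Complex.exp_add]
    congr 2
    rw [inner_sub_left, real_inner_smul_left, real_inner_comm ξ v]; push_cast; ring
  simp_rw [Real.fourierInv_eq', Real.fourier_real_eq_integral_exp_smul, smul_eq_mul]
  calc _ = ∫ x, ∫ s, cexp (↑(2 * Real.pi * inner ℝ x ξ) * I) * (κ s * F (x - s • v)) := by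
        simp_rw [integral_const_mul]; rfl
    _ = ∫ s, ∫ x, cexp (↑(2 * Real.pi * inner ℝ x ξ) * I) * (κ s * F (x - s • v)) :=
        integral_integral_swap hi
    _ = ∫ s, κ s * ∫ x, cexp (↑(2 * Real.pi * inner ℝ x ξ) * I) * F (x - s • v) := by
        refine integral_congr_ae (Filter.Eventually.of_forall fun s => ?_)
        simp only
        rw [← integral_const_mul]
        refine integral_congr_ae (Filter.Eventually.of_forall fun x => ?_)
        simp only; ring
    _ = _ := by
        rw [← integral_mul_const]
        refine integral_congr_ae (Filter.Eventually.of_forall fun s => ?_)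
        simp only [shift]
        rw [← mul_assoc, mul_comm (κ s)]
        congr 3; push_cast; ring

theorem enorm_dirConv_le {C : ℝ} (hC : ∀ s, ‖κ s‖ ≤ C * cauchyKer s) (hC0 : 0 ≤ C) (v : Plane)
    (hFm : Measurable F) (x : Plane) :
    ‖dirConv κ v F x‖ₑ ≤ ENNReal.ofReal C * avg v (fun x => ‖F x‖ₑ) x := by
  rw [dirConv, avg, ← lintegral_const_mul _ (by fun_prop)]
  refine (enorm_integral_le_lintegral_enorm _).trans (lintegral_mono fun s => ?_)
  rw [enorm_mul, ← mul_assoc, ← ENNReal.ofReal_mul hC0]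
  gcongr
  rw [← ofReal_norm]
  exact ENNReal.ofReal_le_ofReal (hC s)

end DirConv

theorem sum_inv_one_add_sq_le {s : ℝ} (hs : s ≠ 0) (y : ℝ) (Q : ℕ) :
    ∑ q ∈ Finset.range Q, ((1 + |y - q * s|) ^ 2)⁻¹ ≤ 2 * (1 + |s|⁻¹) := by
  have hs' : 0 < |s| := abs_pos.2 hs
  refine sum_antitone_progression_le (φ := fun t => ((1 + t) ^ 2)⁻¹) (σ := s) ?_ (fun n => ?_) y Q
  · intro a ha b hb hab
    have ha' : 0 ≤ a := ha
    simp only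
    gcongr
  · have key : ∀ n : ℕ, ∑ j ∈ Finset.range (n + 1), ((1 + (j:ℝ) * |s|) ^ 2)⁻¹ ≤
        1 + |s|⁻¹ * (1 - (1 + (n:ℝ) * |s|)⁻¹) := by
      intro n
      induction n with
      | zero => simp
      | succ n ih =>
        rw [Finset.sum_range_succ]
        have h1 : ((1 + ((n + 1 : ℕ):ℝ) * |s|) ^ 2)⁻¹ ≤
            |s|⁻¹ * ((1 + (n:ℝ) * |s|)⁻¹ - (1 + ((n + 1 : ℕ):ℝ) * |s|)⁻¹) := by
          push_cast
          have a0 : 0 < 1 + (n:ℝ) * |s| := by positivity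
          have a1 : 0 < 1 + ((n:ℝ) + 1) * |s| := by positivity
          have : |s|⁻¹ * ((1 + (n:ℝ) * |s|)⁻¹ - (1 + ((n:ℝ) + 1) * |s|)⁻¹) =
              ((1 + (n:ℝ) * |s|) * (1 + ((n:ℝ) + 1) * |s|))⁻¹ := by
            field_simp; ring
          rw [this, sq]
          gcongr
          linarith
        linarith
    have h0 : ∑ j ∈ Finset.range n, ((1 + (j:ℝ) * |s|) ^ 2)⁻¹ ≤
        ∑ j ∈ Finset.range (n + 1), ((1 + (j:ℝ) * |s|) ^ 2)⁻¹ := by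
      rw [Finset.sum_range_succ]
      have : 0 ≤ ((1 + (n:ℝ) * |s|) ^ 2)⁻¹ := by positivity
      linarith
    refine h0.trans ((key n).trans ?_)
    have : 0 ≤ |s|⁻¹ * (1 + (n:ℝ) * |s|)⁻¹ := by positivity
    linarith

theorem sum_dyadic_le {s : ℝ} (hs : 0 ≤ s) (J : ℕ) :
    ∑ j ∈ Finset.range J, (2 ^ j * s) / (1 + 2 ^ j * s) ^ 2 ≤ 2 := by
  set φ : ℕ → ℝ := fun j => 2 ^ j * s / (1 + 2 ^ j * s) with hφ
  have h1 : ∀ j, (2 ^ j * s) / (1 + 2 ^ j * s) ^ 2 ≤ 2 * (φ (j + 1) - φ j) := by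
    intro j
    set t := 2 ^ j * s with ht
    have ht0 : 0 ≤ t := by positivity
    have e : φ (j + 1) - φ j = t / ((1 + t) * (1 + 2 * t)) := by
      simp only [hφ]
      rw [show (2:ℝ) ^ (j + 1) * s = 2 * t by rw [ht]; ring, ← ht]
      field_simp; ring
    rw [e, ← mul_div_assoc, div_le_div_iff₀ (by positivity) (by positivity)]
    nlinarith [mul_nonneg ht0 ht0, mul_nonneg (mul_nonneg ht0 ht0) ht0]
  refine (Finset.sum_le_sum fun j _ => h1 j).trans ?_
  rw [← Finset.mul_sum, Finset.sum_range_sub]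
  have h0 : 0 ≤ φ 0 := by simp only [hφ]; positivity
  have h2 : φ J ≤ 1 := by
    simp only [hφ]; rw [div_le_one (by positivity)]; linarith
  linarith

/-- Almost orthogonality on the symbol side. -/
theorem sum_symbol_le {m₁ m₂ : ℝ → ℂ} {A : ℝ} (hm₁ : ∀ x, ‖m₁ x‖ ≤ A * |x| / (1 + |x|) ^ 2)
    (hm₂ : ∀ x, ‖m₂ x‖ ≤ A / (1 + |x|)) (s : ℝ) (y : ℕ → ℝ) (J Q : ℕ) :
    ∑ j ∈ Finset.range J, ∑ q ∈ Finset.range Q,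
      ‖m₁ (2 ^ j * s)‖ ^ 2 * ‖m₂ (y j - q * (2 ^ j * s))‖ ^ 2 ≤ 4 * A ^ 4 := by
  by_cases hs : s = 0
  · have : m₁ 0 = 0 := by simpa using hm₁ 0
    simp only [hs, mul_zero, this]; simp; positivity
  have step : ∀ j, ∑ q ∈ Finset.range Q, ‖m₁ (2 ^ j * s)‖ ^ 2 * ‖m₂ (y j - q * (2 ^ j * s))‖ ^ 2 ≤
      2 * A ^ 4 * ((2 ^ j * |s|) / (1 + 2 ^ j * |s|) ^ 2) := by
    intro j
    set t := 2 ^ j * s with ht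
    have htabs : |t| = 2 ^ j * |s| := by rw [ht, abs_mul, abs_of_pos (by positivity : (0:ℝ) < 2 ^ j)]
    have ht0 : t ≠ 0 := by positivity
    have hta : 0 < |t| := abs_pos.2 ht0
    rw [← Finset.mul_sum, ← htabs]
    have h2 : ∑ q ∈ Finset.range Q, ‖m₂ (y j - q * t)‖ ^ 2 ≤ A ^ 2 * (2 * (1 + |t|⁻¹)) := by
      refine le_trans (Finset.sum_le_sum fun q _ => ?_) (le_trans (Finset.mul_sum _ _ _).symm.le
        (mul_le_mul_of_nonneg_left (sum_inv_one_add_sq_le ht0 (y j) Q) (sq_nonneg A)))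
      refine (pow_le_pow_left₀ (norm_nonneg _) (hm₂ _) 2).trans_eq ?_
      rw [div_pow, div_eq_mul_inv]
    have h1 : ‖m₁ t‖ ^ 2 ≤ (A * |t| / (1 + |t|) ^ 2) ^ 2 := pow_le_pow_left₀ (norm_nonneg _) (hm₁ _) 2
    refine (mul_le_mul h1 h2 (by positivity) (by positivity)).trans ?_
    have e : (A * |t| / (1 + |t|) ^ 2) ^ 2 * (A ^ 2 * (2 * (1 + |t|⁻¹))) =
        2 * A ^ 4 * (|t| / (1 + |t|) ^ 3) := by
      field_simp; ring
    rw [e]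
    have hA : 0 ≤ 2 * A ^ 4 := by positivity
    refine mul_le_mul_of_nonneg_left ?_ hA
    refine div_le_div_of_nonneg_left hta.le (by positivity) ?_
    exact pow_le_pow_right₀ (by linarith) (by norm_num)
  refine (Finset.sum_le_sum fun j _ => step j).trans ?_
  rw [← Finset.mul_sum]
  have := sum_dyadic_le (abs_nonneg s) J
  have := mul_le_mul_of_nonneg_left this (by positivity : 0 ≤ 2 * A ^ 4)
  linarith

section Kernels
open scoped SchwartzMap ContDiff

theorem SchwartzMap.exists_decay (g : 𝓢(ℝ, ℂ)) (k : ℕ) :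
    ∃ A : ℝ, 0 ≤ A ∧ ∀ x, ‖g x‖ ≤ A / (1 + |x|) ^ k := by
  refine ⟨2 ^ k * (Finset.Iic (k, 0)).sup (fun m => SchwartzMap.seminorm ℝ m.1 m.2) g,
    by positivity, fun x => ?_⟩
  rw [le_div_iff₀ (by positivity), mul_comm]
  have := SchwartzMap.one_add_le_sup_seminorm_apply (𝕜 := ℝ) (m := (k, 0)) (k := k) (n := 0) le_rfl le_rfl g x
  simpa [norm_iteratedFDeriv_zero] using this

theorem SchwartzMap.exists_le_cauchyKer (g : 𝓢(ℝ, ℂ)) :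
    ∃ C : ℝ, 0 ≤ C ∧ ∀ x, ‖g x‖ ≤ C * cauchyKer x := by
  obtain ⟨A, hA, h⟩ := g.exists_decay 2
  refine ⟨A, hA, fun x => (h x).trans ?_⟩
  rw [div_eq_mul_inv, cauchyKer]
  gcongr
  have : (1 + |x|) ^ 2 = 1 + 2 * |x| + x ^ 2 := by rw [add_sq, sq_abs]; ring
  rw [this]; have := abs_nonneg x; linarith

/-- A Schwartz function inverting the Fourier multiplier `𝓕 κ` on a ball where it does not vanish. -/
theorem SchwartzMap.exists_fourier_mul_eq_one (κ : 𝓢(ℝ, ℂ)) (c : ℝ) {r R : ℝ} (hr : 0 < r) (hrR : r < R)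
    (hκ : ∀ x ∈ Metric.closedBall c R, 𝓕 (κ : ℝ → ℂ) x ≠ 0) :
    ∃ ν : 𝓢(ℝ, ℂ), ∀ x ∈ Metric.closedBall c r, 𝓕 (ν : ℝ → ℂ) x * 𝓕 (κ : ℝ → ℂ) x = 1 := by
  let ψ : ContDiffBump c := ⟨r, R, hr, hrR⟩
  let h : ℝ → ℂ := fun x => (ψ x : ℂ) * (𝓕 (κ : ℝ → ℂ) x)⁻¹
  have hκs : ContDiff ℝ ∞ (𝓕 (κ : ℝ → ℂ)) := by
    rw [← SchwartzMap.fourier_coe]; exact (𝓕 κ).smooth ⊤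
  have hψs : ContDiff ℝ ∞ (fun x => (ψ x : ℂ)) := Complex.ofRealCLM.contDiff.comp ψ.contDiff
  have hsupp : HasCompactSupport (fun x => (ψ x : ℂ)) :=
    ψ.hasCompactSupport.comp_left (g := fun x : ℝ => (x : ℂ)) (by simp)
  have hcs : HasCompactSupport h := hsupp.mul_right
  have hsm : ContDiff ℝ ∞ h := by
    rw [contDiff_iff_contDiffAt]
    intro x
    by_cases hx : x ∈ Metric.closedBall c R
    · exact hψs.contDiffAt.mul (hκs.contDiffAt.inv (hκ x hx))
    · have : h =ᶠ[nhds x] fun _ => 0 := by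
        filter_upwards [Metric.isClosed_closedBall.isOpen_compl.mem_nhds hx] with y hy
        have : ψ y = 0 := ψ.zero_of_le_dist (le_of_lt (not_le.1 hy))
        simp [h, this]
      exact contDiffAt_const.congr_of_eventuallyEq this
  let H : 𝓢(ℝ, ℂ) := hcs.toSchwartzMap hsm
  refine ⟨𝓕⁻ H, fun x hx => ?_⟩
  have e : 𝓕 ((𝓕⁻ H : 𝓢(ℝ, ℂ)) : ℝ → ℂ) = h := by
    rw [← SchwartzMap.fourier_coe, FourierTransform.fourier_fourierInv_eq]; rfl
  rw [e]
  have h1 : ψ x = 1 := ψ.one_of_mem_closedBall hx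
  simp only [h, h1, ofReal_one, one_mul]
  exact inv_mul_cancel₀ (hκ x (Metric.closedBall_subset_closedBall hrR.le hx))

/-- Kernels on the line with compact support, one of them having mean zero, with Schwartz inverses of
their Fourier multipliers on prescribed frequency ranges. -/
theorem exists_reproducing_kernels : ∃ (κ₁ κ₂ ν₁ ν₂ : 𝓢(ℝ, ℂ)) (A : ℝ),
    (∀ s, 1 < |s| → κ₁ s = 0) ∧ (∀ s, 1 < |s| → κ₂ s = 0) ∧
    (∀ x, ‖𝓕 (κ₁ : ℝ → ℂ) x‖ ≤ A * |x| / (1 + |x|) ^ 2) ∧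
    (∀ x, ‖𝓕 (κ₂ : ℝ → ℂ) x‖ ≤ A / (1 + |x|)) ∧
    (∀ x, 1 ≤ x → x ≤ 2 → 𝓕 (ν₁ : ℝ → ℂ) x * 𝓕 (κ₁ : ℝ → ℂ) x = 1) ∧
    (∀ x, |x| ≤ 16 → 𝓕 (ν₂ : ℝ → ℂ) x * 𝓕 (κ₂ : ℝ → ℂ) x = 1) := by
  let φ : ContDiffBump (0 : ℝ) := ⟨1 / 400, 1 / 200, by norm_num, by norm_num⟩
  have hs : ContDiff ℝ ∞ (fun x => (φ.normed volume x : ℂ)) :=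
    Complex.ofRealCLM.contDiff.comp φ.contDiff_normed
  have hc : HasCompactSupport (fun x => (φ.normed volume x : ℂ)) :=
    (φ.hasCompactSupport_normed).comp_left (g := fun x : ℝ => (x : ℂ)) (by simp)
  let η : 𝓢(ℝ, ℂ) := hc.toSchwartzMap hs
  have hη : ∀ x, η x = (φ.normed volume x : ℂ) := fun x => rfl
  have hsupp : ∀ x, 1 / 200 ≤ |x| → φ.normed volume x = 0 := fun x hx => by
    rw [← Function.notMem_support, φ.support_normed_eq, Metric.mem_ball, Real.dist_eq, sub_zero, not_lt]
    exact hx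
  have hfd : ∀ x, |x| ≤ 17 → 𝓕 (η : ℝ → ℂ) x ≠ 0 := by
    intro x hx h0
    have e1 : 𝓕 (η : ℝ → ℂ) x - 1 = ∫ s, (cexp (↑(-2 * Real.pi * s * x) * I) - 1) * φ.normed volume s := by
      have : (1:ℂ) = ∫ s, (φ.normed volume s : ℂ) := by
        rw [integral_complex_ofReal, φ.integral_normed]; simp
      rw [this, Real.fourier_real_eq_integral_exp_smul, ← integral_sub]
      · refine integral_congr_ae (Filter.Eventually.of_forall fun s => ?_)
        simp only [smul_eq_mul, hη]; rw [← this]; ring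
      · refine η.integrable.bdd_mul (c := 1) (by fun_prop) (Filter.Eventually.of_forall fun s => ?_)
        rw [Complex.norm_exp_ofReal_mul_I]
      · exact η.integrable
    have e2 : ‖𝓕 (η : ℝ → ℂ) x - 1‖ ≤ ∫ s, (4 * 17 / 200 * 2) * φ.normed volume s := by
      rw [e1]
      refine norm_integral_le_of_norm_le (φ.integrable_normed.const_mul _)
        (Filter.Eventually.of_forall fun s => ?_)
      rw [norm_mul, norm_real, Real.norm_of_nonneg (φ.nonneg_normed s)]
      rcases le_or_gt (1 / 200) |s| with h | h
      · simp [hsupp s h]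
      · refine mul_le_mul_of_nonneg_right ?_ (φ.nonneg_normed s)
        rw [mul_comm _ I]
        refine (Real.norm_exp_I_mul_ofReal_sub_one_le).trans ?_
        rw [Real.norm_eq_abs, abs_mul, abs_mul, abs_mul, abs_neg, abs_of_pos Real.pi_pos, abs_two]
        have : |s| * |x| ≤ 1 / 200 * 17 := mul_le_mul h.le hx (abs_nonneg _) (by norm_num)
        nlinarith [Real.pi_le_four, Real.pi_pos]
    rw [h0, integral_const_mul, φ.integral_normed] at e2
    norm_num at e2
  let κ : 𝓢(ℝ, ℂ) := SchwartzMap.derivCLM ℂ ℂ η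
  have hκ : ∀ x, κ x = deriv η x := fun x => SchwartzMap.derivCLM_apply ℂ η x
  have hκf : ∀ x, 𝓕 (κ : ℝ → ℂ) x = 2 * Real.pi * I * x * 𝓕 (η : ℝ → ℂ) x := by
    intro x
    have : (κ : ℝ → ℂ) = deriv η := funext hκ
    rw [this, Real.fourier_deriv η.integrable η.differentiable (by rw [← this]; exact κ.integrable)]
    simp
  have hκs : ∀ x, 1 < |x| → κ x = 0 := by
    intro x hx
    rw [hκ]
    have : (η : ℝ → ℂ) =ᶠ[nhds x] fun _ => 0 := by
      filter_upwards [(isOpen_lt continuous_const continuous_abs).mem_nhds hx] with y hy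
      rw [hη, hsupp y (le_trans (by norm_num) (le_of_lt hy))]; simp
    rw [this.deriv_eq]; simp
  obtain ⟨A, hA, hAd⟩ := (𝓕 η).exists_decay 2
  obtain ⟨ν₁, h1⟩ := κ.exists_fourier_mul_eq_one (3 / 2) (r := 1 / 2) (R := 1) (by norm_num) (by norm_num)
    (fun x hx => by
      rw [Metric.mem_closedBall, Real.dist_eq, abs_le] at hx
      rw [hκf]
      refine mul_ne_zero (mul_ne_zero (mul_ne_zero (mul_ne_zero (by norm_num) ?_) I_ne_zero) ?_)
        (hfd x (abs_le.2 ⟨by linarith, by linarith⟩))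
      · exact_mod_cast Real.pi_ne_zero
      · have : x ≠ 0 := by intro h; rw [h] at hx; norm_num at hx
        exact_mod_cast this)
  obtain ⟨ν₂, h2⟩ := η.exists_fourier_mul_eq_one 0 (r := 16) (R := 17) (by norm_num) (by norm_num)
    (fun x hx => hfd x (by simpa using hx))
  refine ⟨κ, η, ν₁, ν₂, 2 * Real.pi * A, hκs, fun s h => ?_, fun x => ?_, fun x => ?_, fun x hx hx' => ?_,
    fun x hx => h2 x (by simpa using hx)⟩
  · rw [hη, hsupp s (le_trans (by norm_num) h.le)]; simp
  · rw [hκf]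
    have := hAd x
    rw [SchwartzMap.fourier_coe] at this
    simp only [norm_mul, norm_real, norm_I, mul_one, Complex.norm_ofNat, Real.norm_eq_abs,
      abs_of_pos Real.pi_pos]
    calc 2 * Real.pi * |x| * ‖𝓕 (η : ℝ → ℂ) x‖ ≤ 2 * Real.pi * |x| * (A / (1 + |x|) ^ 2) := by gcongr
      _ = _ := by ring
  · have := hAd x
    rw [SchwartzMap.fourier_coe] at this
    refine this.trans ?_
    rw [div_le_div_iff₀ (by positivity) (by positivity)]
    have h0 := abs_nonneg x
    have h3 : 1 ≤ 2 * Real.pi := by linarith [Real.pi_gt_three]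
    have h4 : A ≤ 2 * Real.pi * A := le_mul_of_one_le_left hA h3
    have h5 : 1 + |x| ≤ (1 + |x|) ^ 2 := by nlinarith
    exact mul_le_mul h4 h5 (by positivity) (by positivity)
  · refine h1 x ?_
    rw [Metric.mem_closedBall, Real.dist_eq, abs_le]
    constructor <;> linarith

end Kernels

theorem lintegral_enorm_sq_eq {F : Plane → ℂ} (hF : MemLp F 2) :
    ∫⁻ x, ‖F x‖ₑ ^ 2 = ENNReal.ofReal (∫ x, ‖F x‖ ^ 2) := by
  rw [ofReal_integral_eq_lintegral_ofReal]
  · refine lintegral_congr fun x => ?_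
    rw [← ofReal_norm, ENNReal.ofReal_pow (norm_nonneg _)]
  · exact hF.integrable_norm_pow (by norm_num)
  · exact Filter.Eventually.of_forall fun x => by positivity

theorem avg_le_shift (v : Plane) {u : Plane → ℝ≥0∞} (hu : Measurable u) {s : ℝ} (hs : |s| ≤ 1) (x : Plane) :
    avg v u x ≤ 3 * avg v u (x - s • v) := by
  have hs2 : s ^ 2 ≤ 1 := by rw [← sq_abs]; exact pow_le_one₀ (abs_nonneg s) hs
  rw [avg, avg, ← lintegral_const_mul _ (by
      have := measurable_cauchyKer
      fun_prop), ← lintegral_add_right_eq_self _ s]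
  refine lintegral_mono fun t => ?_
  have e : x - (t + s) • v = x - s • v - t • v := by rw [add_smul]; abel
  simp only
  rw [e, ← mul_assoc]
  gcongr
  rw [show (3:ℝ≥0∞) = ENNReal.ofReal 3 by simp, ← ENNReal.ofReal_mul (by norm_num)]
  refine ENNReal.ofReal_le_ofReal ?_
  rw [cauchyKer, cauchyKer, ← div_eq_mul_inv, inv_eq_one_div, div_le_div_iff₀ (by positivity) (by positivity)]
  nlinarith [sq_nonneg (t + 2 * s)]

theorem nikodymAvg_le_shift (e e' : Plane) (i : ℕ) (r : ℝ) (q : ℕ) {u : Plane → ℝ≥0∞} (hu : Measurable u)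
    {s t : ℝ} (hs : |s| ≤ 1) (ht : |t| ≤ 1) (x : Plane) :
    nikodymAvg e e' i r q u x ≤ 9 * nikodymAvg e e' i r q u
      (x - s • ((r / 2 ^ i) • e) - t • (r • (e' - ((q:ℝ) / 2 ^ i) • e))) := by
  set v₁ := (r / 2 ^ i) • e
  set v₂ := r • (e' - ((q:ℝ) / 2 ^ i) • e)
  change avg v₁ (avg v₂ u) x ≤ 9 * avg v₁ (avg v₂ u) (x - s • v₁ - t • v₂)
  have hm := avg.measurable v₂ hu
  refine (avg_le_shift v₁ hm hs x).trans ?_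
  have : avg v₁ (avg v₂ u) (x - s • v₁) ≤ 3 * avg v₁ (avg v₂ u) (x - s • v₁ - t • v₂) := by
    rw [avg, avg, ← lintegral_const_mul _ (by
      have := measurable_cauchyKer
      fun_prop)]
    refine lintegral_mono fun a => ?_
    have := avg_le_shift v₂ hu ht (x - s • v₁ - a • v₁)
    rw [show x - s • v₁ - t • v₂ - a • v₁ = x - s • v₁ - a • v₁ - t • v₂ by abel]
    calc _ ≤ ENNReal.ofReal (cauchyKer a) * (3 * avg v₂ u (x - s • v₁ - a • v₁ - t • v₂)) := by gcongr
      _ = _ := by ring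
  calc _ ≤ 3 * (3 * avg v₁ (avg v₂ u) (x - s • v₁ - t • v₂)) := by gcongr
    _ = _ := by ring

theorem lintegral_mul_eq_layer {F w : Plane → ℝ≥0∞} (hF : Measurable F) (hw : Measurable w) :
    ∫⁻ x, F x * w x = ∫⁻ t in Ioi (0:ℝ), ∫⁻ x, {x | ENNReal.ofReal t < w x}.indicator F x := by
  have hset : MeasurableSet {z : ℝ × Plane | ENNReal.ofReal z.1 < w z.2} :=
    measurableSet_lt (by fun_prop) (by fun_prop)
  have hvol : ∀ a : ℝ≥0∞, ∫⁻ t in Ioi (0:ℝ), {t | ENNReal.ofReal t < a}.indicator 1 t = a := by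
    intro a
    have hm : MeasurableSet {t : ℝ | ENNReal.ofReal t < a} := measurableSet_lt (by fun_prop) (by fun_prop)
    rw [lintegral_indicator_one hm, Measure.restrict_apply hm]
    induction a with
    | top =>
      have : {t : ℝ | ENNReal.ofReal t < ∞} ∩ Ioi 0 = Ioi 0 := by
        ext t; simp
      rw [this]; simp
    | coe a =>
      have : {t : ℝ | ENNReal.ofReal t < (a : ℝ≥0∞)} ∩ Ioi 0 = Ioo 0 (a:ℝ) := by
        ext t
        simp only [mem_inter_iff, mem_ofPred_eq, mem_Ioi, mem_Ioo]
        rw [and_comm, and_congr_right_iff]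
        intro ht
        rw [← ENNReal.ofReal_coe_nnreal, ENNReal.ofReal_lt_ofReal_iff_of_nonneg ht.le]
      rw [this, Real.volume_Ioo]; simp
  rw [lintegral_lintegral_swap]
  · refine lintegral_congr fun x => ?_
    have : ∀ t : ℝ, {x | ENNReal.ofReal t < w x}.indicator F x =
        F x * {t | ENNReal.ofReal t < w x}.indicator 1 t := by
      intro t; by_cases h : ENNReal.ofReal t < w x <;> simp [h]
    simp_rw [this]
    rw [lintegral_const_mul _ (measurable_one.indicator (measurableSet_lt (by fun_prop) (by fun_prop))), hvol]
  · have : Measurable (({z : ℝ × Plane | ENNReal.ofReal z.1 < w z.2}).indicator fun z => F z.2) :=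
      (hF.comp measurable_snd).indicator hset
    exact this.aemeasurable

theorem dirConv_dirConv_congr {κ₁ κ₂ : ℝ → ℂ} (h₁ : ∀ s, 1 < |s| → κ₁ s = 0) (h₂ : ∀ s, 1 < |s| → κ₂ s = 0)
    (v₁ v₂ : Plane) {F G : Plane → ℂ} (x : Plane)
    (h : ∀ s t : ℝ, |s| ≤ 1 → |t| ≤ 1 → F (x - s • v₁ - t • v₂) = G (x - s • v₁ - t • v₂)) :
    dirConv κ₁ v₁ (dirConv κ₂ v₂ F) x = dirConv κ₁ v₁ (dirConv κ₂ v₂ G) x := by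
  refine integral_congr_ae (Filter.Eventually.of_forall fun s => ?_)
  simp only
  rcases lt_or_ge 1 |s| with hs | hs
  · simp [h₁ s hs]
  congr 1
  refine integral_congr_ae (Filter.Eventually.of_forall fun t => ?_)
  simp only
  rcases lt_or_ge 1 |t| with ht | ht
  · simp [h₂ t ht]
  rw [h s t hs ht]

section Bessel
variable {κ₁ κ₂ : ℝ → ℂ} {A : ℝ} (hκ₁ : Integrable κ₁) (hκ₂ : Integrable κ₂) (hm₁ : Measurable κ₁)
  (hm₂ : Measurable κ₂) (hb₁ : ∀ x, ‖𝓕 κ₁ x‖ ≤ A * |x| / (1 + |x|) ^ 2)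
  (hb₂ : ∀ x, ‖𝓕 κ₂ x‖ ≤ A / (1 + |x|))

/-- The composition of two directional convolutions adapted to the frame of `nikodymAvg`. -/
def frameConv (κ₁ κ₂ : ℝ → ℂ) (e e' : Plane) (i : ℕ) (r : ℝ) (q : ℕ) (F : Plane → ℂ) : Plane → ℂ :=
  dirConv κ₁ ((r / 2 ^ i) • e) (dirConv κ₂ (r • (e' - ((q:ℝ) / 2 ^ i) • e)) F)

include hκ₁ hκ₂ hm₁ hm₂ in
theorem Nice.frameConv {F : Plane → ℂ} (hF : Nice F) (hFm : Measurable F) (e e' : Plane) (i : ℕ) (r : ℝ)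
    (q : ℕ) : Nice (frameConv κ₁ κ₂ e e' i r q F) :=
  (hF.dirConv hFm hκ₂ hm₂ _).dirConv (measurable_dirConv hm₂ _ hFm) hκ₁ hm₁ _

include hm₁ hm₂ in
theorem measurable_frameConv {F : Plane → ℂ} (hFm : Measurable F) (e e' : Plane) (i : ℕ) (r : ℝ)
    (q : ℕ) : Measurable (frameConv κ₁ κ₂ e e' i r q F) :=
  measurable_dirConv hm₁ _ (measurable_dirConv hm₂ _ hFm)

include hκ₁ hκ₂ hm₁ hm₂ hb₁ hb₂ in
theorem sum_lintegral_frameConv_le (e e' : Plane) (n : ℕ) (ρ : ℝ) (J Q : ℕ) {F : Plane → ℂ} (hF : Nice F)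
    (hFm : Measurable F) :
    ∑ j ∈ Finset.range J, ∑ q ∈ Finset.range Q,
      ∫⁻ x, ‖frameConv κ₁ κ₂ e e' n (2 ^ j * ρ) q F x‖ₑ ^ 2 ≤
    ENNReal.ofReal (4 * A ^ 4) * ∫⁻ x, ‖F x‖ₑ ^ 2 := by
  have hN := fun j q => hF.frameConv hκ₁ hκ₂ hm₁ hm₂ hFm e e' n (2 ^ j * ρ) q
  simp_rw [fun j q => lintegral_enorm_sq_eq (hN j q).memLp_two, lintegral_enorm_sq_eq hF.memLp_two]
  rw [← ENNReal.ofReal_mul (by positivity)]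
  simp_rw [← ENNReal.ofReal_sum_of_nonneg (fun q _ => integral_nonneg (fun x => sq_nonneg _) :
    ∀ q ∈ Finset.range Q, 0 ≤ ∫ x, ‖frameConv κ₁ κ₂ e e' n (2 ^ _ * ρ) q F x‖ ^ 2)]
  rw [← ENNReal.ofReal_sum_of_nonneg (fun j _ => Finset.sum_nonneg fun q _ => integral_nonneg (fun x => sq_nonneg _))]
  refine ENNReal.ofReal_le_ofReal ?_
  have hsq : ∀ {G : Plane → ℂ}, Nice G → Integrable fun ξ => ‖𝓕⁻ G ξ‖ ^ 2 := fun h =>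
    h.memLp_two_fourierInv.integrable_norm_pow (by norm_num)
  simp_rw [← fun j q => (hN j q).plancherel_sq, ← hF.plancherel_sq]
  simp_rw [← integral_finsetSum _ (fun q _ => hsq (hN _ q))]
  rw [← integral_finsetSum _ (fun j _ => integrable_finsetSum _ fun q _ => hsq (hN j q)),
    ← integral_const_mul]
  refine integral_mono (integrable_finsetSum _ fun j _ => integrable_finsetSum _ fun q _ => hsq (hN j q))
    ((hsq hF).const_mul _) fun ξ => ?_
  have key := sum_symbol_le hb₁ hb₂ (-(ρ / 2 ^ n * inner ℝ ξ e)) (fun j => -(2 ^ j * ρ * inner ℝ ξ e')) J Q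
  simp only
  refine le_trans (le_of_eq ?_) (mul_le_mul_of_nonneg_right key (sq_nonneg ‖𝓕⁻ F ξ‖))
  rw [Finset.sum_mul]
  refine Finset.sum_congr rfl fun j _ => ?_
  rw [Finset.sum_mul]
  refine Finset.sum_congr rfl fun q _ => ?_
  rw [frameConv, fourierInv_dirConv (hF.dirConv hFm hκ₂ hm₂ _).integrable (measurable_dirConv hm₂ _ hFm) hκ₁ hm₁,
    fourierInv_dirConv hF.integrable hFm hκ₂ hm₂, norm_mul, norm_mul, mul_pow, mul_pow, ← mul_assoc]
  congr 5
  · rw [real_inner_smul_right]; ring_nf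
  · rw [real_inner_smul_right, inner_sub_right, real_inner_smul_right]; ring_nf

include hκ₁ hκ₂ hm₁ hm₂ hb₁ hb₂ in
/-- Weighted square-function inequality, with the Nikodym maximal function of the weight. -/
theorem sum_lintegral_frameConv_mul_le (h₁ : ∀ s, 1 < |s| → κ₁ s = 0) (h₂ : ∀ s, 1 < |s| → κ₂ s = 0)
    (e e' : Plane) (n : ℕ) (ρ : ℝ) (J : ℕ) {F : Plane → ℂ} (hF : Nice F)
    (hFm : Measurable F) {u : Plane → ℝ≥0∞} (hu : Measurable u) :
    ∑ j ∈ Finset.range J, ∑ q ∈ Finset.range (2 ^ n),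
      ∫⁻ x, ‖frameConv κ₁ κ₂ e e' n (2 ^ j * ρ) q F x‖ₑ ^ 2 * nikodymAvg e e' n (2 ^ j * ρ) q u x ≤
    ENNReal.ofReal (4 * A ^ 4) * (9 * ∫⁻ x, ‖F x‖ₑ ^ 2 * nikodymMax e e' ρ J n u x) := by
  set g := nikodymMax e e' ρ J n u with hg
  have hgm : Measurable g := measurable_nikodymMax e e' ρ J n hu
  have hwm : ∀ j q, Measurable (nikodymAvg e e' n (2 ^ j * ρ) q u) := fun j q =>
    avg.measurable _ (avg.measurable _ hu)
  have hTm : ∀ j q, Measurable fun x => ‖frameConv κ₁ κ₂ e e' n (2 ^ j * ρ) q F x‖ₑ ^ 2 := fun j q =>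
    (measurable_frameConv hm₁ hm₂ hFm e e' n _ q).enorm.pow_const 2
  have hF2 : Measurable fun x => ‖F x‖ₑ ^ 2 := hFm.enorm.pow_const 2
  rw [show 9 * ∫⁻ x, ‖F x‖ₑ ^ 2 * g x = ∫⁻ x, ‖F x‖ₑ ^ 2 * (9 * g x) by
    rw [← lintegral_const_mul _ (show Measurable fun x => ‖F x‖ₑ ^ 2 * g x from hF2.mul hgm)]; exact lintegral_congr fun x => by ring]
  rw [lintegral_mul_eq_layer hF2 (hgm.const_mul 9)]
  simp_rw [fun j q => lintegral_mul_eq_layer (hTm j q) (hwm j q)]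
  have hlm : ∀ {G w : Plane → ℝ≥0∞}, Measurable G → Measurable w →
      Measurable fun t : ℝ => ∫⁻ x, {x | ENNReal.ofReal t < w x}.indicator G x := by
    intro G w hG hw
    have : Measurable (({z : ℝ × Plane | ENNReal.ofReal z.1 < w z.2}).indicator fun z => G z.2) :=
      (hG.comp measurable_snd).indicator (measurableSet_lt (by fun_prop) (by fun_prop))
    exact this.lintegral_prod_right'
  have hlmT := fun j q => hlm (hTm j q) (hwm j q)
  simp_rw [← lintegral_finsetSum _ (fun q _ => hlmT _ q)]
  rw [← lintegral_finsetSum _ (fun j _ => Finset.measurable_fun_sum _ fun q _ => hlmT j q),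
    ← lintegral_const_mul _ (hlm hF2 (hgm.const_mul 9))]
  refine setLIntegral_mono ((hlm hF2 (hgm.const_mul 9)).const_mul _) fun t _ => ?_
  set Ω : Set Plane := {x | ENNReal.ofReal t < 9 * g x} with hΩ
  have hΩm : MeasurableSet Ω := measurableSet_lt (by fun_prop) (hgm.const_mul 9)
  have hb := sum_lintegral_frameConv_le hκ₁ hκ₂ hm₁ hm₂ hb₁ hb₂ e e' n ρ J (2 ^ n) (hF.indicator hΩm)
    (hFm.indicator hΩm)
  have e2 : ∀ x, ‖Ω.indicator F x‖ₑ ^ 2 = Ω.indicator (fun x => ‖F x‖ₑ ^ 2) x := fun x => by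
    by_cases h : x ∈ Ω <;> simp [h]
  simp_rw [e2] at hb
  refine le_trans (Finset.sum_le_sum fun j hj => Finset.sum_le_sum fun q hq => lintegral_mono fun x => ?_) hb
  by_cases hx : ENNReal.ofReal t < nikodymAvg e e' n (2 ^ j * ρ) q u x
  · rw [indicator_of_mem (s := {x | ENNReal.ofReal t < nikodymAvg e e' n (2 ^ j * ρ) q u x}) hx]
    refine le_of_eq ?_
    congr 2
    refine dirConv_dirConv_congr h₁ h₂ _ _ x fun s t' hs ht => ?_
    rw [indicator_of_mem]
    refine lt_of_lt_of_le hx ((nikodymAvg_le_shift e e' n _ q hu hs ht x).trans ?_)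
    gcongr
    exact Finset.le_sup (f := fun z : ℕ × ℕ => nikodymAvg e e' n (2 ^ z.1 * ρ) z.2 u _)
      (b := (j, q)) (Finset.mem_product.2 ⟨hj, hq⟩)
  · rw [indicator_of_notMem (s := {x | ENNReal.ofReal t < nikodymAvg e e' n (2 ^ j * ρ) q u x}) hx]; simp

end Bessel

theorem lintegral_frameConv_mul_le {ν₁ ν₂ : ℝ → ℂ} (hm₂ : Measurable ν₂) {C : ℝ}
    (hC : 0 ≤ C) (h₁ : ∀ s, ‖ν₁ s‖ ≤ C * cauchyKer s) (h₂ : ∀ s, ‖ν₂ s‖ ≤ C * cauchyKer s)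
    (e e' : Plane) (n : ℕ) (r : ℝ) (q : ℕ) {H : Plane → ℂ} (hH : Measurable H) {u : Plane → ℝ≥0∞}
    (hu : Measurable u) :
    ∫⁻ x, ‖frameConv ν₁ ν₂ e e' n r q H x‖ₑ ^ 2 * u x ≤
      ENNReal.ofReal (C ^ 4 * Real.pi ^ 2) * ∫⁻ x, ‖H x‖ₑ ^ 2 * nikodymAvg e e' n r q u x := by
  set v₁ := (r / 2 ^ n) • e
  set v₂ := r • (e' - ((q:ℝ) / 2 ^ n) • e)
  have hHe : Measurable fun x => ‖H x‖ₑ := hH.enorm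
  have hH2 : Measurable fun x => ‖H x‖ₑ ^ 2 := hHe.pow_const 2
  have hpt : ∀ x, ‖frameConv ν₁ ν₂ e e' n r q H x‖ₑ ^ 2 ≤
      ENNReal.ofReal (C ^ 4 * Real.pi ^ 2) * avg v₁ (avg v₂ fun x => ‖H x‖ₑ ^ 2) x := by
    intro x
    have a1 : ‖frameConv ν₁ ν₂ e e' n r q H x‖ₑ ≤
        ENNReal.ofReal C * (ENNReal.ofReal C * avg v₁ (avg v₂ fun x => ‖H x‖ₑ) x) := by
      refine (enorm_dirConv_le h₁ hC v₁ (measurable_dirConv hm₂ v₂ hH) x).trans ?_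
      rw [← avg.const_mul v₁ _ (avg.measurable _ hHe)]
      gcongr
      exact avg.mono v₁ (fun y => enorm_dirConv_le h₂ hC v₂ hH y) x
    have a2 : avg v₁ (avg v₂ fun x => ‖H x‖ₑ) x ^ 2 ≤ ENNReal.ofReal Real.pi *
        (ENNReal.ofReal Real.pi * avg v₁ (avg v₂ fun x => ‖H x‖ₑ ^ 2) x) := by
      refine (avg.sq_le v₁ (avg.measurable _ hHe) x).trans ?_
      rw [← avg.const_mul v₁ _ (avg.measurable _ hH2)]
      gcongr
      exact avg.mono v₁ (fun y => avg.sq_le v₂ hHe y) x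
    calc _ ≤ (ENNReal.ofReal C * (ENNReal.ofReal C * avg v₁ (avg v₂ fun x => ‖H x‖ₑ) x)) ^ 2 := by gcongr
      _ = ENNReal.ofReal C ^ 4 * avg v₁ (avg v₂ fun x => ‖H x‖ₑ) x ^ 2 := by ring
      _ ≤ ENNReal.ofReal C ^ 4 * (ENNReal.ofReal Real.pi *
        (ENNReal.ofReal Real.pi * avg v₁ (avg v₂ fun x => ‖H x‖ₑ ^ 2) x)) := by gcongr
      _ = _ := by
        rw [ENNReal.ofReal_mul (by positivity), ENNReal.ofReal_pow hC, ENNReal.ofReal_pow Real.pi_pos.le]; ring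
  have hm : Measurable (avg v₁ (avg v₂ fun x => ‖H x‖ₑ ^ 2)) := avg.measurable _ (avg.measurable _ hH2)
  calc _ ≤ ∫⁻ x, ENNReal.ofReal (C ^ 4 * Real.pi ^ 2) * (avg v₁ (avg v₂ fun x => ‖H x‖ₑ ^ 2) x * u x) := by
        refine lintegral_mono fun x => ?_
        rw [← mul_assoc]; exact mul_le_mul_left (hpt x) _
    _ = ENNReal.ofReal (C ^ 4 * Real.pi ^ 2) * ∫⁻ x, avg v₁ (avg v₂ fun x => ‖H x‖ₑ ^ 2) x * u x :=
        lintegral_const_mul _ (hm.mul hu)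
    _ = _ := by
        rw [avg.lintegral_mul_comm v₁ (avg.measurable _ hH2) hu, avg.lintegral_mul_comm v₂ hH2 (avg.measurable _ hu)]
        congr 1
        exact lintegral_congr fun x => by rw [avg.comm v₂ v₁ hu x]; rfl

section
open scoped SchwartzMap

theorem frameConv_fourierInv {κ₁ κ₂ : ℝ → ℂ} (hκ₁ : Integrable κ₁) (hκ₂ : Integrable κ₂)
    (e e' : Plane) (n : ℕ) (r : ℝ) (q : ℕ) {α : Plane → ℂ} (hα : Nice α) :
    frameConv κ₁ κ₂ e e' n r q (𝓕⁻ α) = 𝓕⁻ (fun ξ => 𝓕 κ₁ (inner ℝ ξ ((r / 2 ^ n) • e)) *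
      (𝓕 κ₂ (inner ℝ ξ (r • (e' - ((q:ℝ) / 2 ^ n) • e))) * α ξ)) := by
  rw [frameConv, show dirConv κ₂ (r • (e' - ((q:ℝ) / 2 ^ n) • e)) (𝓕⁻ α) = _ from
    funext fun x => dirConv_fourierInv hκ₂ _ hα.integrable x]
  exact funext fun x => dirConv_fourierInv hκ₁ _ (hα.dirConv_symbol hκ₂ _).integrable x

theorem ENNReal.le_of_sq_le_mul {X Y : ℝ≥0∞} (hX : X ≠ ∞) (h : X ^ 2 ≤ Y * X) : X ≤ Y := by
  rcases eq_or_ne X 0 with h0 | h0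
  · simp [h0]
  · rw [sq] at h
    exact (ENNReal.mul_le_mul_iff_left h0 hX).1 h

/-- Square function estimate in `L⁴` for the reproducing pieces at eccentricity `2 ^ n`. -/
theorem exists_frame_square_function : ∃ (κ₁ κ₂ ν₁ ν₂ : 𝓢(ℝ, ℂ)) (C : ℝ≥0),
    (∀ x, 1 ≤ x → x ≤ 2 → 𝓕 (ν₁ : ℝ → ℂ) x * 𝓕 (κ₁ : ℝ → ℂ) x = 1) ∧
    (∀ x, |x| ≤ 16 → 𝓕 (ν₂ : ℝ → ℂ) x * 𝓕 (κ₂ : ℝ → ℂ) x = 1) ∧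
    ∀ (e e' : Plane) (n : ℕ) (ρ : ℝ) (J : ℕ), 0 < ρ → ∀ α : Plane → ℂ, Nice α → Nice (𝓕⁻ α) →
      ∫⁻ x, (∑ j ∈ Finset.range J, ∑ q ∈ Finset.range (2 ^ n),
        ‖frameConv ν₁ ν₂ e e' n (2 ^ j * ρ) q (frameConv κ₁ κ₂ e e' n (2 ^ j * ρ) q (𝓕⁻ α)) x‖ₑ ^ 2) ^ 2 ≤
      C * (n + 1) ^ 2 * ∫⁻ x, ‖𝓕⁻ α x‖ₑ ^ 4 := by
  obtain ⟨κ₁, κ₂, ν₁, ν₂, A, hs₁, hs₂, hb₁, hb₂, hr₁, hr₂⟩ := exists_reproducing_kernels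
  obtain ⟨C₁, hC₁, hν₁⟩ := ν₁.exists_le_cauchyKer
  obtain ⟨C₂, hC₂, hν₂⟩ := ν₂.exists_le_cauchyKer
  obtain ⟨C₀, hC₀⟩ := exists_nikodymMax_le
  set B : ℝ := max C₁ C₂
  have hB : 0 ≤ B := le_max_of_le_left hC₁
  have hν₁' : ∀ s, ‖ν₁ s‖ ≤ B * cauchyKer s := fun s => (hν₁ s).trans
    (mul_le_mul_of_nonneg_right (le_max_left _ _) (cauchyKer_pos s).le)
  have hν₂' : ∀ s, ‖ν₂ s‖ ≤ B * cauchyKer s := fun s => (hν₂ s).trans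
    (mul_le_mul_of_nonneg_right (le_max_right _ _) (cauchyKer_pos s).le)
  set c : ℝ≥0 := Real.toNNReal (B ^ 4 * Real.pi ^ 2) * (Real.toNNReal (4 * A ^ 4) * 9) with hc
  refine ⟨κ₁, κ₂, ν₁, ν₂, c ^ 2 * C₀, hr₁, hr₂, fun e e' n ρ J hρ α hα hF => ?_⟩
  set s : Finset (ℕ × ℕ) := Finset.range J ×ˢ Finset.range (2 ^ n) with hs
  set F := 𝓕⁻ α with hFdef
  have hFc : Continuous F := hα.continuous_fourierInv
  have hFm : Measurable F := hFc.measurable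
  set T : ℕ × ℕ → Plane → ℂ := fun i => frameConv κ₁ κ₂ e e' n (2 ^ i.1 * ρ) i.2 F with hT
  have hTm : ∀ i, Measurable (T i) := fun i =>
    measurable_frameConv κ₁.continuous.measurable κ₂.continuous.measurable hFm e e' n _ _
  have hz : ∀ i : ℕ × ℕ, ∃ β, Nice β ∧ frameConv ν₁ ν₂ e e' n (2 ^ i.1 * ρ) i.2 (T i) = 𝓕⁻ β := by
    intro i
    have h1 := (hα.dirConv_symbol κ₂.integrable ((2 ^ i.1 * ρ) • (e' - ((i.2:ℝ) / 2 ^ n) • e))).dirConv_symbol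
      κ₁.integrable ((2 ^ i.1 * ρ / 2 ^ n) • e)
    refine ⟨_, (h1.dirConv_symbol ν₂.integrable ((2 ^ i.1 * ρ) • (e' - ((i.2:ℝ) / 2 ^ n) • e))).dirConv_symbol
      ν₁.integrable ((2 ^ i.1 * ρ / 2 ^ n) • e), ?_⟩
    simp only [hT, hFdef]
    rw [frameConv_fourierInv κ₁.integrable κ₂.integrable _ _ _ _ _ hα,
      frameConv_fourierInv ν₁.integrable ν₂.integrable _ _ _ _ _ h1]
  choose β hβ hzβ using hz
  rw [show (∫⁻ x, (∑ j ∈ Finset.range J, ∑ q ∈ Finset.range (2 ^ n),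
        ‖frameConv ν₁ ν₂ e e' n (2 ^ j * ρ) q (frameConv κ₁ κ₂ e e' n (2 ^ j * ρ) q F) x‖ₑ ^ 2) ^ 2) =
      ∫⁻ x, (∑ i ∈ s, ‖𝓕⁻ (β i) x‖ₑ ^ 2) ^ 2 by
    refine lintegral_congr fun x => ?_
    rw [hs, Finset.sum_product]
    simp_rw [← hzβ, hT]]
  set Z : Plane → ℝ := fun x => ∑ i ∈ s, ‖𝓕⁻ (β i) x‖ ^ 2 with hZ
  have hZ0 : ∀ x, 0 ≤ Z x := fun x => Finset.sum_nonneg fun i _ => sq_nonneg _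
  have hZg : Good Z := Nice.good_sum_sq s fun i _ => hβ i
  set u : Plane → ℝ≥0∞ := fun x => ENNReal.ofReal (Z x) with hu
  have hum : Measurable u := hZg.cont.measurable.ennreal_ofReal
  have huZ : ∀ x, ∑ i ∈ s, ‖𝓕⁻ (β i) x‖ₑ ^ 2 = u x := by
    intro x
    rw [hu, hZ]
    simp only
    rw [ENNReal.ofReal_sum_of_nonneg fun i _ => sq_nonneg _]
    refine Finset.sum_congr rfl fun i _ => ?_
    rw [← ofReal_norm, ENNReal.ofReal_pow (norm_nonneg _)]
  simp_rw [huZ]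
  obtain ⟨γ, hγ, hγZ⟩ := Nice.sum_normSq_eq s fun i _ => hβ i
  have hN := hC₀ e e' ρ J hρ hγ hZ0 hγZ n
  set X : ℝ≥0∞ := ∫⁻ x, u x ^ 2 with hX
  have hXfin : X ≠ ∞ := by
    have h2 := hZg.integrable_sq
    rw [hX, show (∫⁻ x, u x ^ 2) = ∫⁻ x, ENNReal.ofReal (Z x ^ 2) from
      lintegral_congr fun x => (ENNReal.ofReal_pow (hZ0 x) 2).symm]
    exact h2.lintegral_lt_top.ne
  have hzm : ∀ i, Measurable fun x => ‖𝓕⁻ (β i) x‖ₑ ^ 2 := fun i =>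
    (hβ i).continuous_fourierInv.measurable.enorm.pow_const 2
  have hF2 : Measurable fun x => ‖F x‖ₑ ^ 2 := hFm.enorm.pow_const 2
  have key : X ≤ c * ∫⁻ x, ‖F x‖ₑ ^ 2 * nikodymMax e e' ρ J n u x := by
    calc X = ∑ i ∈ s, ∫⁻ x, ‖𝓕⁻ (β i) x‖ₑ ^ 2 * u x := by
          rw [← lintegral_finsetSum _ fun i _ =>
            (show Measurable fun x => ‖𝓕⁻ (β i) x‖ₑ ^ 2 * u x from (hzm i).mul hum)]
          refine lintegral_congr fun x => ?_
          rw [← Finset.sum_mul, huZ, sq]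
      _ ≤ ∑ i ∈ s, ENNReal.ofReal (B ^ 4 * Real.pi ^ 2) *
            ∫⁻ x, ‖T i x‖ₑ ^ 2 * nikodymAvg e e' n (2 ^ i.1 * ρ) i.2 u x := by
          refine Finset.sum_le_sum fun i _ => ?_
          simp_rw [← hzβ]
          exact lintegral_frameConv_mul_le ν₂.continuous.measurable hB hν₁' hν₂' e e' n _ _ (hTm i) hum
      _ ≤ ENNReal.ofReal (B ^ 4 * Real.pi ^ 2) * (ENNReal.ofReal (4 * A ^ 4) *
            (9 * ∫⁻ x, ‖F x‖ₑ ^ 2 * nikodymMax e e' ρ J n u x)) := by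
          rw [← Finset.mul_sum, hs, Finset.sum_product]
          gcongr
          exact sum_lintegral_frameConv_mul_le κ₁.integrable κ₂.integrable κ₁.continuous.measurable
            κ₂.continuous.measurable hb₁ hb₂ hs₁ hs₂ e e' n ρ J hF hFm hum
      _ = _ := by
          rw [hc]; push_cast [ENNReal.ofReal]; ring
  have hcs := lintegral_mul_sq_le (μ := volume) hF2.aemeasurable (measurable_nikodymMax e e' ρ J n hum).aemeasurable
  refine ENNReal.le_of_sq_le_mul hXfin ?_
  calc X ^ 2 ≤ (c * ∫⁻ x, ‖F x‖ₑ ^ 2 * nikodymMax e e' ρ J n u x) ^ 2 := by gcongr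
    _ ≤ c ^ 2 * ((∫⁻ x, (‖F x‖ₑ ^ 2) ^ 2) * ∫⁻ x, nikodymMax e e' ρ J n u x ^ 2) := by
        rw [mul_pow]; gcongr
    _ ≤ c ^ 2 * ((∫⁻ x, (‖F x‖ₑ ^ 2) ^ 2) * (C₀ * (n + 1) ^ 2 * X)) := by gcongr
    _ = _ := by
        simp_rw [← pow_mul]; push_cast; ring

end

theorem lintegral_sum_enorm_sq_sq {ι : Type*} (s : Finset ι) {β : ι → Plane → ℂ} (hβ : ∀ i ∈ s, Nice (β i)) :
    ∫⁻ x, (∑ i ∈ s, ‖𝓕⁻ (β i) x‖ₑ ^ 2) ^ 2 =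
      ENNReal.ofReal (∫ x, (∑ i ∈ s, ‖𝓕⁻ (β i) x‖ ^ 2) ^ 2) := by
  rw [ofReal_integral_eq_lintegral_ofReal (Nice.good_sum_sq s hβ).integrable_sq
    (Filter.Eventually.of_forall fun x => sq_nonneg _)]
  refine lintegral_congr fun x => ?_
  rw [ENNReal.ofReal_pow (Finset.sum_nonneg fun i _ => sq_nonneg _),
    ENNReal.ofReal_sum_of_nonneg fun i _ => sq_nonneg _]
  congr 1
  refine Finset.sum_congr rfl fun i _ => ?_
  rw [← ofReal_norm, ENNReal.ofReal_pow (norm_nonneg _)]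

/-- The part of the sector with slopes in `[t m, t (m + 1))` lying over a dyadic interval of the first
coordinate in the frame `(e, e')`. -/
def dyadicSector (e e' : Plane) (t : ℕ → ℝ) (σ : ℝ) (j m : ℕ) : Set Plane :=
  {ξ | 1 ≤ 2 ^ j * σ * inner ℝ ξ e ∧ 2 ^ j * σ * inner ℝ ξ e < 2 ∧
    t m * inner ℝ ξ e ≤ inner ℝ ξ e' ∧ inner ℝ ξ e' < t (m + 1) * inner ℝ ξ e}

theorem measurableSet_dyadicSector (e e' : Plane) (t : ℕ → ℝ) (σ : ℝ) (j m : ℕ) :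
    MeasurableSet (dyadicSector e e' t σ j m) := by
  unfold dyadicSector
  have h1 : MeasurableSet {ξ : Plane | 1 ≤ 2 ^ j * σ * inner ℝ ξ e} := measurableSet_le (by fun_prop) (by fun_prop)
  have h2 : MeasurableSet {ξ : Plane | 2 ^ j * σ * inner ℝ ξ e < 2} := measurableSet_lt (by fun_prop) (by fun_prop)
  have h3 : MeasurableSet {ξ : Plane | t m * inner ℝ ξ e ≤ inner ℝ ξ e'} :=
    measurableSet_le (by fun_prop) (by fun_prop)
  have h4 : MeasurableSet {ξ : Plane | inner ℝ ξ e' < t (m + 1) * inner ℝ ξ e} :=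
    measurableSet_lt (by fun_prop) (by fun_prop)
  exact h1.inter (h2.inter (h3.inter h4))

/-- The square function over dyadic pieces of thin sectors is bounded in `L⁴` with a constant
polynomial in the logarithm of the eccentricity. -/
theorem exists_dyadic_square_function : ∃ C : ℝ, 0 ≤ C ∧
    ∀ (e e' : Plane) (n M J : ℕ) (σ : ℝ) (t : ℕ → ℝ), e ≠ 0 → (∀ m, e' - t m • e ≠ 0) → Monotone t →
      M ≤ 2 ^ n → (∀ m, 0 ≤ t m) → (∀ m < M, t m < 1) → (∀ m < M, 1 ≤ 2 ^ n * (t (m + 1) - t m)) →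
      (∀ m < M, 2 ^ n * (t (m + 1) - t m) ≤ 7) → 0 < σ → ∀ α : Plane → ℂ, Nice α → Nice (𝓕⁻ α) →
      ∫ x, (∑ i ∈ Finset.range J ×ˢ Finset.range M,
        ‖𝓕⁻ ((dyadicSector e e' t σ i.1 i.2).indicator α) x‖ ^ 2) ^ 2 ≤
      C * (n + 1) ^ 10 * ∫ x, ‖𝓕⁻ α x‖ ^ 4 := by
  obtain ⟨κ₁, κ₂, ν₁, ν₂, C, hr₁, hr₂, hC⟩ := exists_frame_square_function
  refine ⟨264 ^ 4 * C, by positivity,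
    fun e e' n M J σ t he he' ht hM ht0 ht1 hgap hgap' hσ α hα hF => ?_⟩
  set ρ := 2 ^ n * σ with hρ
  have hρ0 : 0 < ρ := by positivity
  set β : ℕ → ℕ → Plane → ℂ := fun j q ξ =>
    𝓕 (ν₁ : ℝ → ℂ) (inner ℝ ξ ((2 ^ j * ρ / 2 ^ n) • e)) *
    (𝓕 (ν₂ : ℝ → ℂ) (inner ℝ ξ ((2 ^ j * ρ) • (e' - ((q:ℝ) / 2 ^ n) • e))) *
    (𝓕 (κ₁ : ℝ → ℂ) (inner ℝ ξ ((2 ^ j * ρ / 2 ^ n) • e)) *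
    (𝓕 (κ₂ : ℝ → ℂ) (inner ℝ ξ ((2 ^ j * ρ) • (e' - ((q:ℝ) / 2 ^ n) • e))) * α ξ))) with hβ
  have h1 : ∀ j q : ℕ, _ := fun j q =>
    (hα.dirConv_symbol κ₂.integrable ((2 ^ j * ρ) • (e' - ((q:ℝ) / 2 ^ n) • e))).dirConv_symbol
      κ₁.integrable ((2 ^ j * ρ / 2 ^ n) • e)
  have hβN : ∀ j q, Nice (β j q) := fun j q =>
    ((h1 j q).dirConv_symbol ν₂.integrable ((2 ^ j * ρ) • (e' - ((q:ℝ) / 2 ^ n) • e))).dirConv_symbol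
      ν₁.integrable ((2 ^ j * ρ / 2 ^ n) • e)
  have hz : ∀ j q, frameConv ν₁ ν₂ e e' n (2 ^ j * ρ) q (frameConv κ₁ κ₂ e e' n (2 ^ j * ρ) q (𝓕⁻ α)) =
      𝓕⁻ (β j q) := fun j q => by
    rw [frameConv_fourierInv κ₁.integrable κ₂.integrable _ _ _ _ _ hα,
      frameConv_fourierInv ν₁.integrable ν₂.integrable _ _ _ _ _ (h1 j q)]
  have hmain := hC e e' n ρ J hρ0 α hα hF
  simp_rw [hz] at hmain
  -- the index of the frame adapted to a sector
  set q : ℕ → ℕ := fun m => ⌊2 ^ n * t m⌋₊ with hq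
  have hq0 : ∀ m, (q m : ℝ) ≤ 2 ^ n * t m := fun m => Nat.floor_le (mul_nonneg (by positivity) (ht0 m))
  have hq1 : ∀ m, 2 ^ n * t m < q m + 1 := fun m => Nat.lt_floor_add_one _
  have hqlt : ∀ m < M, q m < 2 ^ n := fun m hm => by
    have : (q m : ℝ) < 2 ^ n := (hq0 m).trans_lt (mul_lt_of_lt_one_right (by positivity) (ht1 m hm))
    exact_mod_cast this
  have hqinj : Set.InjOn q (Finset.range M : Finset ℕ) := by
    have hlt : ∀ a b, a < M → a < b → q a < q b := by
      intro a b ha hab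
      have h2 : t (a + 1) ≤ t b := ht hab
      have h3 := hgap a ha
      have h4 : (2:ℝ) ^ n * t (a + 1) ≤ 2 ^ n * t b := by gcongr
      have : (q a : ℝ) < q b := by linarith [hq0 a, hq1 b, hq1 a]
      exact_mod_cast this
    intro a ha b hb hab
    simp only [Finset.coe_range, mem_Iio] at ha hb
    rcases lt_trichotomy a b with h | h | h
    · exact absurd hab (hlt a b ha h).ne
    · exact h
    · exact absurd hab (hlt b a hb h).ne'
  set s : Finset (ℕ × ℕ) := Finset.range J ×ˢ Finset.range M with hs
  have hs2 : ∀ i ∈ s, i.2 < M := fun i hi => Finset.mem_range.1 (Finset.mem_product.1 hi).2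
  set β₀ : ℕ × ℕ → Plane → ℂ := fun i => β i.1 (q i.2) with hβ₀
  have hβ₀N : ∀ i, Nice (β₀ i) := fun i => hβN _ _
  have hF4 : Integrable fun x => ‖𝓕⁻ α x‖ ^ 4 := by
    have := hα.good_sq.integrable_sq
    simpa [← pow_mul] using this
  have step0 : ∫ x, (∑ i ∈ s, ‖𝓕⁻ (β₀ i) x‖ ^ 2) ^ 2 ≤ C * (n + 1) ^ 2 * ∫ x, ‖𝓕⁻ α x‖ ^ 4 := by
    have hl : ∫⁻ x, (∑ i ∈ s, ‖𝓕⁻ (β₀ i) x‖ₑ ^ 2) ^ 2 ≤ C * (n + 1) ^ 2 * ∫⁻ x, ‖𝓕⁻ α x‖ₑ ^ 4 := by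
      refine le_trans (lintegral_mono fun x => ?_) hmain
      refine pow_le_pow_left₀ (by simp) ?_ 2
      rw [hs, Finset.sum_product]
      refine Finset.sum_le_sum fun j _ => ?_
      simp only [hβ₀]
      rw [← Finset.sum_image (f := fun q => ‖𝓕⁻ (β j q) x‖ₑ ^ 2) hqinj]
      refine Finset.sum_le_sum_of_subset fun y hy => ?_
      obtain ⟨m, hm, rfl⟩ := Finset.mem_image.1 hy
      exact Finset.mem_range.2 (hqlt m (Finset.mem_range.1 hm))
    rw [lintegral_sum_enorm_sq_sq s fun i _ => hβ₀N i] at hl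
    have e4 : ∫⁻ x, ‖𝓕⁻ α x‖ₑ ^ 4 = ENNReal.ofReal (∫ x, ‖𝓕⁻ α x‖ ^ 4) := by
      rw [ofReal_integral_eq_lintegral_ofReal hF4 (Filter.Eventually.of_forall fun x => by positivity)]
      refine lintegral_congr fun x => ?_
      rw [← ofReal_norm, ENNReal.ofReal_pow (norm_nonneg _)]
    rw [e4] at hl
    have h0 : 0 ≤ ∫ x, ‖𝓕⁻ α x‖ ^ 4 := integral_nonneg fun x => by positivity
    have e5 : (C : ℝ≥0∞) * (n + 1) ^ 2 * ENNReal.ofReal (∫ x, ‖𝓕⁻ α x‖ ^ 4) =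
        ENNReal.ofReal (C * (n + 1) ^ 2 * ∫ x, ‖𝓕⁻ α x‖ ^ 4) := by
      rw [ENNReal.ofReal_mul (by positivity), ENNReal.ofReal_mul (by positivity),
        ENNReal.ofReal_coe_nnreal, ENNReal.ofReal_pow (by positivity)]
      congr
      rw [ENNReal.ofReal_add (by positivity) (by norm_num)]; simp
    rw [e5] at hl
    exact (ENNReal.ofReal_le_ofReal_iff (by positivity)).1 hl
  -- the four half-plane truncations
  set A : ℕ → Plane := fun m => e' - t m • e with hA
  have hmono : ∀ ξ : Plane, Monotone (fun m => (inner ℝ ξ (A m) : ℝ)) ∨ Antitone (fun m => (inner ℝ ξ (A m) : ℝ)) := by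
    intro ξ
    simp only [hA, inner_sub_right, real_inner_smul_right]
    rcases le_total 0 (inner ℝ ξ e : ℝ) with h | h
    · right; intro a b hab
      simp only
      have := mul_le_mul_of_nonneg_right (ht hab) h
      linarith
    · left; intro a b hab
      simp only
      have := mul_le_mul_of_nonpos_right (ht hab) h
      linarith
  have hmono' : ∀ ξ : Plane, Monotone (fun m => (inner ℝ ξ (A (m + 1)) : ℝ)) ∨
      Antitone (fun m => (inner ℝ ξ (A (m + 1)) : ℝ)) := fun ξ => (hmono ξ).imp
    (fun h a b hab => h (Nat.succ_le_succ hab)) (fun h a b hab => h (Nat.succ_le_succ hab))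
  set b₁ : ℕ × ℕ → ℝ := fun i => 1 / (2 ^ i.1 * σ) with hb₁
  set b₂ : ℕ × ℕ → ℝ := fun i => 2 / (2 ^ i.1 * σ) with hb₂
  set β₁ : ℕ × ℕ → Plane → ℂ := fun i => {ξ : Plane | b₁ i ≤ inner ℝ ξ e}.indicator (β₀ i) with hβ₁
  have hβ₁N : ∀ i, Nice (β₁ i) := fun i => (hβ₀N i).indicator (measurableSet_halfPlane _ _)
  set β₂ : ℕ × ℕ → Plane → ℂ := fun i => {ξ : Plane | b₂ i ≤ inner ℝ ξ e}ᶜ.indicator (β₁ i) with hβ₂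
  have hβ₂N : ∀ i, Nice (β₂ i) := fun i => (hβ₁N i).indicator (measurableSet_halfPlane _ _).compl
  set β₃ : ℕ × ℕ → Plane → ℂ := fun i => {ξ : Plane | 0 ≤ inner ℝ ξ (A i.2)}.indicator (β₂ i) with hβ₃
  have hβ₃N : ∀ i, Nice (β₃ i) := fun i => (hβ₂N i).indicator (measurableSet_halfPlane _ _)
  have step1 := meyer_halfPlane s hβ₀N 0 (A := fun _ => e) (fun _ => he) (fun ξ => Or.inl monotone_const)
    (fun _ => 0) (fun _ _ => by norm_num) b₁
  have step2 := meyer_halfPlane_compl s hβ₁N 0 (A := fun _ => e) (fun _ => he)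
    (fun ξ => Or.inl monotone_const) (fun _ => 0) (fun _ _ => by norm_num) b₂
  have step3 := meyer_halfPlane s hβ₂N n (A := A) he' hmono (fun i => i.2)
    (fun i hi => (hs2 i hi).trans_le hM) (fun _ => 0)
  have step4 := meyer_halfPlane_compl s hβ₃N n (A := fun m => A (m + 1)) (fun m => he' (m + 1)) hmono'
    (fun i => i.2) (fun i hi => (hs2 i hi).trans_le hM) (fun _ => 0)
  have hE : ∀ i ∈ s, {ξ : Plane | 0 ≤ inner ℝ ξ (A (i.2 + 1))}ᶜ.indicator (β₃ i) =
      (dyadicSector e e' t σ i.1 i.2).indicator α := by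
    intro i hi
    funext ξ
    set c : ℝ := 2 ^ i.1 * σ with hc
    have hc0 : 0 < c := by positivity
    have m1 : b₁ i ≤ inner ℝ ξ e ↔ 1 ≤ c * inner ℝ ξ e := by
      simp only [hb₁]; rw [div_le_iff₀ hc0, mul_comm]
    have m2 : b₂ i ≤ inner ℝ ξ e ↔ 2 ≤ c * inner ℝ ξ e := by
      simp only [hb₂]; rw [div_le_iff₀ hc0, mul_comm]
    have m3 : ∀ m, 0 ≤ (inner ℝ ξ (A m) : ℝ) ↔ t m * inner ℝ ξ e ≤ inner ℝ ξ e' := by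
      intro m; simp only [hA, inner_sub_right, real_inner_smul_right, sub_nonneg]
    by_cases hξ : ξ ∈ dyadicSector e e' t σ i.1 i.2
    · rw [indicator_of_mem hξ]
      obtain ⟨a1, a2, a3, a4⟩ := hξ
      simp only [hβ₃, hβ₂, hβ₁]
      rw [indicator_of_mem, indicator_of_mem, indicator_of_mem, indicator_of_mem]
      · have f1 : (inner ℝ ξ ((2 ^ i.1 * ρ / 2 ^ n) • e) : ℝ) = c * inner ℝ ξ e := by
          rw [real_inner_smul_right, hρ, hc]; field_simp
        have f2 : (inner ℝ ξ ((2 ^ i.1 * ρ) • (e' - ((q i.2:ℝ) / 2 ^ n) • e)) : ℝ) =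
            c * (2 ^ n * inner ℝ ξ e' - q i.2 * inner ℝ ξ e) := by
          rw [real_inner_smul_right, inner_sub_right, real_inner_smul_right, hρ, hc]; field_simp
        have f3 : |(c * (2 ^ n * inner ℝ ξ e' - q i.2 * inner ℝ ξ e) : ℝ)| ≤ 16 := by
          have g1 := hq0 i.2
          have g2 := hq1 i.2
          have g3 := hgap' i.2 (hs2 i hi)
          set x : ℝ := inner ℝ ξ e
          set y : ℝ := inner ℝ ξ e'
          have hn : (0:ℝ) < 2 ^ n := by positivity
          have e1 : 2 ^ n * t i.2 * (c * x) ≤ 2 ^ n * (c * y) := by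
            have := mul_le_mul_of_nonneg_left a3 (mul_pos hn hc0).le
            linarith
          have e2 : 2 ^ n * (c * y) ≤ 2 ^ n * t (i.2 + 1) * (c * x) := by
            have := mul_le_mul_of_nonneg_left a4.le (mul_pos hn hc0).le
            linarith
          have e3 : 2 ^ n * t (i.2 + 1) ≤ q i.2 + 8 := by linarith
          have hcx : 0 ≤ c * x := by linarith
          have e4 := mul_le_mul_of_nonneg_right e3 hcx
          have e5 := mul_le_mul_of_nonneg_right g1 hcx
          rw [abs_le]; constructor <;> linarith
        simp only [hβ₀, hβ]
        rw [f1, f2]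
        have w1 := hr₁ _ a1 a2.le
        have w2 := hr₂ _ f3
        linear_combination (α ξ * 𝓕 (ν₂ : ℝ → ℂ) (c * (2 ^ n * inner ℝ ξ e' - q i.2 * inner ℝ ξ e)) *
          𝓕 (κ₂ : ℝ → ℂ) (c * (2 ^ n * inner ℝ ξ e' - q i.2 * inner ℝ ξ e))) * w1 + α ξ * w2
      · exact m1.2 a1
      · exact fun h => absurd (m2.1 h) (not_le.2 a2)
      · exact (m3 _).2 a3
      · exact fun h => absurd ((m3 _).1 h) (not_le.2 a4)
    · rw [indicator_of_notMem hξ]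
      by_contra hne
      have n4 := mem_of_indicator_ne_zero hne
      rw [indicator_of_mem n4] at hne
      have n3 := mem_of_indicator_ne_zero hne
      simp only [hβ₃] at hne
      rw [indicator_of_mem n3] at hne
      have n2 := mem_of_indicator_ne_zero hne
      simp only [hβ₂] at hne
      rw [indicator_of_mem n2] at hne
      have n1 := mem_of_indicator_ne_zero hne
      exact hξ ⟨m1.1 n1, not_le.1 fun h => n2 (m2.2 h), (m3 _).1 n3, not_le.1 fun h => n4 ((m3 _).2 h)⟩
  have hfin : ∫ x, (∑ i ∈ s, ‖𝓕⁻ ((dyadicSector e e' t σ i.1 i.2).indicator α) x‖ ^ 2) ^ 2 =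
      ∫ x, (∑ i ∈ s, ‖𝓕⁻ ({ξ : Plane | 0 ≤ inner ℝ ξ (A (i.2 + 1))}ᶜ.indicator (β₃ i)) x‖ ^ 2) ^ 2 := by
    refine integral_congr_ae (Filter.Eventually.of_forall fun x => ?_)
    simp only
    congr 1
    exact Finset.sum_congr rfl fun i hi => by rw [hE i hi]
  rw [hfin]
  have hP : (0:ℝ) ≤ ((n + 1) ^ 2) ^ 2 := by positivity
  have I0 : 0 ≤ ∫ x, (∑ i ∈ s, ‖𝓕⁻ (β₀ i) x‖ ^ 2) ^ 2 := integral_nonneg fun x => by positivity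
  have I1 : 0 ≤ ∫ x, (∑ i ∈ s, ‖𝓕⁻ (β₁ i) x‖ ^ 2) ^ 2 := integral_nonneg fun x => by positivity
  have I2 : 0 ≤ ∫ x, (∑ i ∈ s, ‖𝓕⁻ (β₂ i) x‖ ^ 2) ^ 2 := integral_nonneg fun x => by positivity
  have s1 : ∫ x, (∑ i ∈ s, ‖𝓕⁻ (β₁ i) x‖ ^ 2) ^ 2 ≤ 264 * ∫ x, (∑ i ∈ s, ‖𝓕⁻ (β₀ i) x‖ ^ 2) ^ 2 := by
    refine step1.trans ?_
    norm_num
    linarith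
  have s2 : ∫ x, (∑ i ∈ s, ‖𝓕⁻ (β₂ i) x‖ ^ 2) ^ 2 ≤ 264 * ∫ x, (∑ i ∈ s, ‖𝓕⁻ (β₁ i) x‖ ^ 2) ^ 2 := by
    refine step2.trans ?_
    norm_num
  have s3 : ∫ x, (∑ i ∈ s, ‖𝓕⁻ (β₃ i) x‖ ^ 2) ^ 2 ≤
      264 * ((n + 1) ^ 2) ^ 2 * ∫ x, (∑ i ∈ s, ‖𝓕⁻ (β₂ i) x‖ ^ 2) ^ 2 := by
    refine step3.trans ?_
    gcongr; norm_num
  calc _ ≤ 264 * ((n + 1) ^ 2) ^ 2 * ∫ x, (∑ i ∈ s, ‖𝓕⁻ (β₃ i) x‖ ^ 2) ^ 2 := step4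
    _ ≤ 264 * ((n + 1) ^ 2) ^ 2 * (264 * ((n + 1) ^ 2) ^ 2 * (264 * (264 *
        (C * (n + 1) ^ 2 * ∫ x, ‖𝓕⁻ α x‖ ^ 4)))) := by
      gcongr
      refine s3.trans ?_
      gcongr
      refine s2.trans ?_
      gcongr
      refine s1.trans ?_
      gcongr
    _ = _ := by ring

open scoped SchwartzMap ContDiff

theorem norm_sq_sum_range_succ_le (d : ℕ → ℂ) (J : ℕ) :
    ‖∑ j ∈ Finset.range (J + 1), d j‖ ^ 2 ≤ 3 * ∑ j ∈ Finset.range J, ‖d j‖ ^ 2 + 2 * ‖d J‖ ^ 2 +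
      2 * (∑ j ∈ Finset.range (J + 1), d j *
        conj (∑ k ∈ Finset.range (J + 1), if j + 2 ≤ k then d k else 0)).re := by
  have key : ∀ a b : ℂ, ‖a + b‖ ^ 2 = ‖a‖ ^ 2 + ‖b‖ ^ 2 + 2 * (a * conj b).re := fun a b => by
    rw [← Complex.normSq_eq_norm_sq, ← Complex.normSq_eq_norm_sq, ← Complex.normSq_eq_norm_sq,
      Complex.normSq_add]
  induction J with
  | zero => simp; nlinarith [sq_nonneg ‖d 0‖]
  | succ J ih =>
    have h1 : ∑ j ∈ Finset.range (J + 1 + 1), d j *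
        conj (∑ k ∈ Finset.range (J + 1 + 1), if j + 2 ≤ k then d k else 0) =
        ∑ j ∈ Finset.range (J + 1), d j *
          conj (∑ k ∈ Finset.range (J + 1), if j + 2 ≤ k then d k else 0) +
        (∑ j ∈ Finset.range J, d j) * conj (d (J + 1)) := by
      rw [Finset.sum_range_succ (n := J + 1)]
      have h0 : ∑ k ∈ Finset.range (J + 1 + 1), (if J + 1 + 2 ≤ k then d k else 0) = 0 :=
        Finset.sum_eq_zero fun k hk => if_neg (by have := Finset.mem_range.1 hk; omega)
      rw [h0, map_zero, mul_zero, add_zero]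
      simp_rw [Finset.sum_range_succ _ (J + 1), map_add, mul_add, Finset.sum_add_distrib]
      congr 1
      rw [Finset.sum_range_succ, if_neg (by omega), map_zero, mul_zero, add_zero, Finset.sum_mul]
      refine Finset.sum_congr rfl fun j hj => ?_
      rw [if_pos (by have := Finset.mem_range.1 hj; omega)]
    rw [h1, Finset.sum_range_succ, key, Complex.add_re]
    rw [Finset.sum_range_succ (n := J)] at ih ⊢
    rw [Finset.sum_range_succ (n := J) (f := fun j => ‖d j‖ ^ 2)]
    have h2 := key (d J) (d (J + 1))
    have h3 : ‖d J + d (J + 1)‖ ≤ ‖d J‖ + ‖d (J + 1)‖ := norm_add_le _ _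
    have h4 : ‖d J + d (J + 1)‖ ^ 2 ≤ (‖d J‖ + ‖d (J + 1)‖) ^ 2 := by gcongr
    have h5 : ((∑ j ∈ Finset.range J, d j + d J) * conj (d (J + 1))).re =
      ((∑ j ∈ Finset.range J, d j) * conj (d (J + 1))).re + (d J * conj (d (J + 1))).re := by
      rw [add_mul, Complex.add_re]
    rw [h5]
    nlinarith [sq_nonneg (‖d J‖ - ‖d (J + 1)‖)]

/-- Lacunary expansion of the square of a sum: diagonal terms and products with the later tails. -/
theorem norm_sq_sum_range_le (d : ℕ → ℂ) (J : ℕ) :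
    ‖∑ j ∈ Finset.range J, d j‖ ^ 2 ≤ 3 * ∑ j ∈ Finset.range J, ‖d j‖ ^ 2 +
      2 * (∑ j ∈ Finset.range J, d j *
        conj (∑ k ∈ Finset.range J, if j + 2 ≤ k then d k else 0)).re := by
  cases J with
  | zero => simp
  | succ J =>
    refine (norm_sq_sum_range_succ_le d J).trans ?_
    rw [Finset.sum_range_succ (f := fun j => ‖d j‖ ^ 2)]
    nlinarith [sq_nonneg ‖d J‖]

theorem norm_sq_sum_ite_le (d : ℕ → ℂ) (J p : ℕ) :
    ‖∑ k ∈ Finset.range J, if k = p then 0 else d k‖ ^ 2 ≤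
      2 * ‖∑ k ∈ Finset.range J, d k‖ ^ 2 + 2 * ∑ k ∈ Finset.range J, ‖d k‖ ^ 2 := by
  have h0 : 0 ≤ ∑ k ∈ Finset.range J, ‖d k‖ ^ 2 := Finset.sum_nonneg fun _ _ => sq_nonneg _
  by_cases hp : p ∈ Finset.range J
  · have h1 : ∑ k ∈ Finset.range J, d k = (∑ k ∈ Finset.range J, if k = p then 0 else d k) + d p := by
      have : ∀ k, d k = (if k = p then 0 else d k) + if k = p then d p else 0 := fun k => by
        split_ifs with h <;> simp [h]
      rw [Finset.sum_congr rfl fun k _ => this k, Finset.sum_add_distrib, Finset.sum_ite_eq' _ p, if_pos hp]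
    have h2 : ‖d p‖ ^ 2 ≤ ∑ k ∈ Finset.range J, ‖d k‖ ^ 2 :=
      Finset.single_le_sum (f := fun k => ‖d k‖ ^ 2) (fun _ _ => sq_nonneg _) hp
    have h3 := norm_sub_le (∑ k ∈ Finset.range J, d k) (d p)
    rw [show (∑ k ∈ Finset.range J, if k = p then 0 else d k) = (∑ k ∈ Finset.range J, d k) - d p by
      rw [h1]; ring]
    have h4 : ‖(∑ k ∈ Finset.range J, d k) - d p‖ ^ 2 ≤ (‖∑ k ∈ Finset.range J, d k‖ + ‖d p‖) ^ 2 := by gcongr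
    nlinarith [sq_nonneg (‖∑ k ∈ Finset.range J, d k‖ - ‖d p‖)]
  · have h1 : ∑ k ∈ Finset.range J, (if k = p then 0 else d k) = ∑ k ∈ Finset.range J, d k :=
      Finset.sum_congr rfl fun k hk => if_neg (by rintro rfl; exact hp hk)
    rw [h1]
    nlinarith [sq_nonneg ‖∑ k ∈ Finset.range J, d k‖]

theorem norm_sq_sum_le_two_mul {h : ℕ → ℂ} (hh : ∀ j k, h j ≠ 0 → h k ≠ 0 → k ≤ j + 1) (J : ℕ) :
    ‖∑ j ∈ Finset.range J, h j‖ ^ 2 ≤ 2 * ∑ j ∈ Finset.range J, ‖h j‖ ^ 2 := by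
  classical
  set T := (Finset.range J).filter fun j => h j ≠ 0 with hT
  have hcard : (T.card : ℝ) ≤ 2 := by
    rcases T.eq_empty_or_nonempty with h0 | h0
    · simp [h0]
    · have : T ⊆ {T.min' h0, T.min' h0 + 1} := fun j hj => by
        have h1 := T.min'_le j hj
        have h2 := hh _ j (Finset.mem_filter.1 (T.min'_mem h0)).2 (Finset.mem_filter.1 hj).2
        simp only [Finset.mem_insert, Finset.mem_singleton]; omega
      exact_mod_cast (Finset.card_le_card this).trans Finset.card_le_two
  have h1 : ∑ j ∈ Finset.range J, h j = ∑ j ∈ T, h j := (Finset.sum_filter_ne_zero _).symm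
  have h2 : ∑ j ∈ T, ‖h j‖ ^ 2 ≤ ∑ j ∈ Finset.range J, ‖h j‖ ^ 2 :=
    Finset.sum_le_sum_of_subset_of_nonneg (Finset.filter_subset _ _) fun _ _ _ => sq_nonneg _
  have h3 : (∑ j ∈ T, ‖h j‖) ^ 2 ≤ T.card * ∑ j ∈ T, ‖h j‖ ^ 2 := sq_sum_le_card_mul_sum_sq
  have h4 : ‖∑ j ∈ T, h j‖ ≤ ∑ j ∈ T, ‖h j‖ := norm_sum_le _ _
  have h5 : 0 ≤ ∑ j ∈ T, ‖h j‖ ^ 2 := Finset.sum_nonneg fun _ _ => sq_nonneg _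
  rw [h1]
  calc ‖∑ j ∈ T, h j‖ ^ 2 ≤ (∑ j ∈ T, ‖h j‖) ^ 2 := by gcongr
    _ ≤ T.card * ∑ j ∈ T, ‖h j‖ ^ 2 := h3
    _ ≤ 2 * ∑ j ∈ T, ‖h j‖ ^ 2 := by gcongr
    _ ≤ _ := by gcongr

theorem exists_schwartz_fourier_eq_one_eq_zero : ∃ g : 𝓢(ℝ, ℂ),
    (∀ x, |x| ≤ 1 / 2 → 𝓕 (g : ℝ → ℂ) x = 1) ∧ ∀ x, 1 ≤ |x| → 𝓕 (g : ℝ → ℂ) x = 0 := by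
  let ψ : ContDiffBump (0:ℝ) := ⟨1 / 2, 1, by norm_num, by norm_num⟩
  have hsm : ContDiff ℝ ∞ fun x => ((ψ x : ℝ) : ℂ) := Complex.ofRealCLM.contDiff.comp ψ.contDiff
  have hcs : HasCompactSupport fun x => ((ψ x : ℝ) : ℂ) :=
    ψ.hasCompactSupport.comp_left (g := fun x:ℝ => (x:ℂ)) (by simp)
  set H : 𝓢(ℝ, ℂ) := hcs.toSchwartzMap hsm with hH
  have hF : 𝓕 ((𝓕⁻ H : 𝓢(ℝ, ℂ)) : ℝ → ℂ) = fun x => ((ψ x : ℝ) : ℂ) := by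
    rw [← SchwartzMap.fourier_coe, FourierTransform.fourier_fourierInv_eq]; rfl
  refine ⟨𝓕⁻ H, fun x hx => ?_, fun x hx => ?_⟩
  · rw [hF]
    simp only
    rw [ψ.one_of_mem_closedBall (by simpa [ψ] using hx), Complex.ofReal_one]
  · rw [hF]
    simp only
    rw [ψ.zero_of_le_dist (by simpa [ψ] using hx), Complex.ofReal_zero]

section ReverseLP
variable {e : Plane} {σ : ℝ} {a : ℕ → ℕ → Plane → ℂ}

/-- The tail of a lacunary sum after the scale `j`. -/
def lacTail (a : ℕ → ℕ → Plane → ℂ) (J j m : ℕ) : Plane → ℂ :=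
  ∑ k ∈ Finset.range J, if j + 2 ≤ k then a k m else 0

/-- The lacunary sum with the scale `j + 1` removed. -/
def lacHole (a : ℕ → ℕ → Plane → ℂ) (J j m : ℕ) : Plane → ℂ :=
  ∑ k ∈ Finset.range J, if k = j + 1 then 0 else a k m

theorem nice_lacTail (ha : ∀ j m, Nice (a j m)) (J j m : ℕ) : Nice (lacTail a J j m) :=
  Nice.sum _ fun k _ => by split_ifs; exacts [ha k m, Nice.zero]

theorem nice_lacHole (ha : ∀ j m, Nice (a j m)) (J j m : ℕ) : Nice (lacHole a J j m) :=
  Nice.sum _ fun k _ => by split_ifs; exacts [Nice.zero, ha k m]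

theorem fourierInv_lacTail (ha : ∀ j m, Nice (a j m)) (J j m : ℕ) (x : Plane) :
    𝓕⁻ (lacTail a J j m) x = ∑ k ∈ Finset.range J, if j + 2 ≤ k then 𝓕⁻ (a k m) x else 0 := by
  rw [lacTail, Nice.fourierInv_sum _ fun k _ => by split_ifs; exacts [ha k m, Nice.zero], Finset.sum_apply]
  refine Finset.sum_congr rfl fun k _ => ?_
  split_ifs <;> simp [Nice.fourierInv_zero]

theorem fourierInv_lacHole (ha : ∀ j m, Nice (a j m)) (J j m : ℕ) (x : Plane) :
    𝓕⁻ (lacHole a J j m) x = ∑ k ∈ Finset.range J, if k = j + 1 then 0 else 𝓕⁻ (a k m) x := by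
  rw [lacHole, Nice.fourierInv_sum _ fun k _ => by split_ifs; exacts [Nice.zero, ha k m], Finset.sum_apply]
  refine Finset.sum_congr rfl fun k _ => ?_
  split_ifs <;> simp [Nice.fourierInv_zero]

theorem pow_mul_eq (y : ℝ) {j k : ℕ} (h : j ≤ k) : 2 ^ k * y = 2 ^ (k - j) * (2 ^ j * y) := by
  rw [← mul_assoc, ← pow_add, Nat.sub_add_cancel h]

theorem lacTail_eq (hsupp : ∀ j m ξ, a j m ξ ≠ 0 → 1 ≤ 2 ^ j * σ * inner ℝ ξ e ∧ 2 ^ j * σ * inner ℝ ξ e < 2)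
    {g : ℝ → ℂ} (hg1 : ∀ x, |x| ≤ 1 / 2 → 𝓕 g x = 1) (hg0 : ∀ x, 1 ≤ |x| → 𝓕 g x = 0) (J j m : ℕ) (ξ : Plane) :
    𝓕 g (inner ℝ ξ ((2 ^ j * σ) • e)) * lacHole a J j m ξ = lacTail a J j m ξ := by
  rw [lacHole, lacTail, Finset.sum_apply, Finset.sum_apply, Finset.mul_sum]
  refine Finset.sum_congr rfl fun k _ => ?_
  rw [inner_smul_right]
  by_cases h0 : a k m ξ = 0
  · split_ifs <;> simp [h0]
  obtain ⟨h1, h2⟩ := hsupp k m ξ h0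
  rw [mul_assoc] at h1 h2 ⊢
  set y := σ * inner ℝ ξ e
  rcases lt_trichotomy k (j + 1) with h | h | h
  · rw [if_neg h.ne, if_neg (by omega)]
    have h3 := pow_mul_eq y (Nat.lt_succ_iff.1 h)
    have h4 : (1:ℝ) ≤ 2 ^ (j - k) := one_le_pow₀ (by norm_num)
    rw [hg0 _ (le_trans (by nlinarith) (le_abs_self _))]
    simp
  · rw [if_pos h, if_neg (by omega)]; simp
  · rw [if_neg h.ne', if_pos (by omega)]
    have h3 := pow_mul_eq y (show j ≤ k by omega)
    have h4 : (4:ℝ) ≤ 2 ^ (k - j) := by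
      calc (4:ℝ) = 2 ^ 2 := by norm_num
        _ ≤ _ := pow_le_pow_right₀ (by norm_num) (by omega)
    have h5 : 0 < 2 ^ j * y := by
      by_contra! h5
      nlinarith [mul_nonneg (show (0:ℝ) ≤ 2 ^ (k - j) by positivity) (neg_nonneg.2 h5)]
    rw [hg1 _ (by rw [abs_of_pos h5]; nlinarith), one_mul]

/-- Frequency localization of the products with tails. -/
theorem conv_star_lacTail_supp
    (hsupp : ∀ j m ξ, a j m ξ ≠ 0 → 1 ≤ 2 ^ j * σ * inner ℝ ξ e ∧ 2 ^ j * σ * inner ℝ ξ e < 2) (J j m : ℕ)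
    (ξ : Plane) (h : ((a j m) ⋆[ContinuousLinearMap.mul ℂ ℂ, volume] fun ξ => conj (lacTail a J j m (-ξ))) ξ ≠ 0) :
    1 / 2 < 2 ^ j * (σ * inner ℝ ξ e) ∧ 2 ^ j * (σ * inner ℝ ξ e) < 2 := by
  by_contra hc
  refine h ?_
  rw [convolution]
  refine integral_eq_zero_of_ae (Filter.Eventually.of_forall fun η => ?_)
  simp only [ContinuousLinearMap.mul_apply', Pi.zero_apply, mul_eq_zero, map_eq_zero]
  by_contra! h'
  obtain ⟨h1, h2⟩ := h'
  obtain ⟨h3, h4⟩ := hsupp _ _ _ h1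
  rw [lacTail, Finset.sum_apply] at h2
  obtain ⟨k, -, hk⟩ := Finset.exists_ne_zero_of_sum_ne_zero h2
  split_ifs at hk with hjk
  swap
  · simp at hk
  obtain ⟨h5, h6⟩ := hsupp _ _ _ hk
  rw [mul_assoc] at h3 h4 h5 h6
  rw [pow_mul_eq _ (show j ≤ k by omega)] at h5 h6
  have h7 : (4:ℝ) ≤ 2 ^ (k - j) := by
    calc (4:ℝ) = 2 ^ 2 := by norm_num
      _ ≤ _ := pow_le_pow_right₀ (by norm_num) (by omega)
  have h8 : -(ξ - η) = η - ξ := neg_sub _ _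
  rw [h8, inner_sub_left] at h5 h6
  have h9 : 2 ^ j * (σ * (inner ℝ η e - inner ℝ ξ e)) = 2 ^ j * (σ * inner ℝ η e) - 2 ^ j * (σ * inner ℝ ξ e) := by ring
  rw [h9] at h5 h6
  set u := 2 ^ j * (σ * inner ℝ η e)
  set v := 2 ^ j * (σ * inner ℝ ξ e)
  have h10 : 0 < u - v := by
    by_contra! h5
    nlinarith [mul_nonneg (show (0:ℝ) ≤ 2 ^ (k - j) by positivity) (neg_nonneg.2 h5)]
  exact hc ⟨by nlinarith, by linarith⟩

/-- The products with tails at different scales are almost orthogonal. -/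
theorem integral_norm_sq_sum_lac_le (ha : ∀ j m, Nice (a j m))
    (hsupp : ∀ j m ξ, a j m ξ ≠ 0 → 1 ≤ 2 ^ j * σ * inner ℝ ξ e ∧ 2 ^ j * σ * inner ℝ ξ e < 2) (J M : ℕ) :
    ∃ h : ℕ → Plane → ℂ, (∀ j, Nice (h j)) ∧
      (∀ j x, 𝓕⁻ (h j) x = ∑ m ∈ Finset.range M, 𝓕⁻ (a j m) x * conj (𝓕⁻ (lacTail a J j m) x)) ∧
      ∫ x, ‖∑ j ∈ Finset.range J, 𝓕⁻ (h j) x‖ ^ 2 ≤ 2 * ∑ j ∈ Finset.range J, ∫ x, ‖𝓕⁻ (h j) x‖ ^ 2 := by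
  have hc : ∀ j m, Nice ((a j m) ⋆[ContinuousLinearMap.mul ℂ ℂ, volume] fun ξ => conj (lacTail a J j m (-ξ))) :=
    fun j m => (ha j m).conv (nice_lacTail ha J j m).star
  set h : ℕ → Plane → ℂ := fun j => ∑ m ∈ Finset.range M,
    ((a j m) ⋆[ContinuousLinearMap.mul ℂ ℂ, volume] fun ξ => conj (lacTail a J j m (-ξ))) with hh
  have hN : ∀ j, Nice (h j) := fun j => Nice.sum _ fun m _ => hc j m
  refine ⟨h, hN, fun j x => ?_, ?_⟩
  · rw [hh]
    simp only
    rw [Nice.fourierInv_sum _ fun m _ => hc j m, Finset.sum_apply]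
    refine Finset.sum_congr rfl fun m _ => ?_
    rw [← Nice.fourierInv_mul (ha j m) (nice_lacTail ha J j m).star, Nice.conj_fourierInv]
  · have h1 : ∀ x, ∑ j ∈ Finset.range J, 𝓕⁻ (h j) x = 𝓕⁻ (∑ j ∈ Finset.range J, h j) x := fun x => by
      rw [Nice.fourierInv_sum _ fun j _ => hN j, Finset.sum_apply]
    simp_rw [h1]
    rw [Nice.plancherel_sq (Nice.sum _ fun j _ => hN j)]
    simp_rw [fun j => Nice.plancherel_sq (hN j)]
    rw [← integral_finsetSum _ fun j _ => (hN j).integrable_norm_sq, ← integral_const_mul]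
    refine integral_mono (Nice.sum _ fun j _ => hN j).integrable_norm_sq
      ((integrable_finsetSum _ fun j _ => (hN j).integrable_norm_sq).const_mul 2) fun ξ => ?_
    simp only [Finset.sum_apply]
    refine norm_sq_sum_le_two_mul (fun j k hj hk => ?_) J
    have hs : ∀ j, h j ξ ≠ 0 → 1 / 2 < 2 ^ j * (σ * inner ℝ ξ e) ∧ 2 ^ j * (σ * inner ℝ ξ e) < 2 := fun j hj => by
      rw [hh] at hj
      simp only [Finset.sum_apply] at hj
      obtain ⟨m, -, hm⟩ := Finset.exists_ne_zero_of_sum_ne_zero hj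
      exact conv_star_lacTail_supp hsupp J j m ξ hm
    obtain ⟨h3, h4⟩ := hs j hj
    obtain ⟨h5, h6⟩ := hs k hk
    by_contra! hlt
    rw [pow_mul_eq _ (show j ≤ k by omega)] at h5 h6
    have h7 : (4:ℝ) ≤ 2 ^ (k - j) := by
      calc (4:ℝ) = 2 ^ 2 := by norm_num
        _ ≤ _ := pow_le_pow_right₀ (by norm_num) (by omega)
    nlinarith

end ReverseLP

section ReverseLP
variable {e : Plane} {σ : ℝ} {a : ℕ → ℕ → Plane → ℂ}

theorem ofReal_sum_norm_sq {ι : Type*} (s : Finset ι) (z : ι → ℂ) :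
    ENNReal.ofReal (∑ i ∈ s, ‖z i‖ ^ 2) = ∑ i ∈ s, ‖z i‖ₑ ^ 2 := by
  rw [ENNReal.ofReal_sum_of_nonneg fun i _ => sq_nonneg _]
  refine Finset.sum_congr rfl fun i _ => ?_
  rw [← ofReal_norm, ENNReal.ofReal_pow (norm_nonneg _)]

/-- The tails are controlled by a dyadic directional maximal function. -/
theorem sum_enorm_lacTail_sq_le (ha : ∀ j m, Nice (a j m))
    (hsupp : ∀ j m ξ, a j m ξ ≠ 0 → 1 ≤ 2 ^ j * σ * inner ℝ ξ e ∧ 2 ^ j * σ * inner ℝ ξ e < 2)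
    {g : 𝓢(ℝ, ℂ)} (hg1 : ∀ x, |x| ≤ 1 / 2 → 𝓕 (g : ℝ → ℂ) x = 1) (hg0 : ∀ x, 1 ≤ |x| → 𝓕 (g : ℝ → ℂ) x = 0)
    {C : ℝ} (hC0 : 0 ≤ C) (hC : ∀ s, ‖g s‖ ≤ C * cauchyKer s) (J M j : ℕ) (x : Plane) :
    ∑ m ∈ Finset.range M, ‖𝓕⁻ (lacTail a J j m) x‖ₑ ^ 2 ≤ ENNReal.ofReal (2 * C ^ 2 * Real.pi) *
      avg ((2 ^ j * σ) • e) (fun x => ENNReal.ofReal (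
        ∑ m ∈ Finset.range M, ‖∑ k ∈ Finset.range J, 𝓕⁻ (a k m) x‖ ^ 2 +
        ∑ i ∈ Finset.range J ×ˢ Finset.range M, ‖𝓕⁻ (a i.1 i.2) x‖ ^ 2)) x := by
  set v := (2 ^ j * σ) • e with hv
  have hB : ∀ m, Measurable (𝓕⁻ (lacHole a J j m)) := fun m => (nice_lacHole ha J j m).continuous_fourierInv.measurable
  have hcont : ∀ j m, Continuous (𝓕⁻ (a j m)) := fun j m => (ha j m).continuous_fourierInv
  have hm : Measurable fun x => ENNReal.ofReal (
        ∑ m ∈ Finset.range M, ‖∑ k ∈ Finset.range J, 𝓕⁻ (a k m) x‖ ^ 2 +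
        ∑ i ∈ Finset.range J ×ˢ Finset.range M, ‖𝓕⁻ (a i.1 i.2) x‖ ^ 2) := by
    refine ENNReal.measurable_ofReal.comp (Continuous.measurable ?_)
    fun_prop
  have h1 : ∀ m, ‖𝓕⁻ (lacTail a J j m) x‖ₑ ^ 2 ≤
      ENNReal.ofReal (C ^ 2 * Real.pi) * avg v (fun x => ‖𝓕⁻ (lacHole a J j m) x‖ₑ ^ 2) x := fun m => by
    have h2 : 𝓕⁻ (lacTail a J j m) x = dirConv g v (𝓕⁻ (lacHole a J j m)) x := by
      rw [dirConv_fourierInv g.integrable v (nice_lacHole ha J j m).integrable]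
      exact congrFun (congrArg _ (funext fun ξ => (lacTail_eq hsupp hg1 hg0 J j m ξ).symm)) x
    rw [h2]
    calc _ ≤ (ENNReal.ofReal C * avg v (fun x => ‖𝓕⁻ (lacHole a J j m) x‖ₑ) x) ^ 2 := by
          gcongr; exact enorm_dirConv_le hC hC0 v (hB m) x
      _ = ENNReal.ofReal (C ^ 2) * avg v (fun x => ‖𝓕⁻ (lacHole a J j m) x‖ₑ) x ^ 2 := by
          rw [mul_pow, ENNReal.ofReal_pow hC0]
      _ ≤ ENNReal.ofReal (C ^ 2) * (ENNReal.ofReal Real.pi * avg v (fun x => ‖𝓕⁻ (lacHole a J j m) x‖ₑ ^ 2) x) := by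
          gcongr; exact avg.sq_le v (hB m).enorm x
      _ = _ := by rw [← mul_assoc, ENNReal.ofReal_mul (by positivity)]
  calc _ ≤ ∑ m ∈ Finset.range M, ENNReal.ofReal (C ^ 2 * Real.pi) *
        avg v (fun x => ‖𝓕⁻ (lacHole a J j m) x‖ₑ ^ 2) x := Finset.sum_le_sum fun m _ => h1 m
    _ = ENNReal.ofReal (C ^ 2 * Real.pi) *
        avg v (fun x => ∑ m ∈ Finset.range M, ‖𝓕⁻ (lacHole a J j m) x‖ₑ ^ 2) x := by
        rw [avg.sum v _ fun m => ((hB m).enorm.pow_const 2), Finset.mul_sum]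
    _ ≤ ENNReal.ofReal (C ^ 2 * Real.pi) * avg v (fun x => ENNReal.ofReal 2 * ENNReal.ofReal (
        ∑ m ∈ Finset.range M, ‖∑ k ∈ Finset.range J, 𝓕⁻ (a k m) x‖ ^ 2 +
        ∑ i ∈ Finset.range J ×ˢ Finset.range M, ‖𝓕⁻ (a i.1 i.2) x‖ ^ 2)) x := by
        gcongr
        refine avg.mono v (fun x => ?_) x
        rw [← ofReal_sum_norm_sq, ← ENNReal.ofReal_mul (by norm_num)]
        refine ENNReal.ofReal_le_ofReal ?_
        rw [Finset.sum_product_right, mul_add, Finset.mul_sum, Finset.mul_sum, ← Finset.sum_add_distrib]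
        refine Finset.sum_le_sum fun m _ => ?_
        rw [fourierInv_lacHole ha]
        exact norm_sq_sum_ite_le (fun k => 𝓕⁻ (a k m) x) J (j + 1)
    _ = _ := by
        rw [avg.const_mul v _ hm, ← mul_assoc, ← ENNReal.ofReal_mul (by positivity)]
        congr 2
        ring

theorem reverse_lp_arith {X Y w K : ℝ} (hX : 0 ≤ X) (hY : 0 ≤ Y) (hK : 0 ≤ K) (h1 : X ≤ 18 * Y + 16 * w)
    (h2 : w ^ 2 ≤ K * Y * (X + Y)) : X ≤ (37 + 256 * K) * Y := by
  have h3 : 16 * w ≤ (X + Y) / 2 + 128 * K * Y := by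
    refine abs_le_of_sq_le_sq' ?_ (by positivity) |>.2
    nlinarith [sq_nonneg ((X + Y) / 2 - 128 * K * Y)]
  linarith

/-- Reverse Littlewood–Paley inequality in `L⁴` for lacunary frequency strips. -/
theorem exists_reverse_littlewood_paley : ∃ C : ℝ, 0 ≤ C ∧
    ∀ (e : Plane) (σ : ℝ) (J M : ℕ) (a : ℕ → ℕ → Plane → ℂ), 0 < σ → (∀ j m, Nice (a j m)) →
      (∀ j m ξ, a j m ξ ≠ 0 → 1 ≤ 2 ^ j * σ * inner ℝ ξ e ∧ 2 ^ j * σ * inner ℝ ξ e < 2) →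
      ∫ x, (∑ m ∈ Finset.range M, ‖∑ k ∈ Finset.range J, 𝓕⁻ (a k m) x‖ ^ 2) ^ 2 ≤
        C * ∫ x, (∑ i ∈ Finset.range J ×ˢ Finset.range M, ‖𝓕⁻ (a i.1 i.2) x‖ ^ 2) ^ 2 := by
  obtain ⟨g, hg1, hg0⟩ := exists_schwartz_fourier_eq_one_eq_zero
  obtain ⟨C, hC0, hC⟩ := g.exists_le_cauchyKer
  set K := (2 * C ^ 2 * Real.pi) ^ 2 * (64 * Real.pi ^ 2 + 1) * 2 with hK
  refine ⟨37 + 256 * K, by positivity, fun e σ J M a hσ ha hsupp => ?_⟩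
  obtain ⟨h, hN, hh, hh2⟩ := integral_norm_sq_sum_lac_le ha hsupp J M
  have hGg : Good fun x => ∑ m ∈ Finset.range M, ‖∑ k ∈ Finset.range J, 𝓕⁻ (a k m) x‖ ^ 2 := by
    have := Nice.good_sum_sq (Finset.range M) (a := fun m => ∑ k ∈ Finset.range J, a k m)
      fun m _ => Nice.sum _ fun k _ => ha k m
    simp_rw [fun m => Nice.fourierInv_sum (Finset.range J) (a := fun k => a k m) fun k _ => ha k m,
      Finset.sum_apply] at this
    exact this
  have hDg : Good fun x => ∑ i ∈ Finset.range J ×ˢ Finset.range M, ‖𝓕⁻ (a i.1 i.2) x‖ ^ 2 :=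
    Nice.good_sum_sq _ (a := fun i : ℕ × ℕ => a i.1 i.2) fun i _ => ha i.1 i.2
  set G : Plane → ℝ := fun x => ∑ m ∈ Finset.range M, ‖∑ k ∈ Finset.range J, 𝓕⁻ (a k m) x‖ ^ 2 with hG
  set D : Plane → ℝ := fun x => ∑ i ∈ Finset.range J ×ˢ Finset.range M, ‖𝓕⁻ (a i.1 i.2) x‖ ^ 2 with hD
  have hG0 : ∀ x, 0 ≤ G x := fun x => Finset.sum_nonneg fun _ _ => sq_nonneg _
  have hD0 : ∀ x, 0 ≤ D x := fun x => Finset.sum_nonneg fun _ _ => sq_nonneg _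
  have hsumN : Nice (∑ j ∈ Finset.range J, h j) := Nice.sum _ fun j _ => hN j
  have hHg : Good fun x => ‖∑ j ∈ Finset.range J, 𝓕⁻ (h j) x‖ := by
    have := hsumN.good_norm
    simp_rw [Nice.fourierInv_sum (Finset.range J) fun j _ => hN j, Finset.sum_apply] at this
    exact this
  -- pointwise expansion
  have hpt : ∀ x, G x ≤ 3 * D x + 2 * ‖∑ j ∈ Finset.range J, 𝓕⁻ (h j) x‖ := fun x => by
    have h1 : G x ≤ ∑ m ∈ Finset.range M, (3 * ∑ j ∈ Finset.range J, ‖𝓕⁻ (a j m) x‖ ^ 2 +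
        2 * (∑ j ∈ Finset.range J, 𝓕⁻ (a j m) x * conj (𝓕⁻ (lacTail a J j m) x)).re) :=
      Finset.sum_le_sum fun m _ => by
        simp_rw [fourierInv_lacTail ha]
        exact norm_sq_sum_range_le (fun j => 𝓕⁻ (a j m) x) J
    refine h1.trans ?_
    rw [Finset.sum_add_distrib, ← Finset.mul_sum, ← Finset.mul_sum, ← Complex.re_sum]
    rw [Finset.sum_comm (s := Finset.range M) (t := Finset.range J)
      (f := fun m j => 𝓕⁻ (a j m) x * conj (𝓕⁻ (lacTail a J j m) x))]
    simp_rw [hh]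
    simp only [hD]
    rw [Finset.sum_product_right]
    gcongr
    exact Complex.re_le_norm _
  have hX : ∫ x, G x ^ 2 ≤ 18 * (∫ x, D x ^ 2) + 16 * ∑ j ∈ Finset.range J, ∫ x, ‖𝓕⁻ (h j) x‖ ^ 2 := by
    have h1 : ∫ x, G x ^ 2 ≤ ∫ x, (18 * D x ^ 2 + 8 * ‖∑ j ∈ Finset.range J, 𝓕⁻ (h j) x‖ ^ 2) := by
      refine integral_mono hGg.integrable_sq ((hDg.integrable_sq.const_mul 18).add
        (hHg.integrable_sq.const_mul 8)) fun x => ?_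
      have h2 := hpt x
      have h3 : G x ^ 2 ≤ (3 * D x + 2 * ‖∑ j ∈ Finset.range J, 𝓕⁻ (h j) x‖) ^ 2 := pow_le_pow_left₀ (hG0 x) h2 2
      simp only
      nlinarith [sq_nonneg (3 * D x - 2 * ‖∑ j ∈ Finset.range J, 𝓕⁻ (h j) x‖)]
    rw [integral_add (hDg.integrable_sq.const_mul 18) (hHg.integrable_sq.const_mul 8), integral_const_mul,
      integral_const_mul] at h1
    linarith
  refine reverse_lp_arith (integral_nonneg fun x => sq_nonneg _) (integral_nonneg fun x => sq_nonneg _)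
    (by positivity) hX ?_
  -- the maximal function estimate
  set U : Plane → ℝ≥0∞ := fun x => ENNReal.ofReal (G x + D x) with hU
  have hUm : Measurable U := ENNReal.measurable_ofReal.comp (hGg.add hDg).cont.measurable
  set Q : Plane → ℝ≥0∞ := fun x => (Finset.range J).sup fun j => avg ((2 ^ j * σ) • e) U x with hQ
  have hQm : Measurable Q := measurable_finset_sup _ fun j => avg.measurable _ hUm
  set A := ENNReal.ofReal (2 * C ^ 2 * Real.pi) with hA
  have hDm : Measurable fun x => ENNReal.ofReal (D x) := ENNReal.measurable_ofReal.comp hDg.cont.measurable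
  have hHm : ∀ j, Measurable fun x => ‖𝓕⁻ (h j) x‖ₑ ^ 2 := fun j =>
    ((hN j).continuous_fourierInv.measurable.enorm.pow_const 2)
  have hw : ENNReal.ofReal (∑ j ∈ Finset.range J, ∫ x, ‖𝓕⁻ (h j) x‖ ^ 2) ≤
      A * ∫⁻ x, ENNReal.ofReal (D x) * Q x := by
    rw [ENNReal.ofReal_sum_of_nonneg fun j _ => integral_nonneg fun x => sq_nonneg _]
    simp_rw [← fun j => lintegral_enorm_sq_eq (hN j).memLp_two_fourierInv]
    rw [← lintegral_finsetSum _ fun j _ => hHm j,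
      ← lintegral_const_mul _ (show Measurable fun x => ENNReal.ofReal (D x) * Q x from hDm.mul hQm)]
    refine lintegral_mono fun x => ?_
    have h1 : ∀ j ∈ Finset.range J, ‖𝓕⁻ (h j) x‖ₑ ^ 2 ≤
        (∑ m ∈ Finset.range M, ‖𝓕⁻ (a j m) x‖ₑ ^ 2) * (A * Q x) := fun j hj => by
      have h2 : ‖𝓕⁻ (h j) x‖ ^ 2 ≤ (∑ m ∈ Finset.range M, ‖𝓕⁻ (a j m) x‖ ^ 2) *
          ∑ m ∈ Finset.range M, ‖𝓕⁻ (lacTail a J j m) x‖ ^ 2 := by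
        rw [hh]
        refine le_trans ?_ (Finset.sum_mul_sq_le_sq_mul_sq _ _ _)
        gcongr
        refine (norm_sum_le _ _).trans (Finset.sum_le_sum fun m _ => ?_)
        rw [norm_mul, Complex.norm_conj]
      have h3 := ENNReal.ofReal_le_ofReal h2
      rw [ENNReal.ofReal_mul (Finset.sum_nonneg fun _ _ => sq_nonneg _), ofReal_sum_norm_sq, ofReal_sum_norm_sq,
        ENNReal.ofReal_pow (norm_nonneg _), ofReal_norm] at h3
      refine h3.trans ?_
      gcongr
      refine (sum_enorm_lacTail_sq_le ha hsupp hg1 hg0 hC0 hC J M j x).trans ?_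
      gcongr
      exact Finset.le_sup (f := fun j => avg ((2 ^ j * σ) • e) U x) hj
    refine (Finset.sum_le_sum h1).trans_eq ?_
    rw [← Finset.sum_mul, ← Finset.sum_product' (f := fun j m => ‖𝓕⁻ (a j m) x‖ₑ ^ 2), ← ofReal_sum_norm_sq]
    simp only [hD]
    ring
  have hw0 : 0 ≤ ∑ j ∈ Finset.range J, ∫ x, ‖𝓕⁻ (h j) x‖ ^ 2 :=
    Finset.sum_nonneg fun j _ => integral_nonneg fun x => sq_nonneg _
  have hsq : ∀ {u : Plane → ℝ}, Good u → (∀ x, 0 ≤ u x) →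
      ∫⁻ x, ENNReal.ofReal (u x) ^ 2 = ENNReal.ofReal (∫ x, u x ^ 2) := fun {u} hu hu0 => by
    rw [ofReal_integral_eq_lintegral_ofReal hu.integrable_sq (Filter.Eventually.of_forall fun x => sq_nonneg _)]
    exact lintegral_congr fun x => (ENNReal.ofReal_pow (hu0 x) 2).symm
  have hY0 : 0 ≤ ∫ x, D x ^ 2 := integral_nonneg fun x => sq_nonneg _
  have hX0 : 0 ≤ ∫ x, G x ^ 2 := integral_nonneg fun x => sq_nonneg _
  have hUsq : ∫⁻ x, U x ^ 2 ≤ ENNReal.ofReal (2 * ((∫ x, G x ^ 2) + ∫ x, D x ^ 2)) := by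
    rw [hU, hsq (hGg.add hDg) fun x => add_nonneg (hG0 x) (hD0 x)]
    refine ENNReal.ofReal_le_ofReal ?_
    rw [← integral_add hGg.integrable_sq hDg.integrable_sq, ← integral_const_mul]
    refine integral_mono (hGg.add hDg).integrable_sq
      ((hGg.integrable_sq.add hDg.integrable_sq).const_mul 2) fun x => ?_
    simp only
    nlinarith [sq_nonneg (G x - D x)]
  rw [← ENNReal.ofReal_le_ofReal_iff (by positivity), ENNReal.ofReal_pow hw0]
  calc _ ≤ (A * ∫⁻ x, ENNReal.ofReal (D x) * Q x) ^ 2 := by gcongr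
    _ = A ^ 2 * (∫⁻ x, ENNReal.ofReal (D x) * Q x) ^ 2 := mul_pow _ _ _
    _ ≤ A ^ 2 * ((∫⁻ x, ENNReal.ofReal (D x) ^ 2) * ∫⁻ x, Q x ^ 2) := by
        gcongr; exact lintegral_mul_sq_le hDm.aemeasurable hQm.aemeasurable
    _ ≤ A ^ 2 * (ENNReal.ofReal (∫ x, D x ^ 2) * (ENNReal.ofReal (64 * Real.pi ^ 2 + 1) *
        ENNReal.ofReal (2 * ((∫ x, G x ^ 2) + ∫ x, D x ^ 2)))) := by
        rw [hsq hDg hD0]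
        gcongr
        refine (lintegral_sup_avg_sq_le (Finset.range J) (fun j => 2 ^ j * σ) (fun j => by positivity) e hUm).trans ?_
        gcongr
    _ = _ := by
        rw [hA, ← ENNReal.ofReal_pow (by positivity), ← ENNReal.ofReal_mul (by positivity),
          ← ENNReal.ofReal_mul (by positivity), ← ENNReal.ofReal_mul (by positivity)]
        congr 1
        rw [hK]; ring

end ReverseLP

theorem tendsto_fourierInv_indicator {α : Plane → ℂ} (hα : Nice α) {E : ℕ → Set Plane} {E' : Set Plane}
    (hE : ∀ n, MeasurableSet (E n)) (h : ∀ ξ, ∀ᶠ n in Filter.atTop, ξ ∈ E n ↔ ξ ∈ E') (x : Plane) :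
    Filter.Tendsto (fun n => 𝓕⁻ ((E n).indicator α) x) Filter.atTop (nhds (𝓕⁻ (E'.indicator α) x)) := by
  simp_rw [Real.fourierInv_eq]
  refine tendsto_integral_of_dominated_convergence (fun ξ => ‖α ξ‖) (fun n => ?_) hα.integrable.norm
    (fun n => Filter.Eventually.of_forall fun ξ => ?_) (Filter.Eventually.of_forall fun ξ => ?_)
  · simp_rw [Circle.smul_def]
    refine AEStronglyMeasurable.smul (show Continuous fun ξ : Plane => (Real.fourierChar (inner ℝ ξ x) : ℂ) from
      continuous_subtype_val.comp (Real.continuous_fourierChar.comp (by fun_prop))).aestronglyMeasurable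
      (hα.integrable.aestronglyMeasurable.indicator (hE n))
  · rw [Circle.norm_smul]
    exact norm_indicator_le_norm_self _ _
  · refine tendsto_const_nhds.congr' ?_
    filter_upwards [h ξ] with n hn
    by_cases hξ : ξ ∈ E'
    · rw [indicator_of_mem hξ, indicator_of_mem (hn.2 hξ)]
    · rw [indicator_of_notMem hξ, indicator_of_notMem (fun h => hξ (hn.1 h))]

/-- The sector with slopes in `[t m, t (m + 1))` in the frame `(e, e')`. -/
def slopeSector (e e' : Plane) (t : ℕ → ℝ) (m : ℕ) : Set Plane :=
  {ξ | 0 < inner ℝ ξ e ∧ t m * inner ℝ ξ e ≤ inner ℝ ξ e' ∧ inner ℝ ξ e' < t (m + 1) * inner ℝ ξ e}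

theorem pow_mul_lt_two_unique {s : ℝ} {j k : ℕ} (hjk : j < k) (h1 : 1 ≤ 2 ^ j * s) (h2 : 2 ^ k * s < 2) : False := by
  rw [pow_mul_eq s hjk.le] at h2
  have h7 : (2:ℝ) ≤ 2 ^ (k - j) := by
    calc (2:ℝ) = 2 ^ 1 := by norm_num
      _ ≤ _ := pow_le_pow_right₀ (by norm_num) (by omega)
  nlinarith

theorem sum_indicator_dyadicSector (e e' : Plane) (t : ℕ → ℝ) (σ : ℝ) (m J : ℕ) (α : Plane → ℂ) :
    ∑ j ∈ Finset.range J, (dyadicSector e e' t σ j m).indicator α =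
      (⋃ j ∈ Finset.range J, dyadicSector e e' t σ j m).indicator α := by
  rw [Finset.indicator_biUnion]
  · ext ξ; simp
  · intro j _ k _ hjk
    refine disjoint_left.2 fun ξ h1 h2 => ?_
    obtain ⟨h3, h4, -⟩ := h1
    obtain ⟨h5, h6, -⟩ := h2
    rw [mul_assoc] at h3 h4 h5 h6
    rcases hjk.lt_or_gt with h | h
    · exact pow_mul_lt_two_unique h h3 h6
    · exact pow_mul_lt_two_unique h h5 h4

theorem eventually_mem_iUnion_dyadicSector (e e' : Plane) (t : ℕ → ℝ) (m : ℕ) (ξ : Plane) :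
    ∀ᶠ L : ℕ in Filter.atTop,
      ξ ∈ (⋃ j ∈ Finset.range (2 * L + 1), dyadicSector e e' t (2 ^ (-(L:ℤ))) j m) ↔ ξ ∈ slopeSector e e' t m := by
  have hsub : ∀ L : ℕ, ξ ∈ (⋃ j ∈ Finset.range (2 * L + 1), dyadicSector e e' t (2 ^ (-(L:ℤ))) j m) →
      ξ ∈ slopeSector e e' t m := fun L h => by
    simp only [mem_iUnion] at h
    obtain ⟨j, -, h1, h2, h3, h4⟩ := h
    refine ⟨?_, h3, h4⟩
    by_contra! h5
    nlinarith [mul_nonneg (show (0:ℝ) ≤ 2 ^ j * 2 ^ (-(L:ℤ)) by positivity) (neg_nonneg.2 h5)]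
  by_cases hξ : ξ ∈ slopeSector e e' t m
  · obtain ⟨k, hk1, hk2⟩ := exists_mem_Ico_zpow (y := (2:ℝ)) hξ.1 (by norm_num)
    filter_upwards [Filter.eventually_ge_atTop k.natAbs] with L hL
    refine ⟨hsub L, fun _ => ?_⟩
    simp only [mem_iUnion]
    have h1 : ((L - k).toNat : ℤ) = L - k := Int.toNat_of_nonneg (by omega)
    have h2 : (2:ℝ) ^ (L - k).toNat * 2 ^ (-(L:ℤ)) = 2 ^ (-k) := by
      rw [← zpow_natCast, h1, ← zpow_add₀ (by norm_num)]; congr 1; ring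
    have h3 : (0:ℝ) < 2 ^ (-k) := by positivity
    have h4 : (2:ℝ) ^ (-k) * 2 ^ k = 1 := by rw [← zpow_add₀ (by norm_num)]; simp
    have h5 : (2:ℝ) ^ (-k) * 2 ^ (k + 1) = 2 := by rw [← zpow_add₀ (by norm_num)]; simp
    refine ⟨(L - k).toNat, Finset.mem_range.2 (by omega), ?_, ?_, hξ.2⟩
    · rw [h2, ← h4]; gcongr
    · rw [h2]; nth_rewrite 2 [← h5]; gcongr
  · exact Filter.Eventually.of_forall fun L => ⟨hsub L, fun h => absurd h hξ⟩

/-- The square function over thin sectors in a quarter plane frame is bounded in `L⁴` with a constant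
polynomial in the logarithm of the number of sectors. -/
theorem exists_slope_square_function : ∃ C : ℝ, 0 ≤ C ∧
    ∀ (e e' : Plane) (n M : ℕ) (t : ℕ → ℝ), e ≠ 0 → (∀ m, e' - t m • e ≠ 0) → Monotone t →
      M ≤ 2 ^ n → (∀ m, 0 ≤ t m) → (∀ m < M, t m < 1) → (∀ m < M, 1 ≤ 2 ^ n * (t (m + 1) - t m)) →
      (∀ m < M, 2 ^ n * (t (m + 1) - t m) ≤ 7) → ∀ α : Plane → ℂ, Nice α → Nice (𝓕⁻ α) →
      ∫⁻ x, (∑ m ∈ Finset.range M, ‖𝓕⁻ ((slopeSector e e' t m).indicator α) x‖ₑ ^ 2) ^ 2 ≤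
      ENNReal.ofReal (C * (n + 1) ^ 10 * ∫ x, ‖𝓕⁻ α x‖ ^ 4) := by
  obtain ⟨C₁, hC₁, h₁⟩ := exists_dyadic_square_function
  obtain ⟨C₂, hC₂, h₂⟩ := exists_reverse_littlewood_paley
  refine ⟨C₂ * C₁, by positivity, fun e e' n M t he he' ht hM ht0 ht1 hg hg' α hα hF => ?_⟩
  set E : ℕ → ℕ → Set Plane := fun L m =>
    ⋃ j ∈ Finset.range (2 * L + 1), dyadicSector e e' t (2 ^ (-(L:ℤ))) j m with hE
  have hEm : ∀ L m, MeasurableSet (E L m) := fun L m =>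
    Finset.measurableSet_biUnion _ fun j _ => measurableSet_dyadicSector _ _ _ _ _ _
  have hbound : ∀ L, ∫⁻ x, (∑ m ∈ Finset.range M, ‖𝓕⁻ ((E L m).indicator α) x‖ₑ ^ 2) ^ 2 ≤
      ENNReal.ofReal (C₂ * C₁ * (n + 1) ^ 10 * ∫ x, ‖𝓕⁻ α x‖ ^ 4) := fun L => by
    rw [lintegral_sum_enorm_sq_sq _ fun m _ => hα.indicator (hEm L m)]
    refine ENNReal.ofReal_le_ofReal ?_
    have hN : ∀ j m, Nice ((dyadicSector e e' t (2 ^ (-(L:ℤ))) j m).indicator α) := fun j m =>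
      hα.indicator (measurableSet_dyadicSector _ _ _ _ _ _)
    have h3 := h₂ e (2 ^ (-(L:ℤ))) (2 * L + 1) M
      (fun j m => (dyadicSector e e' t (2 ^ (-(L:ℤ))) j m).indicator α) (by positivity) hN
      (fun j m ξ hξ => by
        have := mem_of_indicator_ne_zero hξ
        exact ⟨this.1, this.2.1⟩)
    have h4 := h₁ e e' n M (2 * L + 1) (2 ^ (-(L:ℤ))) t he he' ht hM ht0 ht1 hg hg' (by positivity) α hα hF
    have h5 : ∀ m x, 𝓕⁻ ((E L m).indicator α) x = ∑ k ∈ Finset.range (2 * L + 1),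
        𝓕⁻ ((dyadicSector e e' t (2 ^ (-(L:ℤ))) k m).indicator α) x := fun m x => by
      simp only [hE]
      rw [← sum_indicator_dyadicSector, Nice.fourierInv_sum _ fun k _ => hN k m, Finset.sum_apply]
    simp_rw [h5]
    refine h3.trans ?_
    rw [mul_assoc, mul_assoc, ← mul_assoc C₁]
    gcongr
  have hlim : ∀ x, Filter.Tendsto (fun L => (∑ m ∈ Finset.range M, ‖𝓕⁻ ((E L m).indicator α) x‖ₑ ^ 2) ^ 2)
      Filter.atTop (nhds ((∑ m ∈ Finset.range M, ‖𝓕⁻ ((slopeSector e e' t m).indicator α) x‖ₑ ^ 2) ^ 2)) :=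
    fun x => by
    refine ENNReal.Tendsto.pow (tendsto_finsetSum _ fun m _ => ENNReal.Tendsto.pow ?_)
    exact (tendsto_fourierInv_indicator hα (fun L => hEm L m)
      (eventually_mem_iUnion_dyadicSector e e' t m) x).enorm
  have hmeas : ∀ L, Measurable fun x => (∑ m ∈ Finset.range M, ‖𝓕⁻ ((E L m).indicator α) x‖ₑ ^ 2) ^ 2 := fun L =>
    (Finset.measurable_fun_sum _ fun m _ =>
      ((hα.indicator (hEm L m)).continuous_fourierInv.measurable.enorm.pow_const 2)).pow_const 2
  calc _ = ∫⁻ x, Filter.liminf (fun L => (∑ m ∈ Finset.range M, ‖𝓕⁻ ((E L m).indicator α) x‖ₑ ^ 2) ^ 2)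
        Filter.atTop := lintegral_congr fun x => (hlim x).liminf_eq.symm
    _ ≤ _ := lintegral_liminf_le hmeas
    _ ≤ _ := Filter.liminf_le_of_frequently_le' (Filter.Eventually.of_forall hbound).frequently

theorem argTwoPi_nonneg (ξ : Plane) : 0 ≤ argTwoPi ξ := by
  unfold argTwoPi
  simp only
  have h := Complex.neg_pi_lt_arg (((ξ 0 : ℝ) : ℂ) + (ξ 1 : ℝ) * Complex.I)
  split_ifs with h0
  · linarith [Real.pi_pos]
  · exact not_lt.1 h0

theorem argTwoPi_lt (ξ : Plane) : argTwoPi ξ < 2 * Real.pi := by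
  unfold argTwoPi
  simp only
  have h := Complex.arg_le_pi (((ξ 0 : ℝ) : ℂ) + (ξ 1 : ℝ) * Complex.I)
  split_ifs with h0
  · linarith [Real.pi_pos]
  · linarith [Real.pi_pos]

theorem exists_polar {ξ : Plane} (hξ : ξ ≠ 0) : ∃ r : ℝ, 0 < r ∧ ξ 0 = r * Real.cos (argTwoPi ξ) ∧
    ξ 1 = r * Real.sin (argTwoPi ξ) := by
  set z : ℂ := ((ξ 0 : ℝ) : ℂ) + (ξ 1 : ℝ) * Complex.I with hz
  have hre : z.re = ξ 0 := by simp [hz]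
  have him : z.im = ξ 1 := by simp [hz]
  have hz0 : z ≠ 0 := fun h => hξ (by
    ext i
    fin_cases i
    · simpa [h] using hre.symm
    · simpa [h] using him.symm)
  refine ⟨‖z‖, norm_pos_iff.2 hz0, ?_, ?_⟩
  · rw [← hre, ← Complex.norm_mul_cos_arg z]
    unfold argTwoPi
    simp only
    split_ifs
    · rw [Real.cos_add_two_pi]
    · rfl
  · rw [← him, ← Complex.norm_mul_sin_arg z]
    unfold argTwoPi
    simp only
    split_ifs
    · rw [Real.sin_add_two_pi]
    · rfl

/-- The unit vector at angle `φ`. -/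
def unitVec (φ : ℝ) : Plane := !₂[Real.cos φ, Real.sin φ]

/-- The unit vector at angle `φ + π / 2`. -/
def unitVecPerp (φ : ℝ) : Plane := !₂[-Real.sin φ, Real.cos φ]

theorem unitVec_ne_zero (φ : ℝ) : unitVec φ ≠ 0 := fun h => by
  have h0 : Real.cos φ = 0 := by simpa [unitVec] using congrArg (fun v : Plane => v 0) h
  have h1 : Real.sin φ = 0 := by simpa [unitVec] using congrArg (fun v : Plane => v 1) h
  simpa [h0, h1] using Real.sin_sq_add_cos_sq φ

theorem unitVecPerp_sub_smul_ne_zero (φ t : ℝ) : unitVecPerp φ - t • unitVec φ ≠ 0 := fun h => by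
  have h0 : -Real.sin φ - t * Real.cos φ = 0 := by
    simpa [unitVec, unitVecPerp] using congrArg (fun v : Plane => v 0) h
  have h1 : Real.cos φ - t * Real.sin φ = 0 := by
    simpa [unitVec, unitVecPerp] using congrArg (fun v : Plane => v 1) h
  have h2 : (1:ℝ) = 0 := by
    linear_combination Real.cos φ * h1 - Real.sin φ * h0 - Real.sin_sq_add_cos_sq φ
  exact one_ne_zero h2

theorem inner_unitVec_of_polar {ξ : Plane} {r θ : ℝ} (h0 : ξ 0 = r * Real.cos θ) (h1 : ξ 1 = r * Real.sin θ)
    (φ : ℝ) : inner ℝ ξ (unitVec φ) = r * Real.cos (θ - φ) := by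
  rw [Real.cos_sub]
  simp [unitVec, PiLp.inner_apply, Fin.sum_univ_two, h0, h1]
  ring

theorem inner_unitVecPerp_of_polar {ξ : Plane} {r θ : ℝ} (h0 : ξ 0 = r * Real.cos θ) (h1 : ξ 1 = r * Real.sin θ)
    (φ : ℝ) : inner ℝ ξ (unitVecPerp φ) = r * Real.sin (θ - φ) := by
  rw [Real.sin_sub]
  simp [unitVecPerp, PiLp.inner_apply, Fin.sum_univ_two, h0, h1]
  ring

theorem tan_mul_cos_le_sin_iff {a ψ : ℝ} (ha : 0 < Real.cos a) :
    Real.tan a * Real.cos ψ ≤ Real.sin ψ ↔ 0 ≤ Real.sin (ψ - a) := by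
  rw [Real.tan_eq_sin_div_cos, div_mul_eq_mul_div, div_le_iff₀ ha, Real.sin_sub]
  constructor <;> intro h <;> linarith

theorem sin_lt_tan_mul_cos_iff {a ψ : ℝ} (ha : 0 < Real.cos a) :
    Real.sin ψ < Real.tan a * Real.cos ψ ↔ Real.sin (ψ - a) < 0 := by
  rw [← not_le, tan_mul_cos_le_sin_iff ha, not_le]

theorem angle_window_iff {ψ a b : ℝ} (ha : 0 ≤ a) (hab : a < b) (hb : b ≤ Real.pi / 4)
    (hψ1 : -(7 * Real.pi / 4) ≤ ψ) (hψ2 : ψ < 2 * Real.pi) :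
    (a ≤ ψ ∧ ψ < b) ↔ 0 < Real.cos ψ ∧ Real.tan a * Real.cos ψ ≤ Real.sin ψ ∧
      Real.sin ψ < Real.tan b * Real.cos ψ := by
  have hpi := Real.pi_pos
  have hca : 0 < Real.cos a := Real.cos_pos_of_mem_Ioo ⟨by linarith, by linarith⟩
  have hcb : 0 < Real.cos b := Real.cos_pos_of_mem_Ioo ⟨by linarith, by linarith⟩
  rw [tan_mul_cos_le_sin_iff hca, sin_lt_tan_mul_cos_iff hcb]
  constructor
  · rintro ⟨h1, h2⟩
    exact ⟨Real.cos_pos_of_mem_Ioo ⟨by linarith, by linarith⟩,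
      Real.sin_nonneg_of_nonneg_of_le_pi (by linarith) (by linarith),
      Real.sin_neg_of_neg_of_neg_pi_lt (by linarith) (by linarith)⟩
  · rintro ⟨-, h1, h2⟩
    have hnn : ∀ x, -(2 * Real.pi) ≤ x → x ≤ -Real.pi → 0 ≤ Real.sin x := fun x hx1 hx2 => by
      rw [← Real.sin_add_two_pi]
      exact Real.sin_nonneg_of_nonneg_of_le_pi (by linarith) (by linarith)
    have hneg : ∀ x, Real.pi < x → x < 2 * Real.pi → Real.sin x < 0 := fun x hx1 hx2 => by
      rw [← Real.sin_sub_two_pi]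
      exact Real.sin_neg_of_neg_of_neg_pi_lt (by linarith) (by linarith)
    constructor
    · by_contra! h
      have h3 : ψ - a ≤ -Real.pi := by
        by_contra! h4
        exact absurd (Real.sin_neg_of_neg_of_neg_pi_lt (by linarith) h4) (not_lt.2 h1)
      exact absurd (hnn (ψ - b) (by linarith) (by linarith)) (not_le.2 h2)
    · by_contra! h
      have h3 : Real.pi < ψ - b := by
        by_contra! h4
        exact absurd (Real.sin_nonneg_of_nonneg_of_le_pi (by linarith) h4) (not_le.2 h2)
      exact absurd (hneg (ψ - a) (by linarith) (by linarith)) (not_lt.2 h1)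

/-- The slopes of the equiangular subdivision of an octant into `N` sectors. -/
def octantSlope (N m : ℕ) : ℝ := Real.tan (Real.pi / 4 * (min m N : ℕ) / N)

theorem octantSlope_arg_mem {N : ℕ} (hN : 0 < N) (m : ℕ) :
    0 ≤ Real.pi / 4 * (min m N : ℕ) / N ∧ Real.pi / 4 * (min m N : ℕ) / N ≤ Real.pi / 4 := by
  have hpi := Real.pi_pos
  have hN' : (0:ℝ) < N := by exact_mod_cast hN
  have h1 : ((min m N : ℕ) : ℝ) ≤ N := by exact_mod_cast min_le_right m N
  refine ⟨by positivity, ?_⟩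
  rw [div_le_iff₀ hN']
  gcongr

theorem tan_mono_octant {a b : ℝ} (ha : 0 ≤ a) (hab : a ≤ b) (hb : b ≤ Real.pi / 4) : Real.tan a ≤ Real.tan b := by
  have hpi := Real.pi_pos
  rcases hab.eq_or_lt with rfl | h
  · rfl
  · exact (Real.tan_lt_tan_of_lt_of_lt_pi_div_two (by linarith) (by linarith) h).le

theorem octantSlope_monotone {N : ℕ} (hN : 0 < N) : Monotone (octantSlope N) := fun m k h => by
  have hN' : (0:ℝ) < N := by exact_mod_cast hN
  refine tan_mono_octant (octantSlope_arg_mem hN m).1 ?_ (octantSlope_arg_mem hN k).2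
  have : ((min m N : ℕ) : ℝ) ≤ (min k N : ℕ) := by exact_mod_cast min_le_min_right N h
  have hpi := Real.pi_pos
  gcongr

theorem octantSlope_nonneg {N : ℕ} (hN : 0 < N) (m : ℕ) : 0 ≤ octantSlope N m := by
  have h := octantSlope_arg_mem hN m
  have hpi := Real.pi_pos
  exact Real.tan_nonneg_of_nonneg_of_le_pi_div_two h.1 (by linarith [h.2])

theorem octantSlope_lt_one {N m : ℕ} (hm : m < N) : octantSlope N m < 1 := by
  have hN : 0 < N := by omega
  have hN' : (0:ℝ) < N := by exact_mod_cast hN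
  have h := octantSlope_arg_mem hN m
  have hpi := Real.pi_pos
  rw [← Real.tan_pi_div_four]
  refine Real.tan_lt_tan_of_lt_of_lt_pi_div_two (by linarith) (by linarith) ?_
  rw [min_eq_left hm.le, div_lt_iff₀ hN']
  have : (m:ℝ) < N := by exact_mod_cast hm
  gcongr

theorem octantSlope_gap {N m : ℕ} (hm : m < N) : 1 / (2 * N) ≤ octantSlope N (m + 1) - octantSlope N m ∧
    octantSlope N (m + 1) - octantSlope N m ≤ Real.pi / (2 * N) := by
  have hN : 0 < N := by omega
  have hN' : (0:ℝ) < N := by exact_mod_cast hN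
  have hN1 : (1:ℝ) ≤ N := by exact_mod_cast hN
  have hpi := Real.pi_pos
  have ha := octantSlope_arg_mem hN m
  have hb := octantSlope_arg_mem hN (m + 1)
  unfold octantSlope
  rw [min_eq_left hm.le] at ha ⊢
  rw [min_eq_left (Nat.succ_le_of_lt hm)] at hb ⊢
  set a := Real.pi / 4 * (m:ℕ) / N with hadef
  set b := Real.pi / 4 * ((m + 1 : ℕ)) / N with hbdef
  have hba : b - a = Real.pi / (4 * N) := by
    rw [hadef, hbdef]; push_cast; field_simp; ring
  have hca : 0 < Real.cos a := Real.cos_pos_of_mem_Ioo ⟨by linarith, by linarith⟩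
  have hcb : 0 < Real.cos b := Real.cos_pos_of_mem_Ioo ⟨by linarith, by linarith⟩
  have heq : Real.tan b - Real.tan a = Real.sin (b - a) / (Real.cos a * Real.cos b) := by
    rw [Real.tan_eq_sin_div_cos, Real.tan_eq_sin_div_cos, Real.sin_sub]; field_simp
  have hd0 : 0 < b - a := by rw [hba]; positivity
  have hdle : b - a ≤ Real.pi / 2 := by linarith
  have hs1 := Real.mul_le_sin hd0.le hdle
  have hs2 := Real.sin_le hd0.le
  have hc1 : Real.sqrt 2 / 2 ≤ Real.cos a := by
    rw [← Real.cos_pi_div_four]; exact Real.cos_le_cos_of_nonneg_of_le_pi ha.1 (by linarith) ha.2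
  have hc2 : Real.sqrt 2 / 2 ≤ Real.cos b := by
    rw [← Real.cos_pi_div_four]; exact Real.cos_le_cos_of_nonneg_of_le_pi hb.1 (by linarith) hb.2
  have hcc : 1 / 2 ≤ Real.cos a * Real.cos b := by
    calc (1:ℝ) / 2 = Real.sqrt 2 / 2 * (Real.sqrt 2 / 2) := by
          have := Real.mul_self_sqrt (show (0:ℝ) ≤ 2 by norm_num); linarith
      _ ≤ _ := by gcongr
  have hcc1 : Real.cos a * Real.cos b ≤ 1 := mul_le_one₀ (Real.cos_le_one _) hcb.le (Real.cos_le_one _)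
  rw [heq]
  constructor
  · rw [le_div_iff₀ (by positivity)]
    have h1 : 2 / Real.pi * (b - a) = 1 / (2 * N) := by rw [hba]; field_simp; ring
    rw [h1] at hs1
    have : 0 ≤ 1 / (2 * (N:ℝ)) := by positivity
    nlinarith
  · rw [div_le_iff₀ (by positivity)]
    have h1 : Real.pi / (2 * N) = 2 * (b - a) := by rw [hba]; field_simp; ring
    rw [h1]
    nlinarith

/-- Equiangular sectors are slope sectors of the frame of their octant. -/
theorem equiangularSector_eq_slopeSector {N j m : ℕ} (hj : j < 8) (hm : m < N) :
    equiangularSector (8 * N) (j * N + m) =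
      slopeSector (unitVec (j * (Real.pi / 4))) (unitVecPerp (j * (Real.pi / 4))) (octantSlope N) m := by
  have hN : 0 < N := by omega
  have hN' : (0:ℝ) < N := by exact_mod_cast hN
  have hpi := Real.pi_pos
  have hb := octantSlope_arg_mem hN (m + 1)
  rw [min_eq_left (Nat.succ_le_of_lt hm)] at hb
  have hj' : (j:ℝ) ≤ 7 := by exact_mod_cast Nat.lt_succ_iff.1 hj
  have hj0 : (0:ℝ) ≤ j := Nat.cast_nonneg j
  ext ξ
  by_cases hξ : ξ = 0
  · subst hξ
    simp [equiangularSector, slopeSector]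
  obtain ⟨r, hr, h0, h1⟩ := exists_polar hξ
  set θ := argTwoPi ξ with hθ
  have hw := angle_window_iff (ψ := θ - j * (Real.pi / 4)) (a := Real.pi / 4 * (m:ℕ) / N)
    (b := Real.pi / 4 * ((m + 1 : ℕ)) / N) (by positivity) (by push_cast; gcongr; linarith) hb.2
    (by nlinarith [argTwoPi_nonneg ξ]) (by nlinarith [argTwoPi_lt ξ])
  have e1 : 2 * Real.pi * ((j * N + m : ℕ) : ℝ) / ((8 * N : ℕ) : ℝ) = j * (Real.pi / 4) + Real.pi / 4 * (m:ℕ) / N := by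
    push_cast; field_simp; ring
  have e2 : 2 * Real.pi * (((j * N + m : ℕ) : ℝ) + 1) / ((8 * N : ℕ) : ℝ) =
      j * (Real.pi / 4) + Real.pi / 4 * ((m + 1 : ℕ)) / N := by
    push_cast; field_simp; ring
  have hs : ξ ∈ equiangularSector (8 * N) (j * N + m) ↔
      (Real.pi / 4 * (m:ℕ) / N ≤ θ - j * (Real.pi / 4) ∧ θ - j * (Real.pi / 4) < Real.pi / 4 * ((m + 1 : ℕ)) / N) := by
    unfold equiangularSector
    rw [Set.mem_ofPred_eq, e1, e2, ← hθ]
    constructor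
    · rintro ⟨-, h2, h3⟩; exact ⟨by linarith, by linarith⟩
    · rintro ⟨h2, h3⟩; exact ⟨hξ, by linarith, by linarith⟩
  rw [hs, hw]
  unfold slopeSector octantSlope
  rw [Set.mem_ofPred_eq, inner_unitVec_of_polar h0 h1, inner_unitVecPerp_of_polar h0 h1, min_eq_left hm.le,
    min_eq_left (Nat.succ_le_of_lt hm), mul_pos_iff_of_pos_left hr, mul_left_comm, mul_le_mul_iff_right₀ hr,
    mul_left_comm, mul_lt_mul_iff_right₀ hr]

theorem measurable_argTwoPi : Measurable argTwoPi := by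
  unfold argTwoPi
  have h : Measurable fun ξ : EuclideanSpace ℝ (Fin 2) =>
      Complex.arg (((ξ 0 : ℝ) : ℂ) + (ξ 1 : ℝ) * Complex.I) := by
    refine Complex.measurable_arg.comp (Continuous.measurable ?_)
    fun_prop
  exact Measurable.ite (measurableSet_lt h measurable_const) (h.add_const _) h

theorem measurableSet_equiangularSector (N m : ℕ) : MeasurableSet (equiangularSector N m) := by
  unfold equiangularSector
  have h1 : MeasurableSet {ξ : EuclideanSpace ℝ (Fin 2) | ξ ≠ 0} := (measurableSet_singleton 0).compl
  have h2 : MeasurableSet {ξ | 2 * Real.pi * m / N ≤ argTwoPi ξ} :=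
    measurableSet_le measurable_const measurable_argTwoPi
  have h3 : MeasurableSet {ξ | argTwoPi ξ < 2 * Real.pi * (m + 1) / N} :=
    measurableSet_lt measurable_argTwoPi measurable_const
  exact h1.inter (h2.inter h3)

theorem mem_equiangularSector_iff {N : ℕ} (hN : 0 < N) (m : ℕ) (ξ : Plane) :
    ξ ∈ equiangularSector N m ↔ ξ ≠ 0 ∧ ⌊N * argTwoPi ξ / (2 * Real.pi)⌋₊ = m := by
  have hN' : (0:ℝ) < N := by exact_mod_cast hN
  have hpi := Real.pi_pos
  have h0 := argTwoPi_nonneg ξ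
  unfold equiangularSector
  rw [Set.mem_ofPred_eq, Nat.floor_eq_iff (by positivity), div_le_iff₀ hN', lt_div_iff₀ hN',
    le_div_iff₀ (by positivity), div_lt_iff₀ (by positivity)]
  refine and_congr_right fun _ => and_congr ?_ ?_ <;> constructor <;> intro h <;> linarith

theorem sum_indicator_equiangularSector {N : ℕ} (hN : 0 < N) (m : ℕ) (α : Plane → ℂ) :
    (equiangularSector N m).indicator α =
      ∑ j ∈ Finset.range 8, (equiangularSector (8 * N) (m * 8 + j)).indicator α := by
  classical
  ext ξ
  rw [Finset.sum_apply]
  simp only [Set.indicator_apply, mem_equiangularSector_iff hN,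
    mem_equiangularSector_iff (show 0 < 8 * N by omega)]
  set q := ⌊((8 * N : ℕ) : ℝ) * argTwoPi ξ / (2 * Real.pi)⌋₊ with hq
  have h1 : ⌊N * argTwoPi ξ / (2 * Real.pi)⌋₊ = q / 8 := by
    rw [hq, ← Nat.floor_div_natCast]
    congr 1
    push_cast
    ring
  rw [h1]
  by_cases hξ : ξ = 0
  · simp [hξ]
  simp only [ne_eq, hξ, not_false_eq_true, true_and]
  by_cases hm : q / 8 = m
  · rw [if_pos hm, Finset.sum_eq_single (q % 8), if_pos (by omega)]
    · intro j _ hj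
      rw [if_neg (by omega)]
    · intro h
      exact absurd (Finset.mem_range.2 (Nat.mod_lt _ (by norm_num))) h
  · rw [if_neg hm, Finset.sum_eq_zero]
    intro j hj
    have := Finset.mem_range.1 hj
    rw [if_neg (by omega)]

theorem sum_range_mul_eq {R : Type*} [AddCommMonoid R] (f : ℕ → R) (a b : ℕ) :
    ∑ k ∈ Finset.range (a * b), f k = ∑ i ∈ Finset.range a, ∑ l ∈ Finset.range b, f (i * b + l) := by
  induction a with
  | zero => simp
  | succ a ih => rw [Nat.succ_mul, Finset.sum_range_add, ih, Finset.sum_range_succ]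

theorem ennreal_sq_sum_le {ι : Type*} (s : Finset ι) (f : ι → ℝ≥0∞) :
    (∑ i ∈ s, f i) ^ 2 ≤ s.card * ∑ i ∈ s, f i ^ 2 := by
  have h := ENNReal.inner_le_Lp_mul_Lq s (fun _ => 1) f Real.HolderConjugate.two_two
  have h2 := ENNReal.rpow_le_rpow (z := 2) h (by norm_num)
  rw [ENNReal.mul_rpow_of_nonneg _ _ (by norm_num), ← ENNReal.rpow_mul, ← ENNReal.rpow_mul] at h2
  norm_num at h2
  simpa using h2

theorem sum_enorm_sq_sector_le {N : ℕ} (hN : 0 < N) {α : Plane → ℂ} (hα : Nice α) (x : Plane) :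
    ∑ m ∈ Finset.range N, ‖𝓕⁻ ((equiangularSector N m).indicator α) x‖ₑ ^ 2 ≤
      8 * ∑ j ∈ Finset.range 8, ∑ m ∈ Finset.range N,
        ‖𝓕⁻ ((equiangularSector (8 * N) (j * N + m)).indicator α) x‖ₑ ^ 2 := by
  rw [← sum_range_mul_eq (fun k => ‖𝓕⁻ ((equiangularSector (8 * N) k).indicator α) x‖ₑ ^ 2), mul_comm 8 N,
    sum_range_mul_eq, Finset.mul_sum]
  refine Finset.sum_le_sum fun m _ => ?_
  rw [sum_indicator_equiangularSector hN, Nice.fourierInv_sum _ fun j _ =>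
    hα.indicator (measurableSet_equiangularSector _ _), Finset.sum_apply, mul_comm N 8]
  calc _ ≤ (∑ j ∈ Finset.range 8, ‖𝓕⁻ ((equiangularSector (8 * N) (m * 8 + j)).indicator α) x‖ₑ) ^ 2 := by
        gcongr; exact enorm_sum_le _ _
    _ ≤ _ := (ennreal_sq_sum_le _ _).trans_eq (by simp)

/-- The `L⁴` bound for the sectorial square function. -/
theorem exists_sector_square_function_four : ∃ C : ℝ, 0 ≤ C ∧ ∀ (N n : ℕ), 0 < N → 2 * N ≤ 2 ^ n →
    2 ^ n ≤ 4 * N → ∀ α : Plane → ℂ, Nice α → Nice (𝓕⁻ α) →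
      ∫⁻ x, (∑ m ∈ Finset.range N, ‖𝓕⁻ ((equiangularSector N m).indicator α) x‖ₑ ^ 2) ^ 2 ≤
        ENNReal.ofReal (C * (n + 1) ^ 10 * ∫ x, ‖𝓕⁻ α x‖ ^ 4) := by
  obtain ⟨C, hC0, hC⟩ := exists_slope_square_function
  refine ⟨4096 * C, by positivity, fun N n hN hn1 hn2 α hα hF => ?_⟩
  have hN' : (0:ℝ) < N := by exact_mod_cast hN
  have hn1' : 2 * (N:ℝ) ≤ 2 ^ n := by exact_mod_cast hn1
  have hn2' : (2:ℝ) ^ n ≤ 4 * N := by exact_mod_cast hn2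
  have hoct : ∀ j ∈ Finset.range 8, ∫⁻ x, (∑ m ∈ Finset.range N,
      ‖𝓕⁻ ((equiangularSector (8 * N) (j * N + m)).indicator α) x‖ₑ ^ 2) ^ 2 ≤
      ENNReal.ofReal (C * (n + 1) ^ 10 * ∫ x, ‖𝓕⁻ α x‖ ^ 4) := fun j hj => by
    refine le_trans (le_of_eq ?_) (hC (unitVec (j * (Real.pi / 4))) (unitVecPerp (j * (Real.pi / 4))) n N
      (octantSlope N) (unitVec_ne_zero _) (fun m => unitVecPerp_sub_smul_ne_zero _ _) (octantSlope_monotone hN)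
      (by omega) (octantSlope_nonneg hN) (fun m hm => octantSlope_lt_one hm) (fun m hm => ?_) (fun m hm => ?_)
      α hα hF)
    · refine lintegral_congr fun x => ?_
      congr 1
      refine Finset.sum_congr rfl fun m hm => ?_
      rw [equiangularSector_eq_slopeSector (Finset.mem_range.1 hj) (Finset.mem_range.1 hm)]
    · calc (1:ℝ) = 2 * N * (1 / (2 * N)) := by field_simp
        _ ≤ _ := by
          gcongr
          exact (octantSlope_gap hm).1
    · calc (2:ℝ) ^ n * (octantSlope N (m + 1) - octantSlope N m) ≤ 4 * N * (Real.pi / (2 * N)) := by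
            refine mul_le_mul hn2' (octantSlope_gap hm).2 ?_ (by positivity)
            exact sub_nonneg.2 (octantSlope_monotone hN (Nat.le_succ m))
        _ = 2 * Real.pi := by field_simp; ring
        _ ≤ 7 := by linarith [Real.pi_lt_d2]
  have hmeas : ∀ k, Measurable fun x => ‖𝓕⁻ ((equiangularSector (8 * N) k).indicator α) x‖ₑ ^ 2 := fun k =>
    ((hα.indicator (measurableSet_equiangularSector _ _)).continuous_fourierInv.measurable.enorm.pow_const 2)
  have hmeas2 : ∀ j, Measurable fun x => (∑ m ∈ Finset.range N,
      ‖𝓕⁻ ((equiangularSector (8 * N) (j * N + m)).indicator α) x‖ₑ ^ 2) ^ 2 := fun j =>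
    (Finset.measurable_fun_sum _ fun m _ => hmeas _).pow_const 2
  calc _ ≤ ∫⁻ x, 512 * ∑ j ∈ Finset.range 8, (∑ m ∈ Finset.range N,
      ‖𝓕⁻ ((equiangularSector (8 * N) (j * N + m)).indicator α) x‖ₑ ^ 2) ^ 2 := by
        refine lintegral_mono fun x => ?_
        calc _ ≤ (8 * ∑ j ∈ Finset.range 8, ∑ m ∈ Finset.range N,
              ‖𝓕⁻ ((equiangularSector (8 * N) (j * N + m)).indicator α) x‖ₑ ^ 2) ^ 2 := by
              gcongr; exact sum_enorm_sq_sector_le hN hα x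
          _ = 64 * (∑ j ∈ Finset.range 8, ∑ m ∈ Finset.range N,
              ‖𝓕⁻ ((equiangularSector (8 * N) (j * N + m)).indicator α) x‖ₑ ^ 2) ^ 2 := by
              rw [mul_pow]; norm_num
          _ ≤ 64 * (8 * _) := by
              gcongr
              exact (ennreal_sq_sum_le _ _).trans_eq (by rw [Finset.card_range]; rfl)
          _ = _ := by rw [← mul_assoc]; norm_num
    _ = 512 * ∑ j ∈ Finset.range 8, ∫⁻ x, (∑ m ∈ Finset.range N,
      ‖𝓕⁻ ((equiangularSector (8 * N) (j * N + m)).indicator α) x‖ₑ ^ 2) ^ 2 := by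
        rw [lintegral_const_mul _ (Finset.measurable_fun_sum _ fun j _ => hmeas2 j),
          lintegral_finsetSum _ fun j _ => hmeas2 j]
    _ ≤ 512 * ∑ j ∈ Finset.range 8, ENNReal.ofReal (C * (n + 1) ^ 10 * ∫ x, ‖𝓕⁻ α x‖ ^ 4) := by
        gcongr with j hj
        exact hoct j hj
    _ = _ := by
        rw [Finset.sum_const, Finset.card_range, nsmul_eq_mul, ← mul_assoc, mul_assoc 4096, mul_assoc 4096,
          ENNReal.ofReal_mul (p := 4096) (by norm_num)]
        congr 1
        norm_num

/-- The `L²` bound for the sectorial square function. -/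
theorem lintegral_sector_square_function_le {N : ℕ} (hN : 0 < N) {α : Plane → ℂ} (hα : Nice α) :
    ∫⁻ x, ∑ m ∈ Finset.range N, ‖𝓕⁻ ((equiangularSector N m).indicator α) x‖ₑ ^ 2 ≤
      ENNReal.ofReal (∫ x, ‖𝓕⁻ α x‖ ^ 2) := by
  have hn : ∀ m, Nice ((equiangularSector N m).indicator α) := fun m =>
    hα.indicator (measurableSet_equiangularSector _ _)
  rw [lintegral_finsetSum _ fun m _ => (hn m).continuous_fourierInv.measurable.enorm.pow_const 2]
  simp_rw [fun m => lintegral_enorm_sq_eq (hn m).memLp_two_fourierInv, fun m => (hn m).plancherel_sq]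
  rw [← ENNReal.ofReal_sum_of_nonneg fun m _ => integral_nonneg fun ξ => sq_nonneg _, hα.plancherel_sq,
    ← integral_finsetSum _ fun m _ => (hn m).integrable_norm_sq]
  refine ENNReal.ofReal_le_ofReal (integral_mono
    (integrable_finsetSum _ fun m _ => (hn m).integrable_norm_sq) hα.integrable_norm_sq fun ξ => ?_)
  simp only
  set q := ⌊N * argTwoPi ξ / (2 * Real.pi)⌋₊ with hq
  calc ∑ m ∈ Finset.range N, ‖(equiangularSector N m).indicator α ξ‖ ^ 2
      ≤ ∑ m ∈ Finset.range N, if m = q then ‖α ξ‖ ^ 2 else 0 := by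
        refine Finset.sum_le_sum fun m _ => ?_
        by_cases h : ξ ∈ equiangularSector N m
        · rw [indicator_of_mem h, if_pos ((mem_equiangularSector_iff hN m ξ).1 h).2.symm]
        · rw [indicator_of_notMem h]
          split_ifs <;> simp
    _ ≤ ‖α ξ‖ ^ 2 := by
        rw [Finset.sum_ite_eq']
        split_ifs
        · rfl
        · positivity

theorem lintegral_Ioi_ite_lt_rpow {a y : ℝ} (ha : -1 < a) (hy : 0 ≤ y) :
    ∫⁻ t in Ioi (0 : ℝ), (if t < y then ENNReal.ofReal (t ^ a) else 0) =
      ENNReal.ofReal (y ^ (a + 1) / (a + 1)) := by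
  have h1 : ∀ t : ℝ, (if t < y then ENNReal.ofReal (t ^ a) else 0) =
      (Iio y).indicator (fun t => ENNReal.ofReal (t ^ a)) t := fun t => by
    simp [Set.indicator_apply]
  simp_rw [h1]
  rw [lintegral_indicator measurableSet_Iio, Measure.restrict_restrict measurableSet_Iio,
    Iio_inter_Ioi, restrict_Ioo_eq_restrict_Ioc]
  have hint : IntervalIntegrable (fun t : ℝ => t ^ a) volume 0 y :=
    intervalIntegral.intervalIntegrable_rpow' ha
  rw [← ofReal_integral_eq_lintegral_ofReal
    ((intervalIntegrable_iff_integrableOn_Ioc_of_le hy).1 hint),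
    ← intervalIntegral.integral_of_le hy, integral_rpow (Or.inl ha),
    Real.zero_rpow (by linarith), sub_zero]
  exact (ae_restrict_iff' measurableSet_Ioc).2 (.of_forall fun t ht => Real.rpow_nonneg ht.1.le _)

theorem lintegral_Ioi_ite_le_rpow {a y : ℝ} (ha : a < -1) (hy : 0 < y) :
    ∫⁻ t in Ioi (0 : ℝ), (if y ≤ t then ENNReal.ofReal (t ^ a) else 0) =
      ENNReal.ofReal (-y ^ (a + 1) / (a + 1)) := by
  have h1 : ∀ t : ℝ, (if y ≤ t then ENNReal.ofReal (t ^ a) else 0) =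
      (Ici y).indicator (fun t => ENNReal.ofReal (t ^ a)) t := fun t => by
    simp [Set.indicator_apply]
  simp_rw [h1]
  rw [lintegral_indicator measurableSet_Ici, Measure.restrict_restrict measurableSet_Ici,
    (inter_eq_left.2 fun t ht => lt_of_lt_of_le hy ht : Ici y ∩ Ioi (0 : ℝ) = Ici y), ← restrict_Ioi_eq_restrict_Ici]
  rw [← ofReal_integral_eq_lintegral_ofReal (integrableOn_Ioi_rpow_of_lt ha hy),
    integral_Ioi_rpow_of_lt ha hy]
  exact (ae_restrict_iff' measurableSet_Ioi).2
    (.of_forall fun t ht => Real.rpow_nonneg (hy.trans ht).le _)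

/-- Marcinkiewicz interpolation between the exponents `2` and `4`, for a function whose
distribution function is controlled by truncations of another one. -/
theorem lintegral_rpow_le_of_distribution {p A : ℝ} (hp2 : 2 < p) (hp4 : p < 4) (hA : 0 ≤ A)
    {F S : Plane → ℝ} (hF : Measurable F) (hS : Measurable S) (hF0 : ∀ x, 0 ≤ F x)
    (hS0 : ∀ x, 0 ≤ S x)
    (h : ∀ t : ℝ, 0 < t → volume {x | t < S x} ≤
      ENNReal.ofReal (4 * t ^ (-2 : ℝ)) *
          (∫⁻ x, if t < F x then ENNReal.ofReal (F x ^ 2) else 0) +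
        ENNReal.ofReal (16 * A * t ^ (-4 : ℝ)) *
          ∫⁻ x, if F x / 2 ≤ t then ENNReal.ofReal (F x ^ 4) else 0) :
    ∫⁻ x, ENNReal.ofReal (S x ^ p) ≤
      ENNReal.ofReal (p * (4 / (p - 2) + 64 * A / (4 - p))) *
        ∫⁻ x, ENNReal.ofReal (F x ^ p) := by
  have hmF : Measurable fun q : ℝ × Plane => F q.2 := hF.comp measurable_snd
  rw [lintegral_rpow_eq_lintegral_meas_lt_mul volume (.of_forall hS0) hS.aemeasurable
    (by linarith)]
  have e1 : ∫⁻ t in Ioi (0 : ℝ), ∫⁻ x : Plane, (if t < F x then ENNReal.ofReal (t ^ (p - 3)) else 0) *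
      ENNReal.ofReal (4 * F x ^ 2) =
      ENNReal.ofReal (4 / (p - 2)) * ∫⁻ x, ENNReal.ofReal (F x ^ p) := by
    rw [lintegral_lintegral_swap, ← lintegral_const_mul' _ _ ENNReal.ofReal_ne_top]
    · refine lintegral_congr fun x => ?_
      rw [lintegral_mul_const' _ _ ENNReal.ofReal_ne_top,
        lintegral_Ioi_ite_lt_rpow (by linarith) (hF0 x), ← ENNReal.ofReal_mul
          (div_nonneg (Real.rpow_nonneg (hF0 x) _) (by linarith)),
        ← ENNReal.ofReal_mul (div_nonneg (by norm_num) (by linarith))]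
      congr 1
      have : F x ^ p = F x ^ (p - 3 + 1) * F x ^ 2 := by
        rw [← Real.rpow_natCast, ← Real.rpow_add_of_nonneg (hF0 x) (by linarith) (by norm_num)]
        congr 1; push_cast; ring
      rw [this]
      have : p - 2 ≠ 0 := by linarith
      rw [show p - 3 + 1 = p - 2 by ring]
      field_simp
    · refine Measurable.aemeasurable ?_
      refine Measurable.mul (Measurable.ite (measurableSet_lt measurable_fst hmF) ?_
        measurable_const) ?_
      · exact (measurable_fst.pow_const _).ennreal_ofReal
      · exact ((hmF.pow_const _).const_mul _).ennreal_ofReal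
  have e2 : ∫⁻ t in Ioi (0 : ℝ), ∫⁻ x : Plane,
      (if F x / 2 ≤ t then ENNReal.ofReal (t ^ (p - 5)) else 0) *
      ENNReal.ofReal (16 * A * F x ^ 4) ≤
      ENNReal.ofReal (64 * A / (4 - p)) * ∫⁻ x, ENNReal.ofReal (F x ^ p) := by
    rw [lintegral_lintegral_swap, ← lintegral_const_mul' _ _ ENNReal.ofReal_ne_top]
    · refine lintegral_mono fun x => ?_
      rw [lintegral_mul_const' _ _ ENNReal.ofReal_ne_top]
      rcases (hF0 x).eq_or_lt with h0 | h0
      · simp [← h0]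
      have hc : (0 : ℝ) < 4 - p := by linarith
      rw [lintegral_Ioi_ite_le_rpow (by linarith) (half_pos h0), ← ENNReal.ofReal_mul,
        ← ENNReal.ofReal_mul (by positivity)]
      · refine ENNReal.ofReal_le_ofReal ?_
        have e : F x ^ p = F x ^ (p - 4) * F x ^ 4 := by
          rw [← Real.rpow_natCast, ← Real.rpow_add h0]
          congr 1; push_cast; ring
        rw [show p - 5 + 1 = -(4 - p) by ring, e, Real.div_rpow h0.le (by norm_num), neg_div_neg_eq,
          Real.rpow_neg (by norm_num : (0:ℝ) ≤ 2), show -(4 - p) = p - 4 by ring]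
        have h2 : (2 : ℝ) ^ (4 - p) ≤ 4 := by
          calc (2 : ℝ) ^ (4 - p) ≤ 2 ^ (2 : ℝ) :=
                Real.rpow_le_rpow_of_exponent_le (by norm_num) (by linarith)
            _ = 4 := by norm_num
        have h3 : (0 : ℝ) < F x ^ (p - 4) := Real.rpow_pos_of_pos h0 _
        calc F x ^ (p - 4) / ((2 : ℝ) ^ (4 - p))⁻¹ / (4 - p) * (16 * A * F x ^ 4)
            = (2 : ℝ) ^ (4 - p) * (16 * A / (4 - p) * (F x ^ (p - 4) * F x ^ 4)) := by
              field_simp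
          _ ≤ 4 * (16 * A / (4 - p) * (F x ^ (p - 4) * F x ^ 4)) := by gcongr
          _ = _ := by ring
      · rw [show p - 5 + 1 = -(4 - p) by ring, neg_div_neg_eq]
        positivity
    · refine Measurable.aemeasurable ?_
      refine Measurable.mul (Measurable.ite (measurableSet_le (hmF.div_const _) measurable_fst) ?_
        measurable_const) ?_
      · exact (measurable_fst.pow_const _).ennreal_ofReal
      · exact ((hmF.pow_const _).const_mul _).ennreal_ofReal
  rw [ENNReal.ofReal_mul (by linarith), mul_assoc]
  gcongr
  rw [ENNReal.ofReal_add (div_nonneg (by norm_num) (by linarith))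
    (div_nonneg (by positivity) (by linarith)), add_mul]
  refine le_trans ?_ (add_le_add e1.le e2)
  rw [← lintegral_add_left]
  · refine setLIntegral_mono' measurableSet_Ioi fun t ht => ?_
    have ht : 0 < t := ht
    refine (mul_le_mul_left (h t ht) _).trans (le_of_eq ?_)
    rw [add_mul]
    congr 1
    · rw [mul_right_comm, ← ENNReal.ofReal_mul (by positivity), ← lintegral_const_mul' _ _
        ENNReal.ofReal_ne_top]
      refine lintegral_congr fun x => ?_
      split_ifs
      · rw [← ENNReal.ofReal_mul (by positivity), ← ENNReal.ofReal_mul (by positivity), mul_assoc 4,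
          ← Real.rpow_add ht, show -2 + (p - 1) = p - 3 by ring]
        congr 1; ring
      · simp
    · rw [mul_right_comm, ← ENNReal.ofReal_mul (by positivity), ← lintegral_const_mul' _ _
        ENNReal.ofReal_ne_top]
      refine lintegral_congr fun x => ?_
      split_ifs
      · rw [← ENNReal.ofReal_mul (by positivity), ← ENNReal.ofReal_mul (by positivity),
          mul_assoc (16 * A), ← Real.rpow_add ht, show -4 + (p - 1) = p - 5 by ring]
        congr 1; ring
      · simp
  · refine Measurable.lintegral_prod_right' (f := fun q : ℝ × Plane =>
      (if q.1 < F q.2 then ENNReal.ofReal (q.1 ^ (p - 3)) else 0) * ENNReal.ofReal (4 * F q.2 ^ 2)) ?_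
    refine Measurable.mul (Measurable.ite (measurableSet_lt measurable_fst hmF) ?_
        measurable_const) ?_
    · exact (measurable_fst.pow_const _).ennreal_ofReal
    · exact ((hmF.pow_const _).const_mul _).ennreal_ofReal

theorem exists_schwartz_truncation (f : 𝓢(Plane, ℂ)) {t : ℝ} (ht : 0 < t) :
    ∃ g : 𝓢(Plane, ℂ), (∀ x, ‖g x‖ ≤ ‖f x‖) ∧ (∀ x, ‖(f - g) x‖ ≤ ‖f x‖) ∧
      (∀ x, ‖f x‖ ≤ t → g x = 0) ∧ ∀ x, 2 * t < ‖f x‖ → (f - g) x = 0 := by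
  set w : Plane → ℝ := fun x => Real.smoothTransition (‖f x‖ ^ 2 / t ^ 2 - 1) with hw
  have hzero : ∀ x, ‖f x‖ ≤ t → w x = 0 := fun x hx => by
    refine Real.smoothTransition.zero_of_nonpos ?_
    rw [sub_nonpos, div_le_one (by positivity)]
    gcongr
  have hone : ∀ x, 2 * t < ‖f x‖ → w x = 1 := fun x hx => by
    refine Real.smoothTransition.one_of_one_le ?_
    have : 2 ≤ ‖f x‖ ^ 2 / t ^ 2 := by
      rw [le_div_iff₀ (by positivity)]
      nlinarith
    linarith
  have hw0 : ∀ x, 0 ≤ w x := fun x => Real.smoothTransition.nonneg _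
  have hw1 : ∀ x, w x ≤ 1 := fun x => Real.smoothTransition.le_one _
  have hsm : ContDiff ℝ ∞ fun x => (w x : ℂ) * f x := by
    have hf : ContDiff ℝ ∞ (f : Plane → ℂ) := f.smooth ⊤
    have h1 : ContDiff ℝ ∞ w := by
      refine Real.smoothTransition.contDiff.comp ?_
      exact ((hf.norm_sq ℝ).div_const _).sub contDiff_const
    exact (Complex.ofRealCLM.contDiff.comp h1).mul hf
  have hcs : HasCompactSupport fun x => (w x : ℂ) * f x := by
    have hev : ∀ᶠ x in Filter.cocompact Plane, ‖f x‖ < t := by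
      have h0 : Filter.Tendsto (fun x => ‖f x‖) (Filter.cocompact Plane) (nhds 0) := by
        simpa using (zero_at_infty f).norm
      exact h0.eventually (gt_mem_nhds ht)
    obtain ⟨K, hK, hKt⟩ := Filter.mem_cocompact.1 hev
    refine HasCompactSupport.intro hK fun x hx => ?_
    rw [hzero x (le_of_lt (hKt hx))]
    simp
  have hg : ∀ x, (hcs.toSchwartzMap hsm) x = (w x : ℂ) * f x := fun x => rfl
  have hfg : ∀ x, (f - hcs.toSchwartzMap hsm) x = ((1 - w x : ℝ) : ℂ) * f x := fun x => by
    rw [sub_apply, hg]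
    push_cast
    ring
  refine ⟨hcs.toSchwartzMap hsm, fun x => ?_, fun x => ?_, fun x hx => ?_, fun x hx => ?_⟩
  · rw [hg, norm_mul, Complex.norm_real, Real.norm_of_nonneg (hw0 x)]
    exact mul_le_of_le_one_left (norm_nonneg _) (hw1 x)
  · rw [hfg, norm_mul, Complex.norm_real, Real.norm_of_nonneg (by linarith [hw1 x])]
    exact mul_le_of_le_one_left (norm_nonneg _) (by linarith [hw0 x])
  · rw [hg, hzero x hx]
    simp
  · rw [hfg, hone x hx]
    simp

theorem nice_schwartz (f : 𝓢(Plane, ℂ)) : Nice (f : Plane → ℂ) :=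
  ⟨f.integrable, _, fun x => f.norm_le_seminorm ℝ x⟩

theorem nice_fourier_schwartz (f : 𝓢(Plane, ℂ)) : Nice (𝓕 (f : Plane → ℂ)) := by
  rw [← SchwartzMap.fourier_coe]
  exact nice_schwartz _

theorem fourierInv_fourier_schwartz (f : 𝓢(Plane, ℂ)) :
    𝓕⁻ (𝓕 (f : Plane → ℂ)) = f := by
  rw [← SchwartzMap.fourier_coe, ← SchwartzMap.fourierInv_coe, FourierTransform.fourierInv_fourier_eq]

theorem fourier_sub_schwartz (f g : 𝓢(Plane, ℂ)) :
    𝓕 ((f - g : 𝓢(Plane, ℂ)) : Plane → ℂ) = 𝓕 (f : Plane → ℂ) - 𝓕 (g : Plane → ℂ) := by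
  rw [← SchwartzMap.fourier_coe, ← SchwartzMap.fourier_coe, ← SchwartzMap.fourier_coe,
    sub_eq_add_neg, FourierTransform.fourier_add, FourierTransform.fourier_neg, ← sub_eq_add_neg]
  rfl

/-- The square of the sectorial square function. -/
def sectorSq (N : ℕ) (f : 𝓢(Plane, ℂ)) (x : Plane) : ℝ :=
  ∑ m ∈ Finset.range N, ‖freqProj2 (equiangularSector N m) f x‖ ^ 2

theorem nice_indicator_fourier_schwartz (N m : ℕ) (f : 𝓢(Plane, ℂ)) :
    Nice ((equiangularSector N m).indicator (𝓕 (f : Plane → ℂ))) :=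
  (nice_fourier_schwartz f).indicator (measurableSet_equiangularSector N m)

theorem sectorSq_nonneg (N : ℕ) (f : 𝓢(Plane, ℂ)) (x : Plane) : 0 ≤ sectorSq N f x :=
  Finset.sum_nonneg fun _ _ => by positivity

theorem continuous_sectorSq (N : ℕ) (f : 𝓢(Plane, ℂ)) : Continuous (sectorSq N f) :=
  continuous_finsetSum _ fun m _ =>
    ((nice_indicator_fourier_schwartz N m f).continuous_fourierInv.norm.pow 2)

theorem ofReal_sectorSq (N : ℕ) (f : 𝓢(Plane, ℂ)) (x : Plane) :
    ENNReal.ofReal (sectorSq N f x) = ∑ m ∈ Finset.range N,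
      ‖𝓕⁻ ((equiangularSector N m).indicator (𝓕 (f : Plane → ℂ))) x‖ₑ ^ 2 :=
  ofReal_sum_norm_sq _ _

theorem sectorSq_le_add (N : ℕ) (f g : 𝓢(Plane, ℂ)) (x : Plane) :
    sectorSq N f x ≤ 2 * sectorSq N g x + 2 * sectorSq N (f - g) x := by
  unfold sectorSq
  rw [Finset.mul_sum, Finset.mul_sum, ← Finset.sum_add_distrib]
  refine Finset.sum_le_sum fun m _ => ?_
  have e : freqProj2 (equiangularSector N m) (f - g : 𝓢(Plane, ℂ)) x =
      freqProj2 (equiangularSector N m) f x - freqProj2 (equiangularSector N m) g x := by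
    unfold freqProj2
    rw [fourier_sub_schwartz, Set.indicator_sub',
      Nice.fourierInv_sub (nice_indicator_fourier_schwartz N m f)
        (nice_indicator_fourier_schwartz N m g), Pi.sub_apply]
  rw [e]
  set a := freqProj2 (equiangularSector N m) f x
  set b := freqProj2 (equiangularSector N m) g x
  have h1 : ‖a‖ ≤ ‖b‖ + ‖a - b‖ := by simpa using norm_add_le b (a - b)
  nlinarith [norm_nonneg a, norm_nonneg b, norm_nonneg (a - b), sq_nonneg (‖b‖ - ‖a - b‖)]

theorem ofReal_integral_norm_pow (f : 𝓢(Plane, ℂ)) {k : ℕ} (hk : 1 ≤ k) :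
    ENNReal.ofReal (∫ x, ‖f x‖ ^ k) = ∫⁻ x, ENNReal.ofReal (‖f x‖ ^ k) := by
  refine ofReal_integral_eq_lintegral_ofReal ?_ (.of_forall fun x => by positivity)
  have h : MemLp (f : Plane → ℂ) k volume := f.memLp k volume
  exact h.integrable_norm_pow (by omega)

theorem lintegral_sectorSq_le {N : ℕ} (hN : 0 < N) (f : 𝓢(Plane, ℂ)) :
    ∫⁻ x, ENNReal.ofReal (sectorSq N f x) ≤ ∫⁻ x, ENNReal.ofReal (‖f x‖ ^ 2) := by
  simp_rw [ofReal_sectorSq]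
  refine (lintegral_sector_square_function_le hN (nice_fourier_schwartz f)).trans ?_
  rw [fourierInv_fourier_schwartz, ofReal_integral_norm_pow f (by norm_num)]

theorem exists_lintegral_sectorSq_sq_le : ∃ C : ℝ, 0 ≤ C ∧ ∀ (N n : ℕ), 0 < N → 2 * N ≤ 2 ^ n →
    2 ^ n ≤ 4 * N → ∀ f : 𝓢(Plane, ℂ), ∫⁻ x, ENNReal.ofReal (sectorSq N f x) ^ 2 ≤
      ENNReal.ofReal (C * (n + 1) ^ 10) * ∫⁻ x, ENNReal.ofReal (‖f x‖ ^ 4) := by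
  obtain ⟨C, hC, h⟩ := exists_sector_square_function_four
  refine ⟨C, hC, fun N n hN h1 h2 f => ?_⟩
  simp_rw [ofReal_sectorSq]
  refine (h N n hN h1 h2 _ (nice_fourier_schwartz f) ?_).trans ?_
  · rw [fourierInv_fourier_schwartz]
    exact nice_schwartz f
  · rw [fourierInv_fourier_schwartz, ENNReal.ofReal_mul (by positivity),
      ofReal_integral_norm_pow f (by norm_num)]

theorem volume_lt_sqrt_sectorSq_le {N : ℕ} (hN : 0 < N) {A : ℝ}
    (h4 : ∀ f : 𝓢(Plane, ℂ), ∫⁻ x, ENNReal.ofReal (sectorSq N f x) ^ 2 ≤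
      ENNReal.ofReal A * ∫⁻ x, ENNReal.ofReal (‖f x‖ ^ 4)) (f : 𝓢(Plane, ℂ)) {t : ℝ} (ht : 0 < t) :
    volume {x | t < √(sectorSq N f x)} ≤
      ENNReal.ofReal (4 * t ^ (-2 : ℝ)) *
          (∫⁻ x, if t < ‖f x‖ then ENNReal.ofReal (‖f x‖ ^ 2) else 0) +
        ENNReal.ofReal (16 * A * t ^ (-4 : ℝ)) *
          ∫⁻ x, if ‖f x‖ / 2 ≤ t then ENNReal.ofReal (‖f x‖ ^ 4) else 0 := by
  obtain ⟨g, hg, hfg, hg0, hfg0⟩ := exists_schwartz_truncation f ht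
  have hsub : {x | t < √(sectorSq N f x)} ⊆
      {x | ENNReal.ofReal (t ^ 2 / 4) ≤ ENNReal.ofReal (sectorSq N g x)} ∪
      {x | ENNReal.ofReal (t ^ 4 / 16) ≤ ENNReal.ofReal (sectorSq N (f - g) x) ^ 2} := by
    intro x hx
    have hx : t < √(sectorSq N f x) := hx
    have h1 : t ^ 2 < sectorSq N f x := (Real.lt_sqrt ht.le).1 hx
    have h2 := sectorSq_le_add N f g x
    by_cases h3 : t ^ 2 / 4 ≤ sectorSq N g x
    · exact Or.inl (ENNReal.ofReal_le_ofReal h3)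
    · refine Or.inr ?_
      have h5 : t ^ 2 / 4 ≤ sectorSq N (f - g) x := by linarith
      rw [Set.mem_ofPred_eq, ← ENNReal.ofReal_pow (sectorSq_nonneg _ _ _)]
      refine ENNReal.ofReal_le_ofReal ?_
      calc t ^ 4 / 16 = (t ^ 2 / 4) ^ 2 := by ring
        _ ≤ _ := by gcongr
  refine (measure_mono hsub).trans ((measure_union_le _ _).trans (add_le_add ?_ ?_))
  · refine (meas_ge_le_lintegral_div (continuous_sectorSq N g).measurable.ennreal_ofReal.aemeasurable
      (by simpa using by positivity) ENNReal.ofReal_ne_top).trans ?_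
    rw [div_eq_mul_inv, mul_comm, ← ENNReal.ofReal_inv_of_pos (by positivity)]
    refine mul_le_mul' (le_of_eq ?_) ((lintegral_sectorSq_le hN g).trans (lintegral_mono fun x => ?_))
    · rw [Real.rpow_neg ht.le, Real.rpow_ofNat, inv_div, div_eq_mul_inv]
    · beta_reduce
      split_ifs with h
      · exact ENNReal.ofReal_le_ofReal (by gcongr; exact hg x)
      · rw [hg0 x (not_lt.1 h)]
        simp
  · refine (meas_ge_le_lintegral_div
      ((continuous_sectorSq N (f - g)).measurable.ennreal_ofReal.pow_const 2).aemeasurable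
      (by simpa using by positivity) ENNReal.ofReal_ne_top).trans ?_
    rw [div_eq_mul_inv, mul_comm, ← ENNReal.ofReal_inv_of_pos (by positivity)]
    refine (mul_le_mul_right (h4 (f - g)) _).trans ?_
    rw [← mul_assoc, ← ENNReal.ofReal_mul (by positivity)]
    refine mul_le_mul' (le_of_eq ?_) (lintegral_mono fun x => ?_)
    · rw [Real.rpow_neg ht.le, Real.rpow_ofNat, inv_div, div_eq_mul_inv]
      congr 1
      ring
    · beta_reduce
      split_ifs with h
      · exact ENNReal.ofReal_le_ofReal (by gcongr; exact hfg x)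
      · rw [hfg0 x (by linarith)]
        simp

theorem exists_lintegral_sqrt_sectorSq_rpow_le {p : ℝ} (hp2 : 2 ≤ p) (hp4 : p ≤ 4) :
    ∃ K : ℝ, 0 < K ∧ ∀ (N : ℕ) (A : ℝ), 0 < N → 1 ≤ A →
      (∀ f : 𝓢(Plane, ℂ), ∫⁻ x, ENNReal.ofReal (sectorSq N f x) ^ 2 ≤
        ENNReal.ofReal A * ∫⁻ x, ENNReal.ofReal (‖f x‖ ^ 4)) → ∀ f : 𝓢(Plane, ℂ),
      ∫⁻ x, ENNReal.ofReal (√(sectorSq N f x) ^ p) ≤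
        ENNReal.ofReal (K * A) * ∫⁻ x, ENNReal.ofReal (‖f x‖ ^ p) := by
  rcases hp2.eq_or_lt with rfl | h2
  · refine ⟨1, one_pos, fun N A hN hA _ f => ?_⟩
    simp_rw [Real.rpow_ofNat, Real.sq_sqrt (sectorSq_nonneg _ _ _)]
    refine (lintegral_sectorSq_le hN f).trans (le_mul_of_one_le_left' ?_)
    rw [one_mul, ← ENNReal.ofReal_one]
    exact ENNReal.ofReal_le_ofReal hA
  rcases hp4.eq_or_lt with rfl | h4
  · refine ⟨1, one_pos, fun N A hN hA h f => ?_⟩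
    have e : ∀ x, ENNReal.ofReal (√(sectorSq N f x) ^ (4 : ℝ)) =
        ENNReal.ofReal (sectorSq N f x) ^ 2 := fun x => by
      rw [← ENNReal.ofReal_pow (sectorSq_nonneg _ _ _), Real.rpow_ofNat,
        show √(sectorSq N f x) ^ 4 = (√(sectorSq N f x) ^ 2) ^ 2 by ring,
        Real.sq_sqrt (sectorSq_nonneg _ _ _)]
    simp_rw [e, Real.rpow_ofNat, one_mul]
    exact h f
  have h2' : 0 < p - 2 := by linarith
  have h4' : 0 < 4 - p := by linarith
  refine ⟨p * (4 / (p - 2) + 64 / (4 - p)), by positivity, fun N A hN hA h f => ?_⟩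
  refine (lintegral_rpow_le_of_distribution (A := A) h2 h4 (by linarith) (F := fun x => ‖f x‖)
    f.continuous.norm.measurable (continuous_sectorSq N f).sqrt.measurable
    (fun x => norm_nonneg _) (fun x => Real.sqrt_nonneg _)
    fun t ht => volume_lt_sqrt_sectorSq_le hN h f ht).trans ?_
  refine mul_le_mul_left (ENNReal.ofReal_le_ofReal ?_) _
  rw [mul_assoc, add_mul, div_mul_eq_mul_div 64]
  gcongr
  exact le_mul_of_one_le_right (by positivity) hA

theorem exists_pow_ten_le_rpow {ε : ℝ} (hε : 0 < ε) : ∃ K : ℝ, 0 < K ∧ ∀ N : ℕ, 2 ≤ N →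
    ∃ n : ℕ, 2 * N ≤ 2 ^ n ∧ 2 ^ n ≤ 4 * N ∧ ((n : ℝ) + 1) ^ 10 ≤ K * (N : ℝ) ^ ε := by
  have hlog : (0 : ℝ) < Real.log 2 := Real.log_pos (by norm_num)
  set c : ℝ := ε / 10 * Real.log 2 with hc
  have hc0 : 0 < c := by positivity
  refine ⟨(Real.exp (3 * c) / c) ^ 10, by positivity, fun N hN => ⟨Nat.clog 2 (2 * N),
    Nat.le_pow_clog (by norm_num) _, ?_, ?_⟩⟩
  all_goals
    have h1 : 2 ^ (Nat.clog 2 (2 * N)).pred < 2 * N := Nat.pow_pred_clog_lt_self (by norm_num)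
      (by omega)
    have h0 : 0 < Nat.clog 2 (2 * N) := Nat.clog_pos (by norm_num) (by omega)
    obtain ⟨k, hk⟩ := Nat.exists_eq_succ_of_ne_zero h0.ne'
    rw [hk, Nat.pred_succ] at h1
    rw [hk]
  · rw [pow_succ]
    omega
  · have h2 : (2 : ℝ) ^ k ≤ 2 * N := by exact_mod_cast h1.le
    have hN0 : (0 : ℝ) < N := by exact_mod_cast (by omega : 0 < N)
    have h3 : (k : ℝ) * Real.log 2 ≤ Real.log 2 + Real.log N := by
      rw [← Real.log_pow, ← Real.log_mul (by norm_num) hN0.ne']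
      exact Real.log_le_log (by positivity) h2
    have h4 : ((k.succ : ℕ) : ℝ) + 1 ≤ Real.exp (c * (k + 2)) / c := by
      rw [le_div_iff₀ hc0]
      have := Real.add_one_le_exp (c * (k + 2))
      push_cast
      nlinarith
    have h5 : Real.exp (c * (k + 2)) ≤ Real.exp (3 * c) * (N : ℝ) ^ (ε / 10) := by
      rw [Real.rpow_def_of_pos hN0, ← Real.exp_add]
      refine Real.exp_le_exp.2 ?_
      have : ε / 10 * (k * Real.log 2) ≤ ε / 10 * (Real.log 2 + Real.log N) := by gcongr
      rw [hc]
      nlinarith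
    calc ((k.succ : ℕ) + 1 : ℝ) ^ 10 ≤ (Real.exp (c * (k + 2)) / c) ^ 10 := by gcongr
      _ ≤ (Real.exp (3 * c) * (N : ℝ) ^ (ε / 10) / c) ^ 10 := by gcongr
      _ = (Real.exp (3 * c) / c) ^ 10 * ((N : ℝ) ^ (ε / 10)) ^ 10 := by ring
      _ = _ := by
        rw [← Real.rpow_natCast ((N : ℝ) ^ (ε / 10)), ← Real.rpow_mul hN0.le]
        congr 2
        push_cast
        ring

end PlaneSquareFunctions

theorem cordoba_sectorial_square_function (p : ℝ) (hp2 : 2 ≤ p) (hp4 : p ≤ 4)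
    (ε : ℝ) (hε : 0 < ε) :
    ∃ C : ℝ, 0 < C ∧
      ∀ N : ℕ, 2 ≤ N →
        ∀ f : SchwartzMap (EuclideanSpace ℝ (Fin 2)) ℂ,
          eLpNorm
              (fun x => Real.sqrt
                (∑ m ∈ Finset.range N, ‖freqProj2 (equiangularSector N m) (⇑f) x‖ ^ 2))
              (ENNReal.ofReal p) volume ≤
            ENNReal.ofReal (C * (N : ℝ) ^ ε) *
              eLpNorm (⇑f) (ENNReal.ofReal p) volume := by
  obtain ⟨C, hC, h4⟩ := exists_lintegral_sectorSq_sq_le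
  obtain ⟨K, hK, hp⟩ := exists_lintegral_sqrt_sectorSq_rpow_le hp2 hp4
  obtain ⟨L, hL, hn⟩ := exists_pow_ten_le_rpow hε
  refine ⟨(K + 1) * ((C + 1) * (L + 1)), by positivity, fun N hN f => ?_⟩
  obtain ⟨n, hn1, hn2, hn3⟩ := hn N hN
  have hNε : (1 : ℝ) ≤ (N : ℝ) ^ ε :=
    Real.one_le_rpow (by exact_mod_cast (by omega : 1 ≤ N)) hε.le
  set A : ℝ := (C + 1) * ((L + 1) * (N : ℝ) ^ ε) with hA
  have hLA : 1 ≤ (L + 1) * (N : ℝ) ^ ε := one_le_mul_of_one_le_of_one_le (by linarith) hNε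
  have hA1 : 1 ≤ A := one_le_mul_of_one_le_of_one_le (by linarith) hLA
  have hKA : 1 ≤ (K + 1) * A := one_le_mul_of_one_le_of_one_le (by linarith) hA1
  have hmain := hp N A (by omega) hA1 (fun g => by
    refine (h4 N n (by omega) hn1 hn2 g).trans ?_
    refine mul_le_mul_left (ENNReal.ofReal_le_ofReal (mul_le_mul (by linarith) (hn3.trans ?_)
      (by positivity) (by linarith))) _
    gcongr
    linarith) f
  have hp0 : 0 < p := by linarith
  have e1 : (ENNReal.ofReal p).toReal = p := ENNReal.toReal_ofReal hp0.le
  have hne : ENNReal.ofReal p ≠ 0 := by simpa using hp0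
  rw [eLpNorm_eq_lintegral_rpow_enorm_toReal hne ENNReal.ofReal_ne_top,
    eLpNorm_eq_lintegral_rpow_enorm_toReal hne ENNReal.ofReal_ne_top, e1]
  have e2 : ∀ x, ‖√(∑ m ∈ Finset.range N, ‖freqProj2 (equiangularSector N m) f x‖ ^ 2)‖ₑ ^ p =
      ENNReal.ofReal (√(sectorSq N f x) ^ p) := fun x => by
    rw [Real.enorm_of_nonneg (Real.sqrt_nonneg _), ENNReal.ofReal_rpow_of_nonneg
      (Real.sqrt_nonneg _) hp0.le]
    rfl
  have e3 : ∀ x, ‖f x‖ₑ ^ p = ENNReal.ofReal (‖f x‖ ^ p) := fun x => by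
    rw [← ofReal_norm, ENNReal.ofReal_rpow_of_nonneg (norm_nonneg _) hp0.le]
  simp_rw [e2, e3]
  refine (ENNReal.rpow_le_rpow hmain (by positivity)).trans ?_
  rw [ENNReal.mul_rpow_of_nonneg _ _ (by positivity)]
  gcongr
  have hB : ENNReal.ofReal (K * A) ≤ ENNReal.ofReal ((K + 1) * A) := by
    gcongr
    linarith
  have hB1 : 1 ≤ ENNReal.ofReal ((K + 1) * A) := by
    rw [← ENNReal.ofReal_one]
    exact ENNReal.ofReal_le_ofReal hKA
  calc ENNReal.ofReal (K * A) ^ (1 / p) ≤ ENNReal.ofReal ((K + 1) * A) ^ (1 / p) := by gcongr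
    _ ≤ ENNReal.ofReal ((K + 1) * A) ^ (1 : ℝ) := by
        refine ENNReal.rpow_le_rpow_of_exponent_le hB1 ?_
        rw [div_le_one hp0]
        linarith
    _ = _ := by
        rw [ENNReal.rpow_one, hA]
        congr 1
        ring
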